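/- For every n ≥ 4 there exists ε'(n) > 0 such that any smooth solution u to the special Lagrangian equation ∑_{i=1}^n arctan λᵢ(x) = c on all of ℝⁿ whose Hessian eigenvalues satisfy |λᵢ(x)| ≤ √3 + ε'(n) for all i and all x ∈ ℝⁿ is a quadratic polynomial. -/

import Mathlib

noncomputable section

/-- The Hessian matrix `D²u(x)`, with entries `∂ᵢ∂ⱼ u (x)`. -/
def Hess {n : ℕ} (u : EuclideanSpace ℝ (Fin n) → ℝ) (x : EuclideanSpace ℝ (Fin n)) :
    Matrix (Fin n) (Fin n) ℝ :=
  Matrix.of fun i j =>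
    iteratedFDeriv ℝ 2 u x ![EuclideanSpace.single i 1, EuclideanSpace.single j 1]

/-- The induced metric `g = I + D²u · D²u` on the gradient graph `(x, ∇u(x))`. -/
def gMat {n : ℕ} (u : EuclideanSpace ℝ (Fin n) → ℝ) (x : EuclideanSpace ℝ (Fin n)) :
    Matrix (Fin n) (Fin n) ℝ :=
  1 + Hess u x * Hess u x

/-- The Laplace–Beltrami operator `Δ_g v = ∑ g^{ij} ∂ᵢ∂ⱼ v` of the induced metric. -/
def lapg {n : ℕ} (u v : EuclideanSpace ℝ (Fin n) → ℝ) (x : EuclideanSpace ℝ (Fin n)) : ℝ :=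
  ∑ i, ∑ j, (gMat u x)⁻¹ i j *
    iteratedFDeriv ℝ 2 v x ![EuclideanSpace.single i 1, EuclideanSpace.single j 1]

/-- The squared metric gradient norm `|∇_g v|²_g = ∑ g^{ij} ∂ᵢv ∂ⱼv`. -/
def gradSq {n : ℕ} (u v : EuclideanSpace ℝ (Fin n) → ℝ) (x : EuclideanSpace ℝ (Fin n)) : ℝ :=
  ∑ i, ∑ j, (gMat u x)⁻¹ i j * fderiv ℝ v x (EuclideanSpace.single i 1) *
    fderiv ℝ v x (EuclideanSpace.single j 1)

/-- The volume element `V = √(det g)`. -/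
def Vol {n : ℕ} (u : EuclideanSpace ℝ (Fin n) → ℝ) (x : EuclideanSpace ℝ (Fin n)) : ℝ :=
  Real.sqrt ((gMat u x).det)

end

/-- pair coefficient -/
def QQ (x y : ℝ) : ℝ := (1+x^2)*(1+y^2)+x*y*(2+x^2+y^2)

def SS (x y z : ℝ) : ℝ := QQ x y + QQ y z + QQ z x

theorem SS_zero (x w : ℝ) (hx : 0 ≤ x) (hw : 0 ≤ w) (hx' : x^2 ≤ 3) (hw' : w^2 ≤ 3) :
    0 ≤ SS x 0 (-w) := by
  have hb : x * w ≤ 3 := by nlinarith [sq_nonneg (x - w)]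
  have hb0 : 0 ≤ x * w := mul_nonneg hx hw
  have e : SS x 0 (-w) = 3 + 2*(x^2+w^2) - 2*(x*w) - (x^2+w^2)*(x*w) + (x*w)^2 := by
    unfold SS QQ; ring
  rw [e]
  by_cases h : x * w ≤ 2
  · nlinarith [mul_nonneg (sub_nonneg.2 h) (sq_nonneg (x-w)), mul_nonneg (sub_nonneg.2 hb) hb0]
  · push Not at h
    -- a ≤ 3 + b²/3
    have ha : x^2 + w^2 ≤ 3 + (x*w)^2/3 := by nlinarith [mul_nonneg (sub_nonneg.2 hx') (sub_nonneg.2 hw')]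
    have := mul_le_mul_of_nonneg_left ha (sub_nonneg.2 h.le)
    set b := x * w
    set a := x^2+w^2
    have : 0 ≤ (3 - b) * (b^2 - 2*b + 9) := mul_nonneg (by linarith) (by nlinarith [sq_nonneg (b-1)])
    nlinarith

theorem SS_ge (x y w : ℝ) (hx : 0 ≤ x) (hy : 0 ≤ y) (hw : 0 ≤ w) (hx' : x^2 ≤ 3) (hw' : w^2 ≤ 3)
    (h : w ≤ x) : 0 ≤ SS x y (-w) := by
  have h0 := SS_zero x w hx hw hx' hw'
  have e : SS x y (-w) = SS x 0 (-w) + y * ((x - w) * (2 + x^2 + x*w + w^2)) + y^2*(2+x^2+w^2)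
     + y^3*(x-w) := by unfold SS QQ; ring
  rw [e]
  have : 0 ≤ x - w := sub_nonneg.2 h
  positivity

theorem SS_diag_aux (a w : ℝ) (ha : 0 ≤ a) (hw : 0 ≤ w) (hw' : w^2 ≤ 3.24) :
    1 ≤ SS a a (-w) := by
  have e : SS a a (-w) = 3+6*a^2+3*a^4+2*w^2-4*(a*w)-2*a^2*(a*w)+2*(a*w)^2-2*(a*w)*w^2 := by
    unfold SS QQ; ring
  have hb : 0 ≤ a * w := mul_nonneg ha hw
  have := mul_le_mul_of_nonneg_left hw' hb
  rw [e]
  have hb2 : (a*w)^2 ≤ 3.24 * a^2 := by nlinarith [sq_nonneg a]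
  nlinarith [sq_nonneg (a^2 - 0.6), sq_nonneg (a*w-1.4), sq_nonneg (w - 2.2*a), sq_nonneg (a^2 - a*w +0.8), sq_nonneg (a^2 - 0.5 * (a*w)), sq_nonneg (a^2-(a*w))]

theorem SS_pos_pos (x y w : ℝ) (hx : 0 ≤ x) (hy : 0 ≤ y) (hw : 0 ≤ w) (hx' : x^2 ≤ 3)
    (hy' : y^2 ≤ 3) (hw' : w^2 ≤ 3) : 0 ≤ SS x y (-w) := by
  by_cases h1 : w ≤ x
  · exact SS_ge x y w hx hy hw hx' hw' h1
  by_cases h2 : w ≤ y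
  · have := SS_ge y x w hy hx hw hy' hw' h2
    have e : SS x y (-w) = SS y x (-w) := by unfold SS QQ; ring
    rwa [e]
  push Not at h1 h2
  -- concavity in q
  set f : ℝ → ℝ := fun q => (3+q-w*(x+y))*(1-q+w*(x+y))+(x+y-w)^2*(2+q-w*(x+y))+3*q*w*(x+y-w)
    with hf
  have e : SS x y (-w) = f (x*y) := by simp only [hf]; unfold SS QQ; ring
  have hq1 : 0 ≤ f ((x+y)^2/4) := by
    have := SS_diag_aux ((x+y)/2) w (by positivity) hw (by linarith)
    have e : SS ((x+y)/2) ((x+y)/2) (-w) = f ((x+y)^2/4) := by simp only [hf]; unfold SS QQ; ring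
    linarith
  have key : ∀ q0, q0 ≤ x*y → 0 ≤ f q0 → 0 ≤ f (x*y) := by
    intro q0 h0 hf0
    have hq : x*y ≤ (x+y)^2/4 := by nlinarith [sq_nonneg (x-y)]
    rcases eq_or_lt_of_le (h0.trans hq) with h | h
    · have : x*y = q0 := by linarith
      rwa [this]
    · have hpos : 0 < (x+y)^2/4 - q0 := by linarith
      have id : ((x+y)^2/4 - q0) * f (x*y) = ((x+y)^2/4 - x*y) * f q0
          + (x*y - q0) * f ((x+y)^2/4)
          + (x*y - q0) * ((x+y)^2/4 - x*y) * ((x+y)^2/4 - q0) := by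
        simp only [hf]; ring
      have : 0 ≤ ((x+y)^2/4 - q0) * f (x*y) := by
        rw [id]
        have a1 := sub_nonneg.2 h0
        have a2 := sub_nonneg.2 hq
        positivity
      exact nonneg_of_mul_nonneg_right this hpos
  rw [e]
  by_cases h3 : x + y ≤ w
  · apply key 0 (mul_nonneg hx hy)
    have := SS_zero (x+y) w (by positivity) hw (by nlinarith) hw'
    have e : SS (x+y) 0 (-w) = f 0 := by simp only [hf]; unfold SS QQ; ring
    rwa [← e]
  · push Not at h3
    apply key (w*(x+y-w)) (by nlinarith)
    have := SS_ge w (x+y-w) w hw (by linarith) hw hw' hw' le_rfl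
    have e : SS w (x+y-w) (-w) = f (w*(x+y-w)) := by simp only [hf]; unfold SS QQ; ring
    rwa [← e]

theorem SS_all_pos (x y z : ℝ) (hx : 0 ≤ x) (hy : 0 ≤ y) (hz : 0 ≤ z) : 3 ≤ SS x y z := by
  have e : SS x y z = 3 + (2*(x^2+y^2+z^2)+(x^2*y^2+y^2*z^2+z^2*x^2)+2*(x*y+y*z+z*x)
    + (x*y*(x^2+y^2)+y*z*(y^2+z^2)+z*x*(z^2+x^2))) := by unfold SS QQ; ring
  rw [e]
  have : 0 ≤ (2*(x^2+y^2+z^2)+(x^2*y^2+y^2*z^2+z^2*x^2)+2*(x*y+y*z+z*x)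
    + (x*y*(x^2+y^2)+y*z*(y^2+z^2)+z*x*(z^2+x^2))) := by positivity
  linarith

theorem SS_neg (x y z : ℝ) : SS (-x) (-y) (-z) = SS x y z := by unfold SS QQ; ring
theorem SS_rot (x y z : ℝ) : SS x y z = SS y z x := by unfold SS QQ; ring

theorem SS_nonneg_box (x y z : ℝ) (hx : x^2 ≤ 3) (hy : y^2 ≤ 3) (hz : z^2 ≤ 3) : 0 ≤ SS x y z := by
  have main : ∀ x y z : ℝ, x^2 ≤ 3 → y^2 ≤ 3 → z^2 ≤ 3 → 0 ≤ x → 0 ≤ y → 0 ≤ SS x y z := by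
    intro x y z hx hy hz h1 h2
    rcases le_total 0 z with h | h
    · linarith [SS_all_pos x y z h1 h2 h]
    · have := SS_pos_pos x y (-z) h1 h2 (by linarith) hx hy (by simpa using hz)
      simpa using this
  have main' : ∀ x y z : ℝ, x^2 ≤ 3 → y^2 ≤ 3 → z^2 ≤ 3 → x ≤ 0 → y ≤ 0 → 0 ≤ SS x y z := by
    intro x y z hx hy hz h1 h2
    rw [← SS_neg]
    exact main _ _ _ (by simpa using hx) (by simpa using hy) (by simpa using hz) (by linarith) (by linarith)
  rcases le_total 0 x with h1 | h1 <;> rcases le_total 0 y with h2 | h2 <;> rcases le_total 0 z with h3 | h3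
  · exact main _ _ _ hx hy hz h1 h2
  · exact main _ _ _ hx hy hz h1 h2
  · rw [SS_rot, SS_rot]; exact main _ _ _ hz hx hy h3 h1
  · rw [SS_rot]; exact main' _ _ _ hy hz hx h2 h3
  · rw [SS_rot]; exact main _ _ _ hy hz hx h2 h3
  · rw [SS_rot, SS_rot]; exact main' _ _ _ hz hx hy h3 h1
  · exact main' _ _ _ hx hy hz h1 h2
  · exact main' _ _ _ hx hy hz h1 h2

theorem SS_diag (x z : ℝ) (hz : z^2 ≤ 3.24) : 1 ≤ SS x x z := by
  rcases le_total 0 x with h1 | h1 <;> rcases le_total 0 z with h3 | h3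
  · linarith [SS_all_pos x x z h1 h1 h3]
  · have := SS_diag_aux x (-z) h1 (by linarith) (by simpa using hz)
    simpa using this
  · rw [← SS_neg]
    exact SS_diag_aux (-x) z (by linarith) h3 hz
  · rw [← SS_neg]
    linarith [SS_all_pos (-x) (-x) (-z) (by linarith) (by linarith) (by linarith)]

set_option maxHeartbeats 2000000 in
theorem SS_lower (d x y z : ℝ) (hd : 0 ≤ d) (hd' : d ≤ 0.03) (hx : x^2 ≤ 3*(1+d)^2)
    (hy : y^2 ≤ 3*(1+d)^2) (hz : z^2 ≤ 3*(1+d)^2) : -(200*d) ≤ SS x y z := by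
  obtain ⟨a, rfl⟩ : ∃ a, x = (1+d)*a := ⟨x/(1+d), by field_simp⟩
  obtain ⟨b, rfl⟩ : ∃ a, y = (1+d)*a := ⟨y/(1+d), by field_simp⟩
  obtain ⟨c, rfl⟩ : ∃ a, z = (1+d)*a := ⟨z/(1+d), by field_simp⟩
  have hp : 0 < (1+d)^2 := by positivity
  have red : ∀ a : ℝ, ((1+d)*a)^2 ≤ 3*(1+d)^2 → a^2 ≤ 3 := by
    intro a h
    by_contra hh
    push Not at hh
    nlinarith
  have ha := red a hx
  have hb := red b hy
  have hc := red c hz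
  have h0 := SS_nonneg_box a b c ha hb hc
  set A2 := 2*(a^2+b^2+c^2)+2*(a*b+b*c+c*a) with hA2
  set A4 := (a^2*b^2+b^2*c^2+c^2*a^2)+(a*b*(a^2+b^2)+b*c*(b^2+c^2)+c*a*(c^2+a^2)) with hA4
  have e1 : SS a b c = 3 + A2 + A4 := by simp only [hA2, hA4]; unfold SS QQ; ring
  have e2 : SS ((1+d)*a) ((1+d)*b) ((1+d)*c) = 3 + (1+d)^2*A2 + (1+d)^4*A4 := by
    simp only [hA2, hA4]; unfold SS QQ; ring
  have hA2n : 0 ≤ A2 := by simp only [hA2]; nlinarith [sq_nonneg (a+b+c), sq_nonneg a, sq_nonneg b, sq_nonneg c]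
  have hA2u : A2 ≤ 36 := by simp only [hA2]; nlinarith [sq_nonneg (a-b), sq_nonneg (b-c), sq_nonneg (c-a)]
  rw [e2]
  rw [e1] at h0
  have q1 : 0 ≤ (1+d)^2 - 1 := by nlinarith
  have q2 : 0 ≤ (1+d)^4 - 1 := by
    have : (1:ℝ) ≤ (1+d)^4 := one_le_pow₀ (by linarith)
    linarith
  have q3 : (1+d)^4 - 1 ≤ 5*d := by
    have : (1+d)^4 - 1 = d*(4+6*d+4*d^2+d^3) := by ring
    rw [this]
    have h2 : d^2 ≤ 0.03 := by nlinarith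
    have h3 : d^3 ≤ 0.03 := by
      have : d^3 = d^2*d := by ring
      rw [this]; nlinarith [sq_nonneg d]
    have h5 : 4+6*d+4*d^2+d^3 ≤ 5 := by linarith
    calc d*(4+6*d+4*d^2+d^3) ≤ d * 5 := mul_le_mul_of_nonneg_left h5 hd
      _ = 5 * d := by ring
  clear_value A2 A4
  generalize (1+d)^4 = m at *
  generalize (1+d)^2 = l at *
  have r1 : 0 ≤ m * (3 + A2 + A4) := mul_nonneg (by linarith) h0
  have r2 : 0 ≤ (l - 1) * A2 := mul_nonneg q1 hA2n
  have r3 : (m-1) * (3 + A2) ≤ (5*d) * 39 :=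
    mul_le_mul q3 (by linarith) (by linarith) (by linarith)
  linarith

open MeasureTheory Set Filter Topology
open scoped ContDiff

abbrev EE (n : ℕ) := EuclideanSpace ℝ (Fin n)

noncomputable def pd {n : ℕ} (i : Fin n) (f : EE n → ℝ) : EE n → ℝ :=
  fun x => fderiv ℝ f x (EuclideanSpace.single i 1)

def Sm {n : ℕ} (f : EE n → ℝ) : Prop := ContDiff ℝ ∞ f

section pdcalc
variable {n : ℕ} {f g : EE n → ℝ} {i j : Fin n} {x : EE n}

theorem Sm.diff (h : Sm f) : Differentiable ℝ f := ContDiff.differentiable h (by simp)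
theorem Sm.da (h : Sm f) : DifferentiableAt ℝ f x := h.diff x
theorem Sm.cont (h : Sm f) : Continuous f := ContDiff.continuous h
theorem Sm.pd (h : Sm f) (i : Fin n) : Sm (pd i f) := by
  unfold Sm _root_.pd
  have h1 : ContDiff ℝ ∞ (fderiv ℝ f) := ContDiff.fderiv_right h (by simp)
  exact h1.clm_apply contDiff_const
theorem Sm.add (h : Sm f) (h' : Sm g) : Sm (fun x => f x + g x) := ContDiff.add h h'
theorem Sm.sub (h : Sm f) (h' : Sm g) : Sm (fun x => f x - g x) := ContDiff.sub h h'
theorem Sm.mul (h : Sm f) (h' : Sm g) : Sm (fun x => f x * g x) := ContDiff.mul h h'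
theorem Sm.neg (h : Sm f) : Sm (fun x => - f x) := ContDiff.neg h
theorem Sm.pow (h : Sm f) (k : ℕ) : Sm (fun x => f x ^ k) := ContDiff.pow h k
theorem Sm.const (c : ℝ) : Sm (fun _ : EE n => c) := contDiff_const
theorem Sm.sum {ι : Type*} {s : Finset ι} {F : ι → EE n → ℝ} (h : ∀ a, Sm (F a)) :
    Sm (fun x => ∑ a ∈ s, F a x) := ContDiff.sum (fun a _ => h a)
theorem Sm.prod {ι : Type*} {s : Finset ι} {F : ι → EE n → ℝ} (h : ∀ a, Sm (F a)) :
    Sm (fun x => ∏ a ∈ s, F a x) := contDiff_prod (fun a _ => h a)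
theorem Sm.coord (i : Fin n) : Sm (fun x : EE n => x i) := by
  unfold Sm; fun_prop

theorem pd_const (c : ℝ) : pd i (fun _ => c) x = 0 := by simp [pd]
theorem pd_add (hf : DifferentiableAt ℝ f x) (hg : DifferentiableAt ℝ g x) :
    pd i (fun x => f x + g x) x = pd i f x + pd i g x := by
  simp only [pd]; rw [fderiv_fun_add hf hg]; rfl
theorem pd_sub (hf : DifferentiableAt ℝ f x) (hg : DifferentiableAt ℝ g x) :
    pd i (fun x => f x - g x) x = pd i f x - pd i g x := by
  simp only [pd]; rw [fderiv_fun_sub hf hg]; rfl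
theorem pd_neg : pd i (fun x => - f x) x = - pd i f x := by
  simp only [pd]; rw [fderiv_fun_neg]; rfl
theorem pd_mul (hf : DifferentiableAt ℝ f x) (hg : DifferentiableAt ℝ g x) :
    pd i (fun x => f x * g x) x = pd i f x * g x + f x * pd i g x := by
  simp only [pd]; rw [fderiv_fun_mul hf hg]; simp; ring
theorem pd_const_mul (c : ℝ) (hf : DifferentiableAt ℝ f x) :
    pd i (fun x => c * f x) x = c * pd i f x := by
  rw [pd_mul (by fun_prop) hf, pd_const]; ring
theorem pd_sum {ι : Type*} {s : Finset ι} {F : ι → EE n → ℝ}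
    (h : ∀ a, DifferentiableAt ℝ (F a) x) :
    pd i (fun x => ∑ a ∈ s, F a x) x = ∑ a ∈ s, pd i (F a) x := by
  simp only [pd]; rw [fderiv_fun_sum (fun a _ => h a)]; simp
theorem pd_coord : pd i (fun x : EE n => x j) x = if j = i then 1 else 0 := by
  simp only [pd]
  have : (fun x : EE n => x j) = (EuclideanSpace.proj j : EE n →L[ℝ] ℝ) := rfl
  rw [this, ContinuousLinearMap.fderiv]
  simp
theorem pd_sq (hf : DifferentiableAt ℝ f x) :
    pd i (fun x => f x ^ 2) x = 2 * f x * pd i f x := by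
  have : (fun x => f x ^ 2) = fun x => f x * f x := by ext; ring
  rw [this, pd_mul hf hf]; ring
theorem pd_comp {φ : ℝ → ℝ} {φ' : ℝ} (hφ : HasDerivAt φ φ' (f x)) (hf : DifferentiableAt ℝ f x) :
    pd i (fun x => φ (f x)) x = φ' * pd i f x := by
  simp only [pd]
  have := (hφ.comp_hasFDerivAt x hf.hasFDerivAt).fderiv
  have h2 : (fun x => φ (f x)) = φ ∘ f := rfl
  rw [h2, this]; simp

theorem pd_comm (hf : Sm f) : pd i (pd j f) x = pd j (pd i f) x := by
  have h1 : ContDiff ℝ ∞ (fderiv ℝ f) := ContDiff.fderiv_right hf (by simp)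
  have hd : DifferentiableAt ℝ (fderiv ℝ f) x := h1.differentiable (by simp) x
  have hs : IsSymmSndFDerivAt ℝ f x := by
    have : ContDiffAt ℝ ∞ f x := ContDiff.contDiffAt hf
    exact this.isSymmSndFDerivAt (by rw [minSmoothness_of_isRCLikeNormedField]; exact WithTop.coe_le_coe.2 le_top)
  have key : ∀ a b : Fin n, pd a (pd b f) x
      = fderiv ℝ (fderiv ℝ f) x (EuclideanSpace.single a 1) (EuclideanSpace.single b 1) := by
    intro a b
    have : pd b f = fun y => fderiv ℝ f y (EuclideanSpace.single b 1) := rfl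
    rw [this]
    simp only [pd]
    rw [fderiv_clm_apply hd (by fun_prop)]
    simp
  rw [key, key]
  exact hs.eq _ _

theorem pd_comm' (hf : Sm f) : pd i (pd j f) = pd j (pd i f) := by
  ext x; exact pd_comm hf

/-- divergence lemma -/
theorem integral_pd_zero {F : EE n → ℝ} (hF : Differentiable ℝ F) (hc : HasCompactSupport F)
    (hpd : Continuous (pd i F)) : ∫ x, pd i F x = 0 := by
  have hFi : Integrable F := hF.continuous.integrable_of_hasCompactSupport hc
  have hcs : HasCompactSupport (pd i F) := by
    have := hc.fderiv (𝕜 := ℝ)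
    exact this.mono (fun x hx => by
      simp only [Function.mem_support, pd] at hx ⊢
      intro h; apply hx; rw [h]; rfl)
  have hpi : Integrable (pd i F) := hpd.integrable_of_hasCompactSupport hcs
  have := integral_mul_fderiv_eq_neg_fderiv_mul_of_integrable (μ := volume)
    (f := fun _ : EE n => (1:ℝ)) (g := F) (v := EuclideanSpace.single i 1)
    (by simp) (by simp only [one_mul]; exact hpi) (by simpa using hFi) (by intros; fun_prop)
    (fun x _ => hF x)
  simpa [pd] using this

theorem pd_fun_mulVec {m : Fin n → ℝ} : pd i (fun x : EE n => ∑ j, m j * x j) x = m i := by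
  rw [pd_sum (fun a => by fun_prop)]
  have : ∀ a, pd i (fun x : EE n => m a * x a) x = if a = i then m a else 0 := by
    intro a; rw [pd_const_mul _ (Sm.coord a).da, pd_coord]; split_ifs <;> simp
  simp [this]
end pdcalc

theorem jacobi {n : ℕ} (M : ℝ → Matrix (Fin n) (Fin n) ℂ) (M' N : Matrix (Fin n) (Fin n) ℂ) (t : ℝ)
    (hM : ∀ i j, HasDerivAt (fun s => M s i j) (M' i j) t) (hN : M t * N = 1) :
    HasDerivAt (fun s => (M s).det) ((M t).det * (N * M').trace) t := by
  classical
  have gen : ∀ P : ℝ → Matrix (Fin n) (Fin n) ℂ, P t = M t →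
      (∀ i j, HasDerivAt (fun s => P s i j) (M' i j) t) →
      HasDerivAt (fun s => (P s).det) (∑ σ : Equiv.Perm (Fin n), ((Equiv.Perm.sign σ : ℤ) : ℂ) *
        ∑ i, (∏ j ∈ Finset.univ.erase i, M t (σ j) j) • M' (σ i) i) t := by
    intro P hP hd
    simp only [Matrix.det_apply']
    apply HasDerivAt.fun_sum
    intro σ _
    apply HasDerivAt.const_mul
    have := HasDerivAt.fun_finsetProd (u := Finset.univ) (f := fun i s => P s (σ i) i)
      (f' := fun i => M' (σ i) i) (x := t) (fun i _ => hd (σ i) i)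
    rw [hP] at this
    exact this
  have h1 := gen M rfl hM
  have h2 := gen (fun s => M t + ((s - t : ℝ) : ℂ) • M') (by simp) (by
    intro i j
    simp only [Matrix.add_apply, Matrix.smul_apply, smul_eq_mul]
    have : HasDerivAt (fun s : ℝ => ((s - t : ℝ) : ℂ)) ((1:ℝ):ℂ) t :=
      ((hasDerivAt_id t).sub_const t).ofReal_comp
    simpa using (this.mul_const (M' i j)).const_add (M t i j))
  have h3 : HasDerivAt (fun s : ℝ => (M t + ((s - t : ℝ) : ℂ) • M').det)
      ((M t).det * (N * M').trace) t := by
    have e : ∀ s : ℝ, (M t + ((s - t : ℝ) : ℂ) • M').det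
        = (M t).det * (1 + (N * M').trace * ((s - t : ℝ) : ℂ)
          + (Polynomial.eval ((s - t : ℝ) : ℂ) (Matrix.det (1 + (Polynomial.X : Polynomial ℂ) • (N * M').map Polynomial.C)).divX.divX) * ((s - t : ℝ) : ℂ) ^ 2) := by
      intro s
      rw [← Matrix.det_one_add_smul, ← Matrix.det_mul]
      congr 1
      rw [Matrix.mul_add, Matrix.mul_smul, ← Matrix.mul_assoc, hN]; simp
    simp only [e]
    have hl : HasDerivAt (fun s : ℝ => ((s - t : ℝ) : ℂ)) ((1:ℝ):ℂ) t :=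
      ((hasDerivAt_id t).sub_const t).ofReal_comp
    apply HasDerivAt.const_mul
    have hp := (Polynomial.hasDerivAt (Matrix.det (1 + (Polynomial.X : Polynomial ℂ) • (N * M').map Polynomial.C)).divX.divX ((t - t : ℝ) : ℂ)).comp t hl
    have := ((hl.const_mul (N * M').trace).const_add 1).add (hp.mul (hl.pow 2))
    refine HasDerivAt.congr_deriv (f := fun y : ℝ => 1 + (N * M').trace * ((y - t : ℝ) : ℂ) + _) this ?_
    simp
  have e2 := h2.unique h3
  rw [← e2]
  exact h1

open MeasureTheory Set Filter Topology
open scoped ContDiff Matrix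

theorem spec {n : ℕ} {H : Matrix (Fin n) (Fin n) ℝ} (hH : H.IsSymm) :
    ∃ (O : Matrix (Fin n) (Fin n) ℝ) (l : Fin n → ℝ), O * Oᵀ = 1 ∧ Oᵀ * O = 1 ∧
      H = O * Matrix.diagonal l * Oᵀ := by
  have hh : H.IsHermitian := by
    rw [Matrix.IsHermitian, Matrix.conjTranspose_eq_transpose_of_trivial]; exact hH
  refine ⟨(hh.eigenvectorUnitary : Matrix (Fin n) (Fin n) ℝ), hh.eigenvalues, ?_, ?_, ?_⟩
  · have := Unitary.coe_mul_star_self hh.eigenvectorUnitary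
    rwa [Unitary.coe_star, Matrix.star_eq_conjTranspose, Matrix.conjTranspose_eq_transpose_of_trivial] at this
  · have := Unitary.coe_star_mul_self hh.eigenvectorUnitary
    rwa [Matrix.star_eq_conjTranspose, Matrix.conjTranspose_eq_transpose_of_trivial] at this
  · have := hh.spectral_theorem
    rw [Unitary.conjStarAlgAut_apply, Matrix.star_eq_conjTranspose,
      Matrix.conjTranspose_eq_transpose_of_trivial] at this
    simpa [Function.comp_def] using this

section alg
variable {n : ℕ} {H O : Matrix (Fin n) (Fin n) ℝ} {l : Fin n → ℝ}

theorem spec_g (h2 : Oᵀ * O = 1) (h1 : O * Oᵀ = 1)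
    (hH : H = O * Matrix.diagonal l * Oᵀ) :
    1 + H * H = O * Matrix.diagonal (fun i => 1 + l i ^ 2) * Oᵀ := by
  have : Matrix.diagonal (fun i => 1 + l i ^ 2)
      = 1 + Matrix.diagonal l * Matrix.diagonal l := by
    rw [Matrix.diagonal_mul_diagonal, ← Matrix.diagonal_one, Matrix.diagonal_add]
    congr 1; ext i; ring
  rw [this, Matrix.mul_add, Matrix.add_mul, Matrix.mul_one, h1]
  congr 1
  calc H * H = O * Matrix.diagonal l * (Oᵀ * O) * Matrix.diagonal l * Oᵀ := by
        rw [hH]; simp only [Matrix.mul_assoc]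
    _ = _ := by rw [h2]; simp only [Matrix.mul_assoc, Matrix.mul_one]

theorem spec_G (h2 : Oᵀ * O = 1) (h1 : O * Oᵀ = 1)
    (hH : H = O * Matrix.diagonal l * Oᵀ) :
    (1 + H * H)⁻¹ = O * Matrix.diagonal (fun i => (1 + l i ^ 2)⁻¹) * Oᵀ := by
  apply Matrix.inv_eq_right_inv
  rw [spec_g h2 h1 hH]
  calc _ = O * Matrix.diagonal (fun i => 1 + l i ^ 2) * (Oᵀ * O)
        * Matrix.diagonal (fun i => (1 + l i ^ 2)⁻¹) * Oᵀ := by simp only [Matrix.mul_assoc]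
    _ = O * (Matrix.diagonal (fun i => 1 + l i ^ 2)
        * Matrix.diagonal (fun i => (1 + l i ^ 2)⁻¹)) * Oᵀ := by
        rw [h2]; simp only [Matrix.mul_assoc, Matrix.mul_one]
    _ = 1 := by
        rw [Matrix.diagonal_mul_diagonal]
        have : (fun i => (1 + l i ^ 2) * (1 + l i ^ 2)⁻¹) = fun _ => (1:ℝ) := by
          ext i; exact mul_inv_cancel₀ (by positivity)
        rw [this, Matrix.diagonal_one, Matrix.mul_one, h1]

theorem spec_det (h2 : Oᵀ * O = 1) (h1 : O * Oᵀ = 1)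
    (hH : H = O * Matrix.diagonal l * Oᵀ) :
    (1 + H * H).det = ∏ i, (1 + l i ^ 2) := by
  rw [spec_g h2 h1 hH, Matrix.det_mul, Matrix.det_mul, Matrix.det_diagonal]
  have : O.det * Oᵀ.det = 1 := by rw [← Matrix.det_mul, h1, Matrix.det_one]
  linear_combination (∏ i, (1 + l i ^ 2)) * this

theorem orth_norm (h1 : O * Oᵀ = 1) (a : Fin n → ℝ) :
    ∑ k, (Oᵀ *ᵥ a) k ^ 2 = ∑ k, a k ^ 2 := by
  have : (Oᵀ *ᵥ a) ⬝ᵥ (Oᵀ *ᵥ a) = a ⬝ᵥ a := by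
    rw [Matrix.dotProduct_mulVec, Matrix.vecMul_transpose, Matrix.mulVec_mulVec, h1,
      Matrix.one_mulVec]
  simpa [dotProduct, pow_two] using this

theorem spec_bd (h2 : Oᵀ * O = 1) (hH : H = O * Matrix.diagonal l * Oᵀ) {B : ℝ}
    (hB : ∀ v : Fin n → ℝ, ∑ i, (∑ j, H i j * v j) ^ 2 ≤ B * ∑ i, v i ^ 2) (k : Fin n) :
    l k ^ 2 ≤ B := by
  have h := hB (O *ᵥ Pi.single k 1)
  have e1 : H *ᵥ (O *ᵥ Pi.single k 1) = O *ᵥ (l k • Pi.single k 1) := by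
    rw [Matrix.mulVec_mulVec, hH, Matrix.mul_assoc, h2, Matrix.mul_one, ← Matrix.mulVec_mulVec]
    congr 1
    ext i
    simp only [Matrix.mulVec_diagonal, Pi.smul_apply, smul_eq_mul, Pi.single_apply]
    split_ifs with h <;> simp [h]
  have e2 : ∀ v, ∑ i, (O *ᵥ v) i ^ 2 = ∑ i, v i ^ 2 := fun v => by
    simpa using orth_norm (O := Oᵀ) (by simpa using h2) v
  have e3 : ∑ i, (∑ j, H i j * (O *ᵥ Pi.single k 1) j) ^ 2
      = ∑ i, (H *ᵥ (O *ᵥ Pi.single k 1)) i ^ 2 := rfl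
  rw [e3, e1, e2, e2] at h
  have e4 : ∑ i, (Pi.single k (1:ℝ) : Fin n → ℝ) i ^ 2 = 1 := by
    simp [Pi.single_apply]
  have e5 : ∑ i, (l k • Pi.single k (1:ℝ) : Fin n → ℝ) i ^ 2 = l k ^ 2 := by
    simp only [Pi.smul_apply, smul_eq_mul, mul_pow, ← Finset.mul_sum, e4, mul_one]
  rw [e4, e5, mul_one] at h
  exact h

theorem spec_quad {A : Matrix (Fin n) (Fin n) ℝ} {m : Fin n → ℝ}
    (hH : A = O * Matrix.diagonal m * Oᵀ) (a b : Fin n → ℝ) :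
    ∑ i, ∑ j, A i j * a i * b j = ∑ k, m k * (Oᵀ *ᵥ a) k * (Oᵀ *ᵥ b) k := by
  have e : ∑ i, ∑ j, A i j * a i * b j = a ⬝ᵥ (A *ᵥ b) := by
    simp only [dotProduct, Matrix.mulVec, Finset.mul_sum]
    exact Finset.sum_congr rfl fun i _ => Finset.sum_congr rfl fun j _ => by ring
  rw [e, hH, ← Matrix.mulVec_mulVec, ← Matrix.mulVec_mulVec, Matrix.dotProduct_mulVec,
    ← Matrix.mulVec_transpose]
  simp only [dotProduct, Matrix.mulVec_diagonal]
  exact Finset.sum_congr rfl fun i _ => by ring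

/-- lower and upper bounds for the inverse metric -/
theorem G_lower (hs : H.IsSymm) {B : ℝ}
    (hB : ∀ v : Fin n → ℝ, ∑ i, (∑ j, H i j * v j) ^ 2 ≤ B * ∑ i, v i ^ 2) (a : Fin n → ℝ) :
    (1 + B)⁻¹ * ∑ i, a i ^ 2 ≤ ∑ i, ∑ j, (1 + H * H)⁻¹ i j * a i * a j := by
  obtain ⟨O, l, h1, h2, hH⟩ := spec hs
  rw [spec_quad (spec_G h2 h1 hH), ← orth_norm h1, Finset.mul_sum]
  refine Finset.sum_le_sum fun k _ => ?_
  have := spec_bd h2 hH hB k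
  rw [mul_assoc, ← pow_two]
  gcongr

theorem G_upper (hs : H.IsSymm) (z D : Fin n → ℝ) :
    ∑ i, ∑ j, (1 + H * H)⁻¹ i j * (z i + ∑ a, H i a * D a) * (z j + ∑ a, H j a * D a)
     ≤ ∑ i, z i ^ 2 + ∑ i, D i ^ 2 := by
  obtain ⟨O, l, h1, h2, hH⟩ := spec hs
  have e0 : ∀ k, (Oᵀ *ᵥ (fun i => z i + ∑ a, H i a * D a)) k
      = (Oᵀ *ᵥ z) k + l k * (Oᵀ *ᵥ D) k := by
    intro k
    have : (fun i => z i + ∑ a, H i a * D a) = z + H *ᵥ D := rfl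
    rw [this, Matrix.mulVec_add, Matrix.mulVec_mulVec]
    have : Oᵀ * H = Matrix.diagonal l * Oᵀ := by
      rw [hH, ← Matrix.mul_assoc, ← Matrix.mul_assoc, h2, Matrix.one_mul]
    rw [this, ← Matrix.mulVec_mulVec]
    simp only [Pi.add_apply, Matrix.mulVec_diagonal]
  rw [spec_quad (spec_G h2 h1 hH), ← orth_norm h1 z, ← orth_norm h1 D, ← Finset.sum_add_distrib]
  refine Finset.sum_le_sum fun k _ => ?_
  rw [e0, mul_assoc, inv_mul_le_iff₀ (by positivity)]
  nlinarith [sq_nonneg ((Oᵀ *ᵥ D) k - l k * (Oᵀ *ᵥ z) k)]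

theorem det_g_bounds (hs : H.IsSymm) {B : ℝ}
    (hB : ∀ v : Fin n → ℝ, ∑ i, (∑ j, H i j * v j) ^ 2 ≤ B * ∑ i, v i ^ 2) :
    1 ≤ (1 + H * H).det ∧ (1 + H * H).det ≤ (1 + B) ^ n := by
  obtain ⟨O, l, h1, h2, hH⟩ := spec hs
  rw [spec_det h2 h1 hH]
  constructor
  · have := Finset.prod_le_prod (s := Finset.univ) (f := fun _ : Fin n => (1:ℝ))
      (g := fun i => 1 + l i ^ 2) (by simp) (fun i _ => by nlinarith [sq_nonneg (l i)])
    simpa using this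
  · have := Finset.prod_le_prod (s := Finset.univ) (g := fun _ : Fin n => (1 + B))
      (f := fun i => 1 + l i ^ 2) (fun i _ => by positivity)
      (fun i _ => by linarith [spec_bd h2 hH hB i])
    simpa using this
end alg

open MeasureTheory Set Filter Topology
open scoped ContDiff Matrix

noncomputable def Hm {n : ℕ} (u : EE n → ℝ) (x : EE n) : Matrix (Fin n) (Fin n) ℝ :=
  Matrix.of fun i j => pd i (pd j u) x
noncomputable def Tm {n : ℕ} (u : EE n → ℝ) (k : Fin n) (x : EE n) : Matrix (Fin n) (Fin n) ℝ :=
  Matrix.of fun i j => pd k (pd i (pd j u)) x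
noncomputable def gm {n : ℕ} (u : EE n → ℝ) (x : EE n) : Matrix (Fin n) (Fin n) ℝ :=
  1 + Hm u x * Hm u x
noncomputable def Gm {n : ℕ} (u : EE n → ℝ) (x : EE n) : Matrix (Fin n) (Fin n) ℝ := (gm u x)⁻¹
noncomputable def om {n : ℕ} (u : EE n → ℝ) (x : EE n) : ℝ := Real.sqrt (gm u x).det

structure Sol {n : ℕ} (d : ℝ) (u : EE n → ℝ) : Prop where
  sm : Sm u
  hd0 : 0 ≤ d
  hd : d ≤ 0.03
  bd : ∀ x (v : Fin n → ℝ),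
    ∑ i, (∑ j, Hm u x i j * v j) ^ 2 ≤ 3 * (1 + d) ^ 2 * ∑ i, v i ^ 2
  eq : ∃ c : ℂ, c ≠ 0 ∧ ∀ x, ((1 : Matrix (Fin n) (Fin n) ℂ) +
      Complex.I • Complex.ofRealHom.mapMatrix (Hm u x)).det = (om u x : ℂ) * c

def SmM {n : ℕ} (M : EE n → Matrix (Fin n) (Fin n) ℝ) : Prop := ∀ i j, Sm (fun x => M x i j)
noncomputable def pdM {n : ℕ} (k : Fin n) (M : EE n → Matrix (Fin n) (Fin n) ℝ) (x : EE n) :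
    Matrix (Fin n) (Fin n) ℝ := Matrix.of fun i j => pd k (fun y => M y i j) x

section basics
variable {n : ℕ} {u : EE n → ℝ} {x : EE n}

theorem Hm_apply (i j : Fin n) : Hm u x i j = pd i (pd j u) x := rfl
theorem Tm_apply (k i j : Fin n) : Tm u k x i j = pd k (pd i (pd j u)) x := rfl

theorem Hm_symm (hu : Sm u) : (Hm u x).IsSymm := by
  ext i j; exact pd_comm hu

theorem Tm_symm (hu : Sm u) (k : Fin n) : (Tm u k x).IsSymm := by
  ext i j; simp only [Matrix.transpose_apply, Tm_apply]; rw [pd_comm' hu]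

theorem Tm_swap (hu : Sm u) (k i j : Fin n) : Tm u k x i j = Tm u i x k j := by
  simp only [Tm_apply]; rw [pd_comm (hu.pd j)]

theorem Tm_swap2 (hu : Sm u) (k i j : Fin n) : Tm u k x i j = Tm u k x j i := by
  simp only [Tm_apply]; rw [pd_comm' hu]

theorem SmM_H (hu : Sm u) : SmM (Hm u) := fun i j => (hu.pd j).pd i
theorem SmM.mul {M N : EE n → Matrix (Fin n) (Fin n) ℝ} (hM : SmM M) (hN : SmM N) :
    SmM (fun x => M x * N x) := by
  intro i j
  simp only [Matrix.mul_apply]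
  exact Sm.sum fun a => (hM i a).mul (hN a j)
theorem SmM.det {M : EE n → Matrix (Fin n) (Fin n) ℝ} (hM : SmM M) : Sm (fun x => (M x).det) := by
  simp only [Matrix.det_apply']
  exact Sm.sum fun σ => (Sm.const _).mul (Sm.prod fun i => hM _ _)

theorem SmM_g (hu : Sm u) : SmM (gm u) := by
  intro i j
  simp only [gm, Matrix.add_apply]
  exact (Sm.const _).add ((SmM_H hu).mul (SmM_H hu) i j)

theorem bd4 {d : ℝ} (hs : Sol d u) (v : Fin n → ℝ) :
    ∑ i, (∑ j, Hm u x i j * v j) ^ 2 ≤ 4 * ∑ i, v i ^ 2 := by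
  refine (hs.bd x v).trans ?_
  have h1 := hs.hd0
  have h2 := hs.hd
  have : (0:ℝ) ≤ ∑ i, v i ^ 2 := Finset.sum_nonneg fun i _ => sq_nonneg _
  have : 3 * (1 + d) ^ 2 ≤ 4 := by nlinarith
  gcongr

theorem det_g_ge (hu : Sm u) : 1 ≤ (gm u x).det := by
  unfold gm
  obtain ⟨O, l, h1, h2, hH⟩ := spec (Hm_symm (x := x) hu)
  rw [spec_det h2 h1 hH]
  have := Finset.prod_le_prod (s := Finset.univ) (f := fun _ : Fin n => (1:ℝ))
      (g := fun i => 1 + l i ^ 2) (by simp) (fun i _ => by nlinarith [sq_nonneg (l i)])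
  simpa using this

theorem om_ge (hu : Sm u) : 1 ≤ om u x := by
  unfold om; rw [Real.one_le_sqrt]; exact det_g_ge hu
theorem om_pos (hu : Sm u) : 0 < om u x := lt_of_lt_of_le one_pos (om_ge hu)

theorem om_le {d : ℝ} (hs : Sol d u) : om u x ≤ 5 ^ n := by
  have h := (det_g_bounds (Hm_symm (x := x) hs.sm) (fun v => bd4 hs v)).2
  unfold om
  rw [Real.sqrt_le_left (by positivity)]
  refine h.trans ?_
  have : (1:ℝ) + 4 = 5 := by norm_num
  rw [this]
  have : (1:ℝ) ≤ 5 ^ n := one_le_pow₀ (by norm_num)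
  nlinarith

theorem Sm_om (hu : Sm u) : Sm (om u) := by
  unfold om Sm
  exact ContDiff.sqrt (SmM_g hu).det (fun x => by have := det_g_ge (x := x) hu; linarith)

theorem gG (hu : Sm u) : gm u x * Gm u x = 1 :=
  Matrix.mul_nonsing_inv _ (isUnit_iff_ne_zero.2 (by have := det_g_ge (x := x) hu; linarith))
theorem Gg (hu : Sm u) : Gm u x * gm u x = 1 :=
  Matrix.nonsing_inv_mul _ (isUnit_iff_ne_zero.2 (by have := det_g_ge (x := x) hu; linarith))

theorem gm_symm (hu : Sm u) : (gm u x).IsSymm := by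
  have := Hm_symm (x := x) hu
  rw [Matrix.IsSymm] at *
  simp [gm, this]
theorem Gm_symm (hu : Sm u) : (Gm u x).IsSymm := by
  have := gm_symm (x := x) hu
  rw [Matrix.IsSymm] at *
  rw [Gm, Matrix.transpose_nonsing_inv, this]

theorem GH_comm (hu : Sm u) : Gm u x * Hm u x = Hm u x * Gm u x := by
  have : gm u x * Hm u x = Hm u x * gm u x := by
    simp [gm, Matrix.mul_add, Matrix.add_mul, Matrix.mul_assoc]
  calc Gm u x * Hm u x = Gm u x * (Hm u x * gm u x) * Gm u x := by
        rw [Matrix.mul_assoc, Matrix.mul_assoc, gG hu, Matrix.mul_one]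
    _ = (Gm u x * gm u x) * Hm u x * Gm u x := by rw [← this]; simp only [Matrix.mul_assoc]
    _ = _ := by rw [Gg hu, Matrix.one_mul]

theorem SmM_G (hu : Sm u) : SmM (Gm u) := by
  intro i j
  have : (fun x => Gm u x i j) = fun x => ((gm u x).det)⁻¹ *
      ((gm u x).updateRow j (Pi.single i 1)).det := by
    ext x
    rw [Gm, Matrix.inv_def, Matrix.smul_apply, Matrix.adjugate_apply, Ring.inverse_eq_inv',
      smul_eq_mul]
  rw [this]
  refine Sm.mul ?_ ?_
  · exact ContDiff.inv (SmM_g hu).det (fun x => by have := det_g_ge (x := x) hu; linarith)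
  · refine SmM.det (M := fun x => (gm u x).updateRow j (Pi.single i 1)) ?_
    intro a b
    by_cases h : a = j
    · simp only [h, Matrix.updateRow_self]; exact Sm.const _
    · simp only [Matrix.updateRow_ne h]; exact SmM_g hu a b

theorem pdM_mul {k : Fin n} {M N : EE n → Matrix (Fin n) (Fin n) ℝ} (hM : SmM M) (hN : SmM N) :
    pdM k (fun x => M x * N x) x = pdM k M x * N x + M x * pdM k N x := by
  ext i j
  simp only [pdM, Matrix.of_apply, Matrix.mul_apply, Matrix.add_apply]
  rw [pd_sum (fun a => ((hM i a).mul (hN a j)).da), ← Finset.sum_add_distrib]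
  exact Finset.sum_congr rfl fun a _ => pd_mul (hM i a).da (hN a j).da

theorem pdM_H {k : Fin n} : pdM k (Hm u) x = Tm u k x := rfl

theorem pdM_g (hu : Sm u) {k : Fin n} :
    pdM k (gm u) x = Tm u k x * Hm u x + Hm u x * Tm u k x := by
  rw [← pdM_H, ← pdM_mul (SmM_H hu) (SmM_H hu)]
  ext i j
  simp only [pdM, gm, Matrix.of_apply, Matrix.add_apply]
  rw [pd_add (by fun_prop) ((SmM_H hu).mul (SmM_H hu) i j).da, pd_const, zero_add]

theorem pdM_G (hu : Sm u) {k : Fin n} :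
    pdM k (Gm u) x = - (Gm u x * (Tm u k x * Hm u x + Hm u x * Tm u k x) * Gm u x) := by
  have h := pdM_mul (x := x) (k := k) (SmM_G hu) (SmM_g hu)
  have h0 : pdM k (fun x => Gm u x * gm u x) x = 0 := by
    have : (fun x => Gm u x * gm u x) = fun _ => 1 := by ext1 x; exact Gg hu
    rw [this]; ext i j; simp [pdM, pd_const]
  rw [h0, pdM_g hu] at h
  have h2 := congrArg (fun A => A * Gm u x) h
  simp only [Matrix.add_mul, Matrix.zero_mul] at h2
  rw [Matrix.mul_assoc (pdM k (Gm u) x), gG hu, Matrix.mul_one] at h2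
  exact eq_neg_of_add_eq_zero_left h2.symm

theorem line_deriv {f : EE n → ℝ} (hf : Sm f) (k : Fin n) :
    HasDerivAt (fun t : ℝ => f (x + t • EuclideanSpace.single k (1:ℝ))) (pd k f x) 0 := by
  have h1 : HasDerivAt (fun t : ℝ => x + t • EuclideanSpace.single k (1:ℝ))
      (EuclideanSpace.single k (1:ℝ)) 0 := by
    simpa using ((hasDerivAt_id (0:ℝ)).smul_const (EuclideanSpace.single k (1:ℝ))).const_add x
  have h2 : HasFDerivAt f (fderiv ℝ f x) (x + (0:ℝ) • EuclideanSpace.single k (1:ℝ)) := by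
    simpa using (hf.da (x := x)).hasFDerivAt
  exact h2.comp_hasDerivAt (0:ℝ) h1

theorem om_facts {d : ℝ} (hs : Sol d u) (k : Fin n) :
    (Gm u x * Tm u k x).trace = 0 ∧ pd k (om u) x = om u x * (Hm u x * Gm u x * Tm u k x).trace := by
  obtain ⟨c, hc, he⟩ := hs.eq
  have hu := hs.sm
  set C := Complex.ofRealHom.mapMatrix (m := Fin n) with hC
  set M : ℝ → Matrix (Fin n) (Fin n) ℂ := fun t =>
    1 + Complex.I • C (Hm u (x + t • EuclideanSpace.single k (1:ℝ))) with hM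
  have hM0 : M 0 = 1 + Complex.I • C (Hm u x) := by simp [hM]
  have hj := jacobi M (Complex.I • C (Tm u k x)) ((1 - Complex.I • C (Hm u x)) * C (Gm u x)) 0
    (by
      intro i j
      simp only [hM, Matrix.add_apply, Matrix.smul_apply, smul_eq_mul]
      exact ((line_deriv (x := x) (SmM_H hu i j) k).ofReal_comp.const_mul Complex.I).const_add _)
    (by
      rw [hM0, ← Matrix.mul_assoc]
      have : (1 + Complex.I • C (Hm u x)) * (1 - Complex.I • C (Hm u x)) = C (gm u x) := by
        simp only [gm, map_add, map_one, map_mul]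
        simp only [Matrix.mul_sub, Matrix.add_mul, Matrix.mul_one, Matrix.one_mul, Matrix.smul_mul,
          Matrix.mul_smul, smul_add, smul_smul, Complex.I_mul_I, neg_smul, one_smul]
        abel
      rw [this, ← map_mul, gG hu, map_one])
  have hj2 : HasDerivAt (fun t => (M t).det) ((pd k (om u) x : ℂ) * c) 0 := by
    simp only [hM, he]
    exact (line_deriv (Sm_om hu) k).ofReal_comp.mul_const c
  have e := hj2.unique hj
  rw [hM0, he] at e
  have tr1 : ∀ A : Matrix (Fin n) (Fin n) ℝ, (C A).trace = ((A.trace : ℝ) : ℂ) := by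
    intro A; simp [hC, Matrix.trace]
  have e2 : ((1 - Complex.I • C (Hm u x)) * C (Gm u x) * Complex.I • C (Tm u k x)).trace
      = Complex.I * ((Gm u x * Tm u k x).trace : ℝ)
        + ((Hm u x * Gm u x * Tm u k x).trace : ℝ) := by
    rw [← tr1, ← tr1, map_mul, map_mul, map_mul, Matrix.sub_mul, Matrix.one_mul, Matrix.sub_mul,
      Matrix.mul_smul, Matrix.smul_mul, Matrix.smul_mul, Matrix.mul_smul, smul_smul,
      Complex.I_mul_I, Matrix.trace_sub, Matrix.trace_smul, Matrix.trace_smul]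
    simp
  rw [e2] at e
  have e3 : (pd k (om u) x : ℂ) = (om u x : ℂ) * (Complex.I * ((Gm u x * Tm u k x).trace : ℝ)
        + ((Hm u x * Gm u x * Tm u k x).trace : ℝ)) := by
    apply mul_right_cancel₀ hc; rw [e]; ring
  have hi := congrArg Complex.im e3
  have hr := congrArg Complex.re e3
  simp at hi hr
  refine ⟨?_, hr⟩
  rcases hi with h | h
  · exact absurd h (om_pos hu).ne'
  · exact h
end basics

open MeasureTheory Set Filter Topology
open scoped ContDiff Matrix

noncomputable def Lap {n : ℕ} (u f : EE n → ℝ) (x : EE n) : ℝ :=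
  ∑ i, ∑ j, Gm u x i j * pd i (pd j f) x

noncomputable def sF {n : ℕ} (u : EE n → ℝ) (y x : EE n) : ℝ :=
  ∑ i, (x i - y i) ^ 2 + ∑ k, (pd k u x - pd k u y) ^ 2

section lap
variable {n : ℕ} {u : EE n → ℝ} {x : EE n} {d : ℝ}

theorem sum_T (hu : Sm u) (A B : Matrix (Fin n) (Fin n) ℝ) (j : Fin n) :
    ∑ i, (A * Tm u i x * B) i j = ∑ b, (A * Tm u b x).trace * B b j := by
  simp only [Matrix.mul_apply, Matrix.trace, Matrix.diag]
  rw [Finset.sum_comm]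
  refine Finset.sum_congr rfl fun b _ => ?_
  rw [← Finset.sum_mul]
  congr 1
  refine Finset.sum_congr rfl fun i _ => Finset.sum_congr rfl fun a _ => ?_
  rw [Tm_swap2 hu i a b, Tm_swap hu i b a, Tm_swap2 hu b i a]

theorem div_free (hs : Sol d u) (j : Fin n) :
    ∑ i, pd i (fun y => om u y * Gm u y i j) x = 0 := by
  have hu := hs.sm
  have h1 : ∀ i, pd i (fun y => om u y * Gm u y i j) x
      = om u x * ((Hm u x * Gm u x * Tm u i x).trace * Gm u x i j)
        - om u x * (Gm u x * Tm u i x * (Hm u x * Gm u x)) i j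
        - om u x * (Gm u x * Hm u x * Tm u i x * Gm u x) i j := by
    intro i
    rw [pd_mul (Sm_om hu).da (SmM_G hu i j).da, (om_facts hs i).2]
    have : pd i (fun y => Gm u y i j) x = pdM i (Gm u) x i j := rfl
    rw [this, pdM_G hu]
    simp only [Matrix.mul_add, Matrix.add_mul, Matrix.neg_apply, Matrix.add_apply,
      ← Matrix.mul_assoc]
    ring
  simp only [h1, Finset.sum_sub_distrib, ← Finset.mul_sum]
  rw [sum_T hu, sum_T hu]
  have h2 : ∀ b, (Gm u x * Tm u b x).trace = 0 := fun b => (om_facts hs b).1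
  simp only [h2, zero_mul, Finset.sum_const_zero, GH_comm hu]
  ring

theorem trace_eq (A B : Matrix (Fin n) (Fin n) ℝ) (hB : B.IsSymm) :
    (A * B).trace = ∑ i, ∑ j, A i j * B i j := by
  simp only [Matrix.mul_apply, Matrix.trace, Matrix.diag]
  refine Finset.sum_congr rfl fun i _ => Finset.sum_congr rfl fun a _ => ?_
  rw [hB.apply]

theorem E1 (hs : Sol d u) (k : Fin n) : ∑ i, ∑ j, Gm u x i j * Tm u k x i j = 0 := by
  rw [← trace_eq _ _ (Tm_symm hs.sm k)]; exact (om_facts hs k).1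

theorem Lap_v (hs : Sol d u) (k : Fin n) : Lap u (pd k u) x = 0 := by
  rw [← E1 (x := x) hs k]
  refine Finset.sum_congr rfl fun i _ => Finset.sum_congr rfl fun j _ => ?_
  rw [Tm_swap hs.sm, Tm_swap2 hs.sm, Tm_apply]

theorem Lap_H (hs : Sol d u) (k l : Fin n) : Lap u (fun y => Hm u y k l) x
    = ∑ i, ∑ j, (Gm u x * (Tm u l x * Hm u x + Hm u x * Tm u l x) * Gm u x) i j * Tm u k x i j := by
  have hu := hs.sm
  have h0 : pd l (fun y => ∑ i, ∑ j, Gm u y i j * Tm u k y i j) x = 0 := by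
    have : (fun y => ∑ i, ∑ j, Gm u y i j * Tm u k y i j) = fun _ => 0 := by
      ext y; exact E1 hs k
    rw [this, pd_const]
  have hT : ∀ i j, Sm (fun y => Tm u k y i j) := fun i j => ((hu.pd j).pd i).pd k
  have hGT : ∀ i j, Sm (fun y => Gm u y i j * Tm u k y i j) := fun i j => (SmM_G hu i j).mul (hT i j)
  rw [pd_sum (fun i => (Sm.sum fun j => hGT i j).da)] at h0
  have h1 : ∀ i, pd l (fun y => ∑ j, Gm u y i j * Tm u k y i j) x
      = ∑ j, (pdM l (Gm u) x i j * Tm u k x i j + Gm u x i j * pd l (fun y => Tm u k y i j) x) := by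
    intro i
    rw [pd_sum (fun j => (hGT i j).da)]
    refine Finset.sum_congr rfl fun j _ => ?_
    rw [pd_mul (SmM_G hu i j).da (hT i j).da]; rfl
  simp only [h1, Finset.sum_add_distrib] at h0
  rw [pdM_G hu] at h0
  simp only [Matrix.neg_apply, neg_mul, Finset.sum_neg_distrib] at h0
  have h2 : Lap u (fun y => Hm u y k l) x
      = ∑ i, ∑ j, Gm u x i j * pd l (fun y => Tm u k y i j) x := by
    refine Finset.sum_congr rfl fun i _ => Finset.sum_congr rfl fun j _ => ?_
    congr 1
    change pd i (pd j (pd k (pd l u))) x = pd l (pd k (pd i (pd j u))) x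
    rw [pd_comm' hu (i := k) (j := l), pd_comm' (hu.pd k) (i := j) (j := l),
      pd_comm (((hu.pd k).pd j)) (i := i) (j := l), pd_comm' hu (i := j) (j := k),
      pd_comm' (hu.pd j) (i := i) (j := k)]
  rw [h2]; linarith

theorem Lap_add {f g : EE n → ℝ} (hf : Sm f) (hg : Sm g) :
    Lap u (fun y => f y + g y) x = Lap u f x + Lap u g x := by
  simp only [Lap, ← Finset.sum_add_distrib]
  refine Finset.sum_congr rfl fun i _ => Finset.sum_congr rfl fun j _ => ?_
  have : pd j (fun y => f y + g y) = fun y => pd j f y + pd j g y := by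
    ext y; exact pd_add hf.da hg.da
  rw [this, pd_add (hf.pd j).da (hg.pd j).da]; ring

theorem Lap_const_mul {f : EE n → ℝ} (c : ℝ) (hf : Sm f) :
    Lap u (fun y => c * f y) x = c * Lap u f x := by
  simp only [Lap, Finset.mul_sum]
  refine Finset.sum_congr rfl fun i _ => Finset.sum_congr rfl fun j _ => ?_
  have : pd j (fun y => c * f y) = fun y => c * pd j f y := by
    ext y; exact pd_const_mul c hf.da
  rw [this, pd_const_mul c (hf.pd j).da]; ring

theorem Lap_const (c : ℝ) : Lap u (fun _ => c) x = 0 := by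
  have : ∀ j, pd j (fun _ : EE n => c) = fun _ => 0 := fun j => by ext y; exact pd_const c
  simp [Lap, this, pd_const]

theorem Lap_sub {f g : EE n → ℝ} (hf : Sm f) (hg : Sm g) :
    Lap u (fun y => f y - g y) x = Lap u f x - Lap u g x := by
  have : (fun y => f y - g y) = fun y => f y + (-1) * g y := by ext; ring
  rw [this, Lap_add hf ((Sm.const _).mul hg), Lap_const_mul _ hg]; ring

theorem Lap_sum {ι : Type*} {s : Finset ι} {F : ι → EE n → ℝ} (h : ∀ a, Sm (F a)) :
    Lap u (fun y => ∑ a ∈ s, F a y) x = ∑ a ∈ s, Lap u (F a) x := by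
  classical
  induction s using Finset.induction_on with
  | empty => simp [Lap_const]
  | insert a s ha ih =>
    simp only [Finset.sum_insert ha]
    rw [Lap_add (h a) (Sm.sum h), ih]

theorem Lap_lin (m : Fin n → ℝ) : Lap u (fun y => ∑ j, m j * y j) x = 0 := by
  have : ∀ j, pd j (fun y : EE n => ∑ j, m j * y j) = fun _ => m j :=
    fun j => by ext y; exact pd_fun_mulVec
  simp [Lap, this, pd_const]

theorem Lap_sq {f : EE n → ℝ} (hf : Sm f) :
    Lap u (fun y => f y ^ 2) x = 2 * f x * Lap u f x +
      2 * ∑ i, ∑ j, Gm u x i j * pd i f x * pd j f x := by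
  simp only [Lap, Finset.mul_sum, ← Finset.sum_add_distrib]
  refine Finset.sum_congr rfl fun i _ => Finset.sum_congr rfl fun j _ => ?_
  have : pd j (fun y => f y ^ 2) = fun y => 2 * (f y * pd j f y) := by
    ext y; rw [pd_sq hf.da]; ring
  rw [this, pd_const_mul _ (hf.mul (hf.pd j)).da, pd_mul hf.da (hf.pd j).da]; ring

theorem Sm_sF (hu : Sm u) (y : EE n) : Sm (sF u y) := by
  unfold sF
  exact (Sm.sum fun i => ((Sm.coord i).sub (Sm.const _)).pow 2).add
    (Sm.sum fun k => ((hu.pd k).sub (Sm.const _)).pow 2)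

theorem pd_sF (hu : Sm u) (y : EE n) (j : Fin n) :
    pd j (sF u y) x = 2 * ((x j - y j) + ∑ a, Hm u x j a * (pd a u x - pd a u y)) := by
  unfold sF
  have c1 : ∀ i, Sm (fun x : EE n => x i - y i) := fun i => (Sm.coord i).sub (Sm.const _)
  have c2 : ∀ k, Sm (fun x : EE n => pd k u x - pd k u y) := fun k => (hu.pd k).sub (Sm.const _)
  rw [pd_add (Sm.sum fun i => (c1 i).pow 2).da (Sm.sum fun i => (c2 i).pow 2).da,
    pd_sum (fun i => ((c1 i).pow 2).da), pd_sum (fun i => ((c2 i).pow 2).da)]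
  simp only [pd_sq (c1 _).da, pd_sq (c2 _).da, pd_sub (Sm.coord _).da (Sm.const _).da,
    pd_sub (hu.pd _).da (Sm.const _).da, pd_const, pd_coord, sub_zero]
  rw [mul_add, Finset.mul_sum]
  congr 1
  · simp
  · exact Finset.sum_congr rfl fun a _ => by rw [Hm_apply]; ring

theorem Lap_sF (hs : Sol d u) (y : EE n) : Lap u (sF u y) x = 2 * n := by
  have hu := hs.sm
  have c1 : ∀ i, Sm (fun x : EE n => x i - y i) := fun i => (Sm.coord i).sub (Sm.const _)
  have c2 : ∀ k, Sm (fun x : EE n => pd k u x - pd k u y) := fun k => (hu.pd k).sub (Sm.const _)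
  have L1 : ∀ i, Lap u (fun x : EE n => x i) x = 0 := by
    intro i
    have := Lap_lin (u := u) (x := x) (fun j => if j = i then 1 else 0)
    simpa using this
  unfold sF
  rw [Lap_add (Sm.sum fun i => (c1 i).pow 2) (Sm.sum fun i => (c2 i).pow 2),
    Lap_sum (fun i => (c1 i).pow 2), Lap_sum (fun i => (c2 i).pow 2)]
  simp only [Lap_sq (c1 _), Lap_sq (c2 _), pd_sub (Sm.coord _).da (Sm.const _).da,
    pd_sub (hu.pd _).da (Sm.const _).da, pd_const, pd_coord, sub_zero,
    Lap_sub (Sm.coord _) (Sm.const _), Lap_sub (hu.pd _) (Sm.const _), Lap_const, Lap_v hs, L1,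
    mul_zero, zero_add]
  have e1 : ∀ i, ∑ a, ∑ b, Gm u x a b * (if i = a then (1:ℝ) else 0) * (if i = b then (1:ℝ) else 0)
      = Gm u x i i := by
    intro i; simp
  simp only [e1]
  have e2 : (Gm u x * gm u x).trace = n := by rw [Gg hu]; simp
  have e3 : (Gm u x * gm u x).trace = ∑ i, Gm u x i i +
      ∑ k, ∑ a, ∑ b, Gm u x a b * pd a (pd k u) x * pd b (pd k u) x := by
    rw [trace_eq _ _ (gm_symm hu)]
    simp only [gm, Matrix.add_apply, mul_add, Finset.sum_add_distrib]
    congr 1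
    · simp [Matrix.one_apply]
    · rw [Finset.sum_comm (s := Finset.univ (α := Fin n)) (t := Finset.univ)
        (f := fun k a => ∑ b, Gm u x a b * pd a (pd k u) x * pd b (pd k u) x)]
      refine Finset.sum_congr rfl fun a _ => ?_
      rw [Finset.sum_comm]
      refine Finset.sum_congr rfl fun b _ => ?_
      rw [Matrix.mul_apply, Finset.mul_sum]
      refine Finset.sum_congr rfl fun k _ => ?_
      rw [Hm_apply, Hm_apply, pd_comm hu (i := k) (j := b)]; ring
  rw [← Finset.mul_sum, ← Finset.mul_sum, ← mul_add, ← e3, e2]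

theorem Gss (hu : Sm u) (y : EE n) :
    ∑ i, ∑ j, Gm u x i j * pd i (sF u y) x * pd j (sF u y) x ≤ 4 * sF u y x := by
  simp only [pd_sF hu]
  have := G_upper (Hm_symm (x := x) hu) (fun i => x i - y i) (fun a => pd a u x - pd a u y)
  unfold sF
  refine le_trans (le_of_eq ?_) (mul_le_mul_of_nonneg_left this (by norm_num : (0:ℝ) ≤ 4))
  simp only [Finset.mul_sum]
  refine Finset.sum_congr rfl fun i _ => Finset.sum_congr rfl fun j _ => ?_
  simp only [← Finset.mul_sum, Gm, gm]; ring

theorem Gnn (hu : Sm u) (a : Fin n → ℝ) : 0 ≤ ∑ i, ∑ j, Gm u x i j * a i * a j := by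
  obtain ⟨O, l, h1, h2, hH⟩ := spec (Hm_symm (x := x) hu)
  rw [Gm, gm, spec_quad (spec_G h2 h1 hH)]
  refine Finset.sum_nonneg fun k _ => ?_
  rw [mul_assoc, ← pow_two]; positivity
end lap

open MeasureTheory Set Filter Topology
open scoped ContDiff Matrix

theorem hasDerivAt_pp2 (t : ℝ) : HasDerivAt (fun t : ℝ => (max t 0) ^ 2) (2 * max t 0) t := by
  rcases lt_trichotomy t 0 with h | h | h
  · rw [max_eq_right h.le, mul_zero]
    refine (hasDerivAt_const t (0:ℝ)).congr_of_eventuallyEq ?_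
    filter_upwards [Iio_mem_nhds h] with s hs
    rw [max_eq_right (le_of_lt hs)]; norm_num
  · subst h
    rw [hasDerivAt_iff_isLittleO_nhds_zero]
    have : (fun h : ℝ => h ^ 2) =o[𝓝 0] fun h : ℝ => h := by
      simpa using Asymptotics.isLittleO_pow_pow (𝕜 := ℝ) (m := 1) (n := 2) (by norm_num)
    refine Asymptotics.IsBigO.trans_isLittleO (Asymptotics.IsBigO.of_bound 1 ?_) this
    refine Filter.Eventually.of_forall fun s => ?_
    simp only [zero_add, max_self, mul_zero, smul_zero, sub_zero, Real.norm_eq_abs, one_mul]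
    rcases le_total s 0 with h | h
    · rw [max_eq_right h]; simp [sq_nonneg]
    · rw [max_eq_left h]; simp
  · rw [max_eq_left h.le]
    have := hasDerivAt_pow 2 t
    refine HasDerivAt.congr_of_eventuallyEq (by simpa using this) ?_
    filter_upwards [Ioi_mem_nhds h] with s hs
    rw [max_eq_left (le_of_lt hs)]

theorem hasDerivAt_pp3 (t : ℝ) : HasDerivAt (fun t : ℝ => (max t 0) ^ 3) (3 * (max t 0) ^ 2) t := by
  have e : (fun t : ℝ => (max t 0) ^ 3) = fun t => t * (max t 0) ^ 2 := by
    ext s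
    rcases le_total s 0 with h | h
    · rw [max_eq_right h]; simp
    · rw [max_eq_left h]; ring
  rw [e]
  have := (hasDerivAt_id t).mul (hasDerivAt_pp2 t)
  refine HasDerivAt.congr_deriv this ?_
  simp only [id]
  rcases le_total t 0 with h | h
  · rw [max_eq_right h]; simp
  · rw [max_eq_left h]; ring

noncomputable def mF {n : ℕ} (u : EE n → ℝ) (y : EE n) (r : ℝ) (x : EE n) : ℝ :=
  max (1 - sF u y x / r ^ 2) 0

section mono
variable {n : ℕ} {u : EE n → ℝ} {x y : EE n} {d r : ℝ}

theorem sF_nonneg : 0 ≤ sF u y x := by unfold sF; positivity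

theorem nsq (z : EE n) : ‖z‖ ^ 2 = ∑ i, z i ^ 2 := EuclideanSpace.real_norm_sq_eq z

theorem sF_ge : ‖x - y‖ ^ 2 ≤ sF u y x := by
  rw [nsq]; unfold sF
  have : (0:ℝ) ≤ ∑ k, (pd k u x - pd k u y) ^ 2 := by positivity
  simpa using this

theorem grad_lip (hs : Sol d u) (x y : EE n) :
    ∑ k, (pd k u x - pd k u y) ^ 2 ≤ 4 * ‖x - y‖ ^ 2 := by
  set a : Fin n → ℝ := fun k => pd k u x - pd k u y with ha
  set z := x - y with hz
  have hu := hs.sm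
  have hd : ∀ t : ℝ, HasDerivAt (fun t : ℝ => ∑ k, a k * pd k u (y + t • z))
      (∑ k, a k * ∑ j, Hm u (y + t • z) k j * z j) t := by
    intro t
    apply HasDerivAt.fun_sum
    intro k _
    apply HasDerivAt.const_mul
    have h1 : HasDerivAt (fun t : ℝ => y + t • z) z t := by
      simpa using ((hasDerivAt_id t).smul_const z).const_add y
    have h2 := ((hu.pd k).da (x := y + t • z)).hasFDerivAt.comp_hasDerivAt t h1
    refine HasDerivAt.congr_deriv h2 ?_
    have h3 : z = ∑ j, z j • EuclideanSpace.single j (1:ℝ) := by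
      ext i; simp [Pi.single_apply]
    have h4 : fderiv ℝ (pd k u) (y + t • z) z
        = fderiv ℝ (pd k u) (y + t • z) (∑ j, z j • EuclideanSpace.single j (1:ℝ)) := congrArg _ h3
    rw [h4, map_sum]
    refine Finset.sum_congr rfl fun j _ => ?_
    rw [map_smul, smul_eq_mul, ← (Hm_symm hu).apply k j, Hm_apply]
    simp only [pd]; ring
  obtain ⟨t, _, ht⟩ := exists_hasDerivAt_eq_slope _ _ (zero_lt_one)
    (fun t _ => (hd t).continuousAt.continuousWithinAt) (fun t _ => hd t)
  have e : (∑ k, a k * pd k u (y + (1:ℝ) • z)) - ∑ k, a k * pd k u (y + (0:ℝ) • z)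
      = ∑ k, a k ^ 2 := by
    rw [← Finset.sum_sub_distrib]
    refine Finset.sum_congr rfl fun k _ => ?_
    have : y + (1:ℝ) • z = x := by rw [hz]; simp
    rw [this]; simp only [zero_smul, add_zero, ha]; ring
  rw [e] at ht
  have cs := Finset.sum_mul_sq_le_sq_mul_sq Finset.univ a
    (fun k => ∑ j, Hm u (y + t • z) k j * z j)
  have b := bd4 (x := y + t • z) hs (fun j => z j)
  rw [← nsq] at b
  rw [ht] at cs
  simp only [sub_zero, div_one] at cs
  rcases (show (0:ℝ) ≤ ∑ k, a k ^ 2 by positivity).eq_or_lt with h0 | h0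
  · rw [← h0]; positivity
  · have : (∑ k, a k ^ 2) ^ 2 ≤ (∑ k, a k ^ 2) * (4 * ‖z‖ ^ 2) :=
      cs.trans (mul_le_mul_of_nonneg_left b h0.le)
    rw [pow_two] at this
    exact le_of_mul_le_mul_left this h0

theorem sF_le (hs : Sol d u) : sF u y x ≤ 5 * ‖x - y‖ ^ 2 := by
  have := grad_lip hs x y
  have h2 := nsq (x - y)
  simp only [PiLp.sub_apply] at h2
  unfold sF; rw [← h2]; linarith

theorem mF_nonneg : 0 ≤ mF u y r x := le_max_right _ _
theorem mF_le_one : mF u y r x ≤ 1 := by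
  unfold mF
  have : 0 ≤ sF u y x / r ^ 2 := div_nonneg sF_nonneg (sq_nonneg _)
  exact max_le (by linarith) zero_le_one
theorem mF_ne (hr : 0 < r) (h : mF u y r x ≠ 0) : sF u y x < r ^ 2 := by
  by_contra hc
  apply h
  unfold mF
  rw [max_eq_right]
  have : 1 ≤ sF u y x / r ^ 2 := by rw [one_le_div (by positivity)]; exact not_lt.1 hc
  linarith
theorem norm_lt_of_sF (hr : 0 < r) (h : sF u y x < r ^ 2) : ‖x - y‖ < r :=
  lt_of_pow_lt_pow_left₀ 2 hr.le (sF_ge.trans_lt h)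
theorem mF_cont (hu : Sm u) : Continuous (mF u y r) := by
  unfold mF
  have := (Sm_sF hu y).cont
  fun_prop

theorem cs_of {f : EE n → ℝ} (hr : 0 < r) (h : ∀ x, mF u y r x = 0 → f x = 0) :
    HasCompactSupport f := by
  refine HasCompactSupport.of_support_subset_isCompact (isCompact_closedBall y r) ?_
  intro x hx
  rw [Metric.mem_closedBall, dist_eq_norm]
  exact (norm_lt_of_sF hr (mF_ne hr (fun h0 => hx (h x h0)))).le

theorem int_of {f : EE n → ℝ} (hr : 0 < r) (hf : Continuous f)
    (h : ∀ x, mF u y r x = 0 → f x = 0) : Integrable f :=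
  hf.integrable_of_hasCompactSupport (cs_of hr h)

theorem pd_m3 (hu : Sm u) (i : Fin n) : pd i (fun x => mF u y r x ^ 3) x
    = - (3 / r ^ 2 * (mF u y r x ^ 2 * pd i (sF u y) x)) := by
  have h1 : Sm (fun x => 1 - sF u y x / r ^ 2) := by
    simp only [div_eq_mul_inv]; exact (Sm.const _).sub ((Sm_sF hu y).mul (Sm.const _))
  have := pd_comp (i := i) (x := x) (f := fun x => 1 - sF u y x / r ^ 2)
    (φ := fun t => max t 0 ^ 3) (hasDerivAt_pp3 (1 - sF u y x / r ^ 2)) h1.da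
  unfold mF
  rw [this, pd_sub (Sm.const _).da (by exact ((Sm_sF hu y).mul (Sm.const (r^2)⁻¹)).da), pd_const]
  have : (fun x => sF u y x / r ^ 2) = fun x => (r ^ 2)⁻¹ * sF u y x := by ext; ring
  rw [this, pd_const_mul _ (Sm_sF hu y).da]
  ring

theorem pd_m2 (hu : Sm u) (i : Fin n) : pd i (fun x => mF u y r x ^ 2) x
    = - (2 / r ^ 2 * (mF u y r x * pd i (sF u y) x)) := by
  have h1 : Sm (fun x => 1 - sF u y x / r ^ 2) := by
    simp only [div_eq_mul_inv]; exact (Sm.const _).sub ((Sm_sF hu y).mul (Sm.const _))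
  have := pd_comp (i := i) (x := x) (f := fun x => 1 - sF u y x / r ^ 2)
    (φ := fun t => max t 0 ^ 2) (hasDerivAt_pp2 (1 - sF u y x / r ^ 2)) h1.da
  unfold mF
  rw [this, pd_sub (Sm.const _).da (by exact ((Sm_sF hu y).mul (Sm.const (r^2)⁻¹)).da), pd_const]
  have : (fun x => sF u y x / r ^ 2) = fun x => (r ^ 2)⁻¹ * sF u y x := by ext; ring
  rw [this, pd_const_mul _ (Sm_sF hu y).da]
  ring

theorem diff_m (hu : Sm u) : Differentiable ℝ (fun x => mF u y r x ^ 3) ∧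
    Differentiable ℝ (fun x => mF u y r x ^ 2) := by
  have h1 : Sm (fun x => 1 - sF u y x / r ^ 2) := by
    simp only [div_eq_mul_inv]; exact (Sm.const _).sub ((Sm_sF hu y).mul (Sm.const _))
  unfold mF
  exact ⟨fun x => ((hasDerivAt_pp3 _).differentiableAt.comp x (h1.da (x := x))),
    fun x => ((hasDerivAt_pp2 _).differentiableAt.comp x (h1.da (x := x)))⟩

/-- weighted divergence theorem, cubic weight -/
theorem ibp3 (hu : Sm u) (hr : 0 < r) {X : Fin n → EE n → ℝ} (hX : ∀ i, Sm (X i)) :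
    ∫ x, mF u y r x ^ 3 * ∑ i, pd i (X i) x
      = 3 / r ^ 2 * ∫ x, mF u y r x ^ 2 * ∑ i, X i x * pd i (sF u y) x := by
  have hm := mF_cont (y := y) (r := r) hu
  have key : ∀ i, ∫ x, mF u y r x ^ 3 * pd i (X i) x
      = 3 / r ^ 2 * ∫ x, mF u y r x ^ 2 * (X i x * pd i (sF u y) x) := by
    intro i
    have c1 := ((hX i).pd i).cont
    have c2 := ((Sm_sF hu y).pd i).cont
    have c3 := (hX i).cont
    have e : ∀ x, pd i (fun x => mF u y r x ^ 3 * X i x) x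
        = mF u y r x ^ 3 * pd i (X i) x
          - 3 / r ^ 2 * (mF u y r x ^ 2 * (X i x * pd i (sF u y) x)) := by
      intro x
      rw [pd_mul ((diff_m hu).1 x) (hX i).da, pd_m3 hu]; ring
    have h0 := integral_pd_zero (i := i) (F := fun x => mF u y r x ^ 3 * X i x)
      ((diff_m hu).1.mul (hX i).diff) (cs_of (u := u) (y := y) hr (fun x h => by simp [h]))
      (by rw [show pd i (fun x => mF u y r x ^ 3 * X i x) = _ from funext e]; fun_prop)
    simp only [e] at h0
    rw [integral_sub (int_of (u := u) (y := y) hr (by fun_prop) (fun x h => by simp [h]))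
      (int_of (u := u) (y := y) hr (by fun_prop) (fun x h => by simp [h])),
      integral_const_mul] at h0
    linarith
  simp only [Finset.mul_sum]
  rw [integral_finsetSum _ (fun i _ => int_of (u := u) (y := y) hr
      (by have := ((hX i).pd i).cont; fun_prop) (fun x h => by simp [h])),
    integral_finsetSum _ (fun i _ => int_of (u := u) (y := y) hr
      (by have := ((Sm_sF hu y).pd i).cont; have := (hX i).cont; fun_prop)
      (fun x h => by simp [h])), Finset.mul_sum]
  exact Finset.sum_congr rfl fun i _ => key i

/-- weighted divergence theorem, quadratic weight -/
theorem ibp2 (hu : Sm u) (hr : 0 < r) {X : Fin n → EE n → ℝ} (hX : ∀ i, Sm (X i)) :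
    ∫ x, mF u y r x ^ 2 * ∑ i, pd i (X i) x
      = 2 / r ^ 2 * ∫ x, mF u y r x * ∑ i, X i x * pd i (sF u y) x := by
  have hm := mF_cont (y := y) (r := r) hu
  have key : ∀ i, ∫ x, mF u y r x ^ 2 * pd i (X i) x
      = 2 / r ^ 2 * ∫ x, mF u y r x * (X i x * pd i (sF u y) x) := by
    intro i
    have c1 := ((hX i).pd i).cont
    have c2 := ((Sm_sF hu y).pd i).cont
    have c3 := (hX i).cont
    have e : ∀ x, pd i (fun x => mF u y r x ^ 2 * X i x) x
        = mF u y r x ^ 2 * pd i (X i) x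
          - 2 / r ^ 2 * (mF u y r x * (X i x * pd i (sF u y) x)) := by
      intro x
      rw [pd_mul ((diff_m hu).2 x) (hX i).da, pd_m2 hu]; ring
    have h0 := integral_pd_zero (i := i) (F := fun x => mF u y r x ^ 2 * X i x)
      ((diff_m hu).2.mul (hX i).diff) (cs_of (u := u) (y := y) hr (fun x h => by simp [h]))
      (by rw [show pd i (fun x => mF u y r x ^ 2 * X i x) = _ from funext e]; fun_prop)
    simp only [e] at h0
    rw [integral_sub (int_of (u := u) (y := y) hr (by fun_prop) (fun x h => by simp [h]))
      (int_of (u := u) (y := y) hr (by fun_prop) (fun x h => by simp [h])),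
      integral_const_mul] at h0
    linarith
  simp only [Finset.mul_sum]
  rw [integral_finsetSum _ (fun i _ => int_of (u := u) (y := y) hr
      (by have := ((hX i).pd i).cont; fun_prop) (fun x h => by simp [h])),
    integral_finsetSum _ (fun i _ => int_of (u := u) (y := y) hr
      (by have := ((Sm_sF hu y).pd i).cont; have := (hX i).cont; fun_prop)
      (fun x h => by simp [h])), Finset.mul_sum]
  exact Finset.sum_congr rfl fun i _ => key i

theorem div_G (hs : Sol d u) {f : Fin n → EE n → ℝ} (hf : ∀ j, Sm (f j)) :
    ∑ i, pd i (fun y => ∑ j, om u y * Gm u y i j * f j y) x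
      = om u x * ∑ i, ∑ j, Gm u x i j * pd i (f j) x := by
  have hu := hs.sm
  have hW : ∀ i j, Sm (fun y => om u y * Gm u y i j) := fun i j => (Sm_om hu).mul (SmM_G hu i j)
  have e : ∀ i, pd i (fun y => ∑ j, om u y * Gm u y i j * f j y) x
      = ∑ j, (pd i (fun y => om u y * Gm u y i j) x * f j x + om u x * Gm u x i j * pd i (f j) x) := by
    intro i
    rw [pd_sum (fun j => ((hW i j).mul (hf j)).da)]
    exact Finset.sum_congr rfl fun j _ => pd_mul (hW i j).da (hf j).da
  simp only [e, Finset.sum_add_distrib]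
  rw [Finset.sum_comm]
  simp only [← Finset.sum_mul, div_free hs, zero_mul, Finset.sum_const_zero, zero_add,
    Finset.mul_sum]
  exact Finset.sum_congr rfl fun i _ => Finset.sum_congr rfl fun j _ => by ring

theorem Sm_Lap (hu : Sm u) {w : EE n → ℝ} (hw : Sm w) : Sm (Lap u w) := by
  unfold Lap
  exact Sm.sum fun i => Sm.sum fun j => (SmM_G hu i j).mul ((hw.pd j).pd i)

noncomputable def gss {n : ℕ} (u : EE n → ℝ) (y x : EE n) : ℝ :=
  ∑ i, ∑ j, Gm u x i j * pd i (sF u y) x * pd j (sF u y) x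

theorem Sm_gss (hu : Sm u) : Sm (gss u y) := by
  unfold gss
  exact Sm.sum fun i => Sm.sum fun j => ((SmM_G hu i j).mul ((Sm_sF hu y).pd i)).mul
    ((Sm_sF hu y).pd j)

theorem green (hs : Sol d u) (hr : 0 < r) {w : EE n → ℝ} (hw : Sm w) :
    ∫ x, mF u y r x ^ 3 * (om u x * Lap u w x)
      = ∫ x, w x * om u x * (6 / r ^ 4 * (mF u y r x * gss u y x)
          - 6 * n / r ^ 2 * mF u y r x ^ 2) := by
  have hu := hs.sm
  have hm := mF_cont (y := y) (r := r) hu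
  have hss := Sm_sF hu y
  have A := ibp3 (y := y) hu hr (X := fun i x => ∑ j, om u x * Gm u x i j * pd j w x)
    (fun i => Sm.sum fun j => ((Sm_om hu).mul (SmM_G hu i j)).mul (hw.pd j))
  have B := ibp2 (y := y) hu hr (X := fun i x => ∑ j, om u x * Gm u x i j * (w x * pd j (sF u y) x))
    (fun i => Sm.sum fun j => ((Sm_om hu).mul (SmM_G hu i j)).mul (hw.mul (hss.pd j)))
  simp only [div_G hs (fun j => hw.pd j)] at A
  simp only [div_G hs (fun j => hw.mul (hss.pd j))] at B
  set cr : EE n → ℝ := fun x => om u x * ∑ i, ∑ j, Gm u x i j * (pd i w x * pd j (sF u y) x)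
    with hcr
  have hcrS : Sm cr := (Sm_om hu).mul (Sm.sum fun i => Sm.sum fun j =>
    (SmM_G hu i j).mul ((hw.pd i).mul (hss.pd j)))
  have e1 : ∀ x, ∑ i, (∑ j, om u x * Gm u x i j * pd j w x) * pd i (sF u y) x = cr x := by
    intro x
    simp only [hcr, Finset.sum_mul, Finset.mul_sum]
    rw [Finset.sum_comm]
    refine Finset.sum_congr rfl fun i _ => Finset.sum_congr rfl fun j _ => ?_
    rw [(Gm_symm hu).apply]; ring
  have e2 : ∀ x, om u x * ∑ i, ∑ j, Gm u x i j * pd i (fun y_1 => w y_1 * pd j (sF u y) y_1) x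
      = cr x + 2 * n * (w x * om u x) := by
    intro x
    simp only [hcr, pd_mul hw.da (hss.pd _).da, mul_add, Finset.sum_add_distrib]
    have : ∑ i, ∑ j, Gm u x i j * (w x * pd i (pd j (sF u y)) x) = w x * Lap u (sF u y) x := by
      simp only [Lap, Finset.mul_sum]
      exact Finset.sum_congr rfl fun i _ => Finset.sum_congr rfl fun j _ => by ring
    rw [this, Lap_sF hs]; ring
  have e3 : ∀ x, ∑ i, (∑ j, om u x * Gm u x i j * (w x * pd j (sF u y) x)) * pd i (sF u y) x
      = w x * om u x * gss u y x := by
    intro x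
    simp only [gss, Finset.sum_mul, Finset.mul_sum]
    exact Finset.sum_congr rfl fun i _ => Finset.sum_congr rfl fun j _ => by ring
  simp only [e1] at A
  simp only [e2, e3, mul_add] at B
  have c1 := hcrS.cont
  have c2 := hw.cont
  have c3 := (Sm_om hu).cont
  have c4 := (Sm_gss (y := y) hu).cont
  rw [integral_add (int_of (u := u) (y := y) hr (by fun_prop) (fun x h => by simp [h]))
      (int_of (u := u) (y := y) hr (by fun_prop) (fun x h => by simp [h]))] at B
  have A' : ∫ x, mF u y r x ^ 3 * (om u x * Lap u w x)
      = 3 / r ^ 2 * ∫ x, mF u y r x ^ 2 * cr x := A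
  rw [A']
  have R : ∫ x, w x * om u x * (6 / r ^ 4 * (mF u y r x * gss u y x)
          - 6 * n / r ^ 2 * mF u y r x ^ 2)
      = 6 / r ^ 4 * (∫ x, mF u y r x * (w x * om u x * gss u y x))
        - 3 / r ^ 2 * ∫ x, mF u y r x ^ 2 * (2 * n * (w x * om u x)) := by
    rw [← integral_const_mul, ← integral_const_mul, ← integral_sub
      (int_of (u := u) (y := y) hr (by fun_prop) (fun x h => by simp [h]))
      (int_of (u := u) (y := y) hr (by fun_prop) (fun x h => by simp [h]))]
    congr 1; ext x; ring
  rw [R]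
  have : ∫ x, mF u y r x ^ 2 * cr x = 2 / r ^ 2 * (∫ x, mF u y r x * (w x * om u x * gss u y x))
      - ∫ x, mF u y r x ^ 2 * (2 * n * (w x * om u x)) := by linarith
  rw [this]
  generalize ∫ x, mF u y r x * (w x * om u x * gss u y x) = I1
  generalize ∫ x, mF u y r x ^ 2 * (2 * n * (w x * om u x)) = I2
  field_simp
  ring
end mono

open MeasureTheory Set Filter Topology
open scoped ContDiff Matrix

section qf
variable {n : ℕ}

noncomputable def qF (A : Matrix (Fin n) (Fin n) ℝ) (z : EE n) : ℝ :=
  ∑ i, z i ^ 2 + ∑ k, (∑ j, A k j * z j) ^ 2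

noncomputable def o0 (A : Matrix (Fin n) (Fin n) ℝ) : ℝ := Real.sqrt (1 + Aᵀ * A).det

noncomputable def cN (n : ℕ) : ℝ := ∫ z : EE n, (max (1 - ‖z‖ ^ 2) 0) ^ 2

theorem qF_cont (A : Matrix (Fin n) (Fin n) ℝ) : Continuous (qF A) := by
  unfold qF; fun_prop

theorem root_g (A : Matrix (Fin n) (Fin n) ℝ) : ∃ B : Matrix (Fin n) (Fin n) ℝ,
    Bᵀ * B = 1 + Aᵀ * A ∧ B.det ≠ 0 ∧ |B.det| = o0 A := by
  have hsym : (1 + Aᵀ * A).IsSymm := by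
    rw [Matrix.IsSymm]; simp
  obtain ⟨O, l, h1, h2, hg⟩ := spec hsym
  have hl : ∀ k, 1 ≤ l k := by
    intro k
    have e : Matrix.diagonal l = 1 + (A * O)ᵀ * (A * O) := by
      have : Matrix.diagonal l = Oᵀ * (1 + Aᵀ * A) * O := by
        rw [hg]
        simp only [Matrix.mul_assoc, h2, Matrix.mul_one]
        rw [← Matrix.mul_assoc, h2, Matrix.one_mul]
      rw [this, Matrix.mul_add, Matrix.add_mul, Matrix.mul_one, h2, Matrix.transpose_mul]
      simp only [Matrix.mul_assoc]
    have := congrFun (congrFun e k) k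
    rw [Matrix.diagonal_apply_eq, Matrix.add_apply, Matrix.one_apply_eq, Matrix.mul_apply] at this
    rw [this]
    have : 0 ≤ ∑ j, (A * O)ᵀ k j * (A * O) j k :=
      Finset.sum_nonneg fun j _ => by rw [Matrix.transpose_apply]; exact mul_self_nonneg _
    linarith
  have hB : (Matrix.diagonal (fun k => Real.sqrt (l k)) * Oᵀ)ᵀ
      * (Matrix.diagonal (fun k => Real.sqrt (l k)) * Oᵀ) = 1 + Aᵀ * A := by
    rw [hg, Matrix.transpose_mul, Matrix.transpose_transpose, Matrix.diagonal_transpose]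
    have : Matrix.diagonal l = Matrix.diagonal (fun k => Real.sqrt (l k))
        * Matrix.diagonal (fun k => Real.sqrt (l k)) := by
      rw [Matrix.diagonal_mul_diagonal]
      congr 1; ext k
      exact (Real.mul_self_sqrt (by linarith [hl k])).symm
    rw [this]; simp only [Matrix.mul_assoc]
  refine ⟨_, hB, ?_, ?_⟩
  · rw [Matrix.det_mul, Matrix.det_diagonal, Matrix.det_transpose]
    refine mul_ne_zero (Finset.prod_ne_zero_iff.2 fun k _ => ?_) ?_
    · exact (Real.sqrt_pos.2 (by linarith [hl k])).ne'
    · intro h0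
      have := congrArg Matrix.det h1
      rw [Matrix.det_mul, h0] at this; simp at this
  · generalize Matrix.diagonal (fun k => Real.sqrt (l k)) * Oᵀ = B at hB
    rw [o0, ← hB, Matrix.det_mul, Matrix.det_transpose, Real.sqrt_mul_self_eq_abs]

theorem root_q {A B : Matrix (Fin n) (Fin n) ℝ} (h : Bᵀ * B = 1 + Aᵀ * A) (z : EE n) :
    ‖Matrix.toEuclideanLin B z‖ ^ 2 = qF A z := by
  have e : ∀ M : Matrix (Fin n) (Fin n) ℝ,
      ∑ i, (∑ j, M i j * z j) ^ 2 = (z : Fin n → ℝ) ⬝ᵥ ((Mᵀ * M) *ᵥ (z : Fin n → ℝ)) := by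
    intro M
    rw [← Matrix.mulVec_mulVec, Matrix.dotProduct_mulVec, Matrix.vecMul_transpose]
    simp only [dotProduct, Matrix.mulVec]
    exact Finset.sum_congr rfl fun i _ => by ring
  rw [nsq]
  have : ∀ i, (Matrix.toEuclideanLin B z) i = ∑ j, B i j * z j := fun i => rfl
  simp only [this]
  rw [e, h, qF, e, Matrix.add_mulVec, Matrix.one_mulVec, dotProduct_add]
  congr 1
  simp only [dotProduct]
  exact Finset.sum_congr rfl fun i _ => by ring

theorem qF_ge (A : Matrix (Fin n) (Fin n) ℝ) (z : EE n) : ‖z‖ ^ 2 ≤ qF A z := by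
  rw [nsq]; unfold qF
  have : (0:ℝ) ≤ ∑ k, (∑ j, A k j * z j) ^ 2 := by positivity
  linarith

theorem o0_pos (A : Matrix (Fin n) (Fin n) ℝ) : 0 < o0 A := by
  obtain ⟨B, _, h2, h3⟩ := root_g A
  rw [← h3]; exact abs_pos.2 h2

theorem qint (A : Matrix (Fin n) (Fin n) ℝ) {t : ℝ} (ht : 0 < t) (y : EE n) :
    o0 A * ∫ x, (max (1 - qF A (x - y) / t ^ 2) 0) ^ 2 = cN n * t ^ n := by
  obtain ⟨B, hB, hd, ho⟩ := root_g A
  rw [integral_sub_right_eq_self (fun x => (max (1 - qF A x / t ^ 2) 0) ^ 2) y]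
  have e1 : (fun x : EE n => (max (1 - qF A x / t ^ 2) 0) ^ 2)
      = fun x => (fun z : EE n => (max (1 - ‖z‖ ^ 2) 0) ^ 2) ((t⁻¹ • Matrix.toEuclideanLin B) x) := by
    ext x
    simp only [LinearMap.smul_apply, norm_smul, mul_pow, root_q hB]
    rw [norm_inv, Real.norm_of_nonneg ht.le]
    congr 3; field_simp
  have hdet : LinearMap.det (t⁻¹ • Matrix.toEuclideanLin B : EE n →ₗ[ℝ] EE n) = (t⁻¹) ^ n * B.det := by
    rw [LinearMap.det_smul]
    congr 1
    · simp
    · exact LinearMap.det_toLpLin 2 B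
  have hne : LinearMap.det (t⁻¹ • Matrix.toEuclideanLin B : EE n →ₗ[ℝ] EE n) ≠ 0 := by
    rw [hdet]; positivity
  have e2 := integral_map (μ := (volume : Measure (EE n)))
    (φ := fun x => (t⁻¹ • Matrix.toEuclideanLin B) x)
    (f := fun z : EE n => (max (1 - ‖z‖ ^ 2) 0) ^ 2)
    (LinearMap.continuous_of_finiteDimensional _).aemeasurable
    (Continuous.aestronglyMeasurable (by fun_prop))
  rw [e1, ← e2]
  rw [Measure.map_linearMap_addHaar_eq_smul_addHaar volume hne, integral_smul_measure, hdet]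
  rw [ENNReal.toReal_ofReal (abs_nonneg _), ← ho, smul_eq_mul, cN]
  rw [abs_inv, abs_mul, abs_of_pos (by positivity : 0 < (t⁻¹) ^ n)]
  have : |B.det| ≠ 0 := abs_ne_zero.2 hd
  rw [inv_pow]
  field_simp

theorem cN_pos (n : ℕ) : 0 < cN n := by
  unfold cN
  have hc : Continuous (fun z : EE n => (max (1 - ‖z‖ ^ 2) 0) ^ 2) := by fun_prop
  refine hc.integral_pos_of_hasCompactSupport_nonneg_nonzero ?_ (fun z => by positivity) (x := 0) (by simp)
  refine HasCompactSupport.of_support_subset_isCompact (isCompact_closedBall 0 1) ?_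
  intro x hx
  rw [mem_closedBall_zero_iff]
  by_contra h
  apply hx
  have : 1 - ‖x‖ ^ 2 ≤ 0 := by nlinarith
  simp [max_eq_right this]
end qf

section beta
variable {n : ℕ} {u : EE n → ℝ} {x y : EE n} {d r : ℝ}

noncomputable def be (u : EE n → ℝ) (y : EE n) (w : EE n → ℝ) (r : ℝ) : ℝ :=
  (r ^ n)⁻¹ * ∫ x, mF u y r x ^ 2 * (w x * om u x)

theorem J_deriv (hu : Sm u) {w : EE n → ℝ} (hw : Continuous w) (hr : 0 < r) :
    HasDerivAt (fun r => ∫ x, mF u y r x ^ 2 * (w x * om u x))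
      (∫ x, 4 * sF u y x / r ^ 3 * mF u y r x * (w x * om u x)) r := by
  have co := (Sm_om hu).cont
  have cs := (Sm_sF hu y).cont
  have cm : ∀ r, Continuous (mF u y r) := fun r => mF_cont hu
  refine (hasDerivAt_integral_of_dominated_loc_of_deriv_le (s := Ioo (r/2) (2*r))
    (F' := fun r x => 4 * sF u y x / r ^ 3 * mF u y r x * (w x * om u x))
    (bound := fun x => 16 / r * (mF u y (3 * r) x * |w x * om u x|))
    (Ioo_mem_nhds (by linarith) (by linarith)) ?_ ?_ ?_ ?_ ?_ ?_).2
  · refine Filter.Eventually.of_forall fun r => Continuous.aestronglyMeasurable ?_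
    have := cm r; fun_prop
  · have := cm r
    exact int_of (u := u) (y := y) hr (by fun_prop) (fun x h => by simp [h])
  · have := cm r
    exact Continuous.aestronglyMeasurable (by fun_prop)
  · refine Filter.Eventually.of_forall fun x ρ hρ => ?_
    have hρ0 : 0 < ρ := by linarith [hρ.1]
    rw [norm_mul, Real.norm_eq_abs (w x * om u x), ← mul_assoc]
    refine mul_le_mul_of_nonneg_right ?_ (abs_nonneg _)
    by_cases h0 : mF u y ρ x = 0
    · rw [h0]; simp only [mul_zero, norm_zero]
      exact mul_nonneg (by positivity) mF_nonneg
    have h1 := mF_ne hρ0 h0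
    have h2 : 1/2 ≤ mF u y (3 * r) x := by
      refine le_trans ?_ (le_max_left _ _)
      have : sF u y x / (3 * r) ^ 2 ≤ 1/2 := by
        rw [div_le_iff₀ (by positivity)]
        nlinarith [hρ.2, hρ0]
      linarith
    rw [Real.norm_of_nonneg (mul_nonneg (div_nonneg (mul_nonneg (by norm_num) sF_nonneg)
      (by positivity)) mF_nonneg)]
    calc 4 * sF u y x / ρ ^ 3 * mF u y ρ x ≤ 4 * sF u y x / ρ ^ 3 * 1 :=
          mul_le_mul_of_nonneg_left mF_le_one (div_nonneg (mul_nonneg (by norm_num) sF_nonneg)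
            (by positivity))
      _ ≤ 4 * ρ ^ 2 / ρ ^ 3 * 1 := by gcongr
      _ = 4 / ρ := by field_simp
      _ ≤ 4 / (r / 2) := by have := hρ.1.le; gcongr
      _ = 16 / r * (1/2) := by field_simp; norm_num
      _ ≤ _ := by gcongr
  · have := cm (3 * r)
    exact int_of (u := u) (y := y) (r := 3 * r) (by linarith) (by fun_prop) (fun x h => by simp [h])
  · refine Filter.Eventually.of_forall fun x ρ hρ => ?_
    have hρ0 : 0 < ρ := by linarith [hρ.1]
    refine HasDerivAt.mul_const ?_ _
    have h1 : HasDerivAt (fun ρ : ℝ => 1 - sF u y x / ρ ^ 2) (2 * sF u y x / ρ ^ 3) ρ := by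
      have := ((hasDerivAt_const ρ (sF u y x)).div (hasDerivAt_pow 2 ρ) (by positivity)).const_sub 1
      refine this.congr_deriv ?_
      field_simp; simp; ring
    refine ((hasDerivAt_pp2 _).comp ρ h1).congr_deriv ?_
    unfold mF; ring

theorem be_deriv (hu : Sm u) {w : EE n → ℝ} (hw : Continuous w) (hr : 0 < r) :
    HasDerivAt (be u y w) ((r ^ n)⁻¹ * ((∫ x, 4 * sF u y x / r ^ 3 * mF u y r x * (w x * om u x))
      - n / r * ∫ x, mF u y r x ^ 2 * (w x * om u x))) r := by
  have h1 := (hasDerivAt_pow n r).inv (by positivity)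
  refine (h1.mul (J_deriv (y := y) hu hw hr)).congr_deriv ?_
  generalize ∫ x, 4 * sF u y x / r ^ 3 * mF u y r x * (w x * om u x) = I1
  generalize ∫ x, mF u y r x ^ 2 * (w x * om u x) = I2
  rcases n with _ | n
  · simp
  · simp only [Pi.inv_apply, Nat.add_sub_cancel]
    field_simp; ring

theorem be_deriv_ge (hs : Sol d u) {w : EE n → ℝ} (hw : Sm w) (hr : 0 < r)
    (h0 : ∀ x, sF u y x < r ^ 2 → 0 ≤ w x) :
    r / 6 * ((r ^ n)⁻¹ * ∫ x, mF u y r x ^ 3 * (om u x * Lap u w x))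
      ≤ (r ^ n)⁻¹ * ((∫ x, 4 * sF u y x / r ^ 3 * mF u y r x * (w x * om u x))
      - n / r * ∫ x, mF u y r x ^ 2 * (w x * om u x)) := by
  have hu := hs.sm
  have co := (Sm_om hu).cont
  have cs := (Sm_sF hu y).cont
  have cm : Continuous (mF u y r) := mF_cont hu
  have cw := hw.cont
  have cg := (Sm_gss (y := y) hu).cont
  rw [mul_left_comm]
  refine mul_le_mul_of_nonneg_left ?_ (by positivity)
  rw [green hs hr hw, ← integral_const_mul, ← integral_const_mul, ← integral_sub
      (int_of (u := u) (y := y) hr (by fun_prop) (fun x h => by simp [h]))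
      (int_of (u := u) (y := y) hr (by fun_prop) (fun x h => by simp [h]))]
  refine integral_mono (int_of (u := u) (y := y) hr (by fun_prop) (fun x h => by simp [h]))
    (int_of (u := u) (y := y) hr (by fun_prop) (fun x h => by simp [h])) fun x => ?_
  by_cases hm : mF u y r x = 0
  · simp [hm]
  have h1 := h0 x (mF_ne hr hm)
  have h2 : gss u y x ≤ 4 * sF u y x := Gss hu y
  have h3 : 0 ≤ mF u y r x := mF_nonneg
  have h4 := (om_pos (x := x) hu).le
  have key : r / 6 * (6 / r ^ 4 * (mF u y r x * gss u y x) - 6 * n / r ^ 2 * mF u y r x ^ 2)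
      ≤ 4 * sF u y x / r ^ 3 * mF u y r x - n / r * mF u y r x ^ 2 := by
    have : mF u y r x * gss u y x ≤ mF u y r x * (4 * sF u y x) :=
      mul_le_mul_of_nonneg_left h2 h3
    have e : r / 6 * (6 / r ^ 4 * (mF u y r x * gss u y x) - 6 * n / r ^ 2 * mF u y r x ^ 2)
      = (r ^ 3)⁻¹ * (mF u y r x * gss u y x) - n / r * mF u y r x ^ 2 := by
      field_simp
    rw [e]
    have e2 : 4 * sF u y x / r ^ 3 * mF u y r x = (r ^ 3)⁻¹ * (mF u y r x * (4 * sF u y x)) := by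
      field_simp
    rw [e2]
    gcongr
  have := mul_le_mul_of_nonneg_left key (mul_nonneg h1 h4)
  calc _ = w x * om u x * (r / 6 * (6 / r ^ 4 * (mF u y r x * gss u y x)
            - 6 * n / r ^ 2 * mF u y r x ^ 2)) := by ring
    _ ≤ _ := this
    _ = _ := by ring

theorem be_scale (w : EE n → ℝ) (hr : 0 < r) :
    be u y w r = ∫ z, mF u y r (y + r • z) ^ 2 * (w (y + r • z) * om u (y + r • z)) := by
  have h := Measure.integral_comp_smul_of_nonneg volume
    (fun x => mF u y r (y + x) ^ 2 * (w (y + x) * om u (y + x))) r (hR := hr.le)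
  rw [h, integral_add_left_eq_self (fun x => mF u y r x ^ 2 * (w x * om u x)) y]
  simp [be]
end beta

open MeasureTheory Set Filter Topology
open scoped ContDiff Matrix

section blim
variable {n : ℕ} {u : EE n → ℝ} {x y : EE n} {d r : ℝ}

theorem fderiv_coord (f : EE n → ℝ) (x z : EE n) : fderiv ℝ f x z = ∑ j, pd j f x * z j := by
  have h3 : z = ∑ j, z j • EuclideanSpace.single j (1:ℝ) := by
    ext i; simp [Pi.single_apply]
  have h4 : fderiv ℝ f x z
      = fderiv ℝ f x (∑ j, z j • EuclideanSpace.single j (1:ℝ)) := congrArg _ h3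
  rw [h4, map_sum]
  refine Finset.sum_congr rfl fun j _ => ?_
  rw [map_smul, smul_eq_mul, pd]; ring

theorem line_deriv2 {f : EE n → ℝ} (hf : Sm f) (y z : EE n) (t : ℝ) :
    HasDerivAt (fun t : ℝ => f (y + t • z)) (∑ j, pd j f (y + t • z) * z j) t := by
  have h1 : HasDerivAt (fun t : ℝ => y + t • z) z t := by
    simpa using ((hasDerivAt_id t).smul_const z).const_add y
  have h2 := (hf.da (x := y + t • z)).hasFDerivAt.comp_hasDerivAt t h1
  exact h2.congr_deriv (fderiv_coord _ _ _)

theorem sF_lim (hu : Sm u) (y z : EE n) :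
    Tendsto (fun r : ℝ => sF u y (y + r • z) / r ^ 2) (𝓝[>] 0) (𝓝 (qF (Hm u y) z)) := by
  have e : (fun r : ℝ => sF u y (y + r • z) / r ^ 2) =ᶠ[𝓝[>] 0] fun r =>
      ∑ i, z i ^ 2 + ∑ k, (r⁻¹ • (pd k u (y + (0 + r) • z) - pd k u (y + (0:ℝ) • z))) ^ 2 := by
    filter_upwards [self_mem_nhdsWithin] with r hr
    have hr : 0 < r := hr
    simp only [sF, add_div, Finset.sum_div, zero_add, zero_smul, add_zero]
    congr 1
    · refine Finset.sum_congr rfl fun i _ => ?_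
      simp; field_simp
    · refine Finset.sum_congr rfl fun i _ => ?_
      simp; field_simp
  refine Tendsto.congr' e.symm ?_
  unfold qF
  refine tendsto_const_nhds.add (tendsto_finsetSum _ fun k _ => Tendsto.pow ?_ 2)
  have := (line_deriv2 (hu.pd k) y z 0).tendsto_slope_zero_right
  convert this using 2
  refine Finset.sum_congr rfl fun j _ => ?_
  rw [← (Hm_symm hu).apply, Hm_apply]; simp

theorem o0_H (hu : Sm u) : o0 (Hm u y) = om u y := by
  unfold o0 om gm; rw [Hm_symm hu]

theorem be_lim (hu : Sm u) {w : EE n → ℝ} (hw : Continuous w) (y : EE n) :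
    Tendsto (be u y w) (𝓝[>] 0) (𝓝 (cN n * w y)) := by
  have co := (Sm_om hu).cont
  have e : be u y w =ᶠ[𝓝[>] 0] fun r =>
      ∫ z, mF u y r (y + r • z) ^ 2 * (w (y + r • z) * om u (y + r • z)) := by
    filter_upwards [self_mem_nhdsWithin] with r hr
    exact be_scale w hr
  refine Tendsto.congr' e.symm ?_
  have hval : cN n * w y = ∫ z, (max (1 - qF (Hm u y) z) 0) ^ 2 * (w y * om u y) := by
    have := qint (Hm u y) one_pos (0 : EE n)
    simp only [sub_zero, one_pow, div_one, mul_one, o0_H hu] at this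
    rw [integral_mul_const, ← this]; ring
  rw [hval]
  obtain ⟨C, hC⟩ := (isCompact_closedBall y (1:ℝ)).exists_bound_of_continuousOn
    (f := fun x => w x * om u x) (by fun_prop)
  refine tendsto_integral_filter_of_dominated_convergence
    (fun z => (Metric.closedBall (0:EE n) 1).indicator (fun _ => C) z) ?_ ?_ ?_ ?_
  · refine Filter.Eventually.of_forall fun r => Continuous.aestronglyMeasurable ?_
    have := mF_cont (y := y) (r := r) hu
    fun_prop
  · filter_upwards [Ioo_mem_nhdsGT (zero_lt_one (α := ℝ))] with r hr
    refine Filter.Eventually.of_forall fun z => ?_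
    by_cases h0 : mF u y r (y + r • z) = 0
    · rw [h0]
      simp only [ne_eq, OfNat.ofNat_ne_zero, not_false_eq_true, zero_pow, zero_mul, norm_zero]
      refine indicator_nonneg (fun _ _ => ?_) _
      exact (norm_nonneg _).trans (hC y (by simp))
    · have h1 := norm_lt_of_sF hr.1 (mF_ne hr.1 h0)
      rw [add_sub_cancel_left, norm_smul, Real.norm_of_nonneg hr.1.le] at h1
      have h2 : ‖z‖ ≤ 1 := by
        have := hr.1
        nlinarith
      rw [indicator_of_mem (by simpa using h2), norm_mul]
      have h3 : ‖mF u y r (y + r • z) ^ 2‖ ≤ 1 := by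
        rw [norm_pow, Real.norm_of_nonneg mF_nonneg]
        exact pow_le_one₀ mF_nonneg mF_le_one
      have h4 := hC (y + r • z) (by
        rw [Metric.mem_closedBall, dist_eq_norm, add_sub_cancel_left, norm_smul,
          Real.norm_of_nonneg hr.1.le]
        nlinarith [hr.2, hr.1])
      calc _ ≤ 1 * C := mul_le_mul h3 h4 (norm_nonneg _) zero_le_one
        _ = C := one_mul C
  · exact (integrable_indicator_iff Metric.isClosed_closedBall.measurableSet).2
      (integrableOn_const (measure_closedBall_lt_top.ne) (by simp))
  · refine Filter.Eventually.of_forall fun z => ?_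
    have hc : Continuous (fun r : ℝ => w (y + r • z) * om u (y + r • z)) := by fun_prop
    have h1 : Tendsto (fun r : ℝ => w (y + r • z) * om u (y + r • z)) (𝓝[>] 0) (𝓝 (w y * om u y)) := by
      have := (hc.tendsto 0).mono_left (nhdsWithin_le_nhds (s := Ioi 0))
      simpa using this
    refine Tendsto.mul (Tendsto.pow ?_ 2) h1
    unfold mF
    exact ((sF_lim hu y z).const_sub 1).max tendsto_const_nhds

theorem be_mono (hs : Sol d u) {w : EE n → ℝ} (hw : Sm w) {R : ℝ}
    (h0 : ∀ x, sF u y x < R ^ 2 → 0 ≤ w x) (hL : ∀ x, sF u y x < R ^ 2 → 0 ≤ Lap u w x) :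
    MonotoneOn (be u y w) (Ioc 0 R) := by
  have hder : ∀ r ∈ Ioc 0 R, HasDerivAt (be u y w) _ r :=
    fun r hr => be_deriv (y := y) hs.sm hw.cont hr.1
  refine monotoneOn_of_deriv_nonneg (convex_Ioc 0 R)
    (fun r hr => (hder r hr).continuousAt.continuousWithinAt)
    (fun r hr => (hder r (interior_subset hr)).differentiableAt.differentiableWithinAt) ?_
  intro r hr
  have hr := interior_subset hr
  rw [(hder r hr).deriv]
  have hlt : ∀ x, sF u y x < r ^ 2 → sF u y x < R ^ 2 := fun x hx =>
    hx.trans_le (pow_le_pow_left₀ hr.1.le hr.2 2)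
  refine le_trans ?_ (be_deriv_ge hs hw hr.1 (fun x hx => h0 x (hlt x hx)))
  have hr0 := hr.1
  refine mul_nonneg (by positivity) (mul_nonneg (by positivity) (integral_nonneg fun x => ?_))
  by_cases hm : mF u y r x = 0
  · simp [hm]
  · exact mul_nonneg (pow_nonneg mF_nonneg 3) (mul_nonneg (om_pos hs.sm).le
      (hL x (hlt x (mF_ne hr.1 hm))))

theorem M0 (hs : Sol d u) {w : EE n → ℝ} (hw : Sm w) {R : ℝ} (hR : 0 < R)
    (h0 : ∀ x, sF u y x < R ^ 2 → 0 ≤ w x) (hL : ∀ x, sF u y x < R ^ 2 → 0 ≤ Lap u w x) :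
    cN n * w y ≤ be u y w R := by
  refine le_of_tendsto (be_lim hs.sm hw.cont y) ?_
  filter_upwards [Ioo_mem_nhdsGT hR] with r hr
  exact be_mono hs hw h0 hL ⟨hr.1, hr.2.le⟩ ⟨hR, le_rfl⟩ hr.2.le
end blim

open MeasureTheory Set Filter Topology
open scoped ContDiff Matrix

section talg
variable {n : ℕ} {H O : Matrix (Fin n) (Fin n) ℝ} {l : Fin n → ℝ}
  {T : Fin n → Matrix (Fin n) (Fin n) ℝ}

theorem sum3_rev (f : Fin n → Fin n → Fin n → ℝ) :
    ∑ k, ∑ j, ∑ i, f i j k = ∑ i, ∑ j, ∑ k, f i j k :=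
  calc ∑ k, ∑ j, ∑ i, f i j k = ∑ j, ∑ k, ∑ i, f i j k := Finset.sum_comm
    _ = ∑ j, ∑ i, ∑ k, f i j k := Finset.sum_congr rfl fun _ _ => Finset.sum_comm
    _ = ∑ i, ∑ j, ∑ k, f i j k := Finset.sum_comm

theorem sum3_cyc (f : Fin n → Fin n → Fin n → ℝ) :
    ∑ i, ∑ j, ∑ k, f j k i = ∑ i, ∑ j, ∑ k, f i j k :=
  calc ∑ i, ∑ j, ∑ k, f j k i = ∑ j, ∑ i, ∑ k, f j k i := Finset.sum_comm
    _ = ∑ j, ∑ k, ∑ i, f j k i := Finset.sum_congr rfl fun _ _ => Finset.sum_comm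

/-- contraction of the first index -/
noncomputable def uT (O : Matrix (Fin n) (Fin n) ℝ) (T : Fin n → Matrix (Fin n) (Fin n) ℝ)
    (a : Fin n) : Matrix (Fin n) (Fin n) ℝ := ∑ i, O i a • T i

noncomputable def sT (O : Matrix (Fin n) (Fin n) ℝ) (T : Fin n → Matrix (Fin n) (Fin n) ℝ)
    (a : Fin n) : Matrix (Fin n) (Fin n) ℝ := Oᵀ * uT O T a * O

theorem sT_apply (a b c : Fin n) :
    sT O T a b c = ∑ i, ∑ j, ∑ k, O i a * O j b * O k c * T i j k := by
  simp only [sT, uT, Matrix.mul_apply, Matrix.transpose_apply, Matrix.sum_apply, Matrix.smul_apply,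
    smul_eq_mul, Finset.sum_mul, Finset.mul_sum]
  refine Eq.trans ?_ (sum3_cyc (fun i j k => O i a * O j b * O k c * T i j k))
  exact Finset.sum_congr rfl fun k _ => Finset.sum_congr rfl fun j _ =>
    Finset.sum_congr rfl fun i _ => by ring

theorem sT_swap (h : ∀ i j k, T i j k = T j i k) (a b c : Fin n) : sT O T a b c = sT O T b a c := by
  rw [sT_apply, sT_apply]
  refine Finset.sum_comm.trans ?_
  exact Finset.sum_congr rfl fun k _ => Finset.sum_congr rfl fun j _ =>
    Finset.sum_congr rfl fun i _ => by rw [h k j]; ring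

theorem sT_swap2 (h : ∀ i j k, T i j k = T i k j) (a b c : Fin n) : sT O T a b c = sT O T a c b := by
  rw [sT_apply, sT_apply]
  refine Finset.sum_congr rfl fun i _ => ?_
  rw [Finset.sum_comm]
  exact Finset.sum_congr rfl fun j _ => Finset.sum_congr rfl fun k _ => by rw [h i j]; ring

theorem uT_eq (h1 : O * Oᵀ = 1) (a : Fin n) : uT O T a = O * sT O T a * Oᵀ := by
  have : O * sT O T a * Oᵀ = (O * Oᵀ) * uT O T a * (O * Oᵀ) := by
    simp only [sT, Matrix.mul_assoc]
  rw [this, h1]; simp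

/-- bilinear contraction -/
theorem bil {K : Matrix (Fin n) (Fin n) ℝ} {m : Fin n → ℝ} (hK : K = O * Matrix.diagonal m * Oᵀ)
    (L : Matrix (Fin n) (Fin n) ℝ →ₗ[ℝ] Matrix (Fin n) (Fin n) ℝ) :
    ∑ i, ∑ j, K i j * (L (T j) * T i).trace = ∑ a, m a * (L (uT O T a) * uT O T a).trace := by
  have e : ∀ a, (L (uT O T a) * uT O T a).trace
      = ∑ i, ∑ j, O i a * O j a * (L (T j) * T i).trace := by
    intro a
    simp only [uT, map_sum, map_smul, Finset.sum_mul_sum, Matrix.trace_sum, Matrix.smul_mul,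
      Matrix.mul_smul, Matrix.trace_smul, smul_eq_mul]
    rw [Finset.sum_comm]
    exact Finset.sum_congr rfl fun i _ => Finset.sum_congr rfl fun j _ => by ring
  have eK : ∀ i j, K i j = ∑ a, O i a * m a * O j a := by
    intro i j
    rw [hK, Matrix.mul_apply]
    simp only [Matrix.mul_diagonal, Matrix.transpose_apply]
  simp only [e, eK, Finset.sum_mul, Finset.mul_sum]
  rw [← sum3_cyc (fun i j a => O i a * m a * O j a * (L (T j) * T i).trace)]
  exact Finset.sum_congr rfl fun k _ => Finset.sum_congr rfl fun j _ =>
    Finset.sum_congr rfl fun i _ => by ring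

theorem tr_conj (h2 : Oᵀ * O = 1) (X Y : Matrix (Fin n) (Fin n) ℝ) :
    ((O * X * Oᵀ) * (O * Y * Oᵀ)).trace = (X * Y).trace := by
  have : (O * X * Oᵀ) * (O * Y * Oᵀ) = O * (X * (Oᵀ * O) * Y) * Oᵀ := by
    simp only [Matrix.mul_assoc]
  rw [this, h2, Matrix.mul_one, Matrix.trace_mul_comm, ← Matrix.mul_assoc, h2, Matrix.one_mul]

theorem tr1 (h1 : O * Oᵀ = 1) (h2 : Oᵀ * O = 1) (h : ∀ i j k, T i j k = T i k j)
    {K : Matrix (Fin n) (Fin n) ℝ} {m : Fin n → ℝ} (hK : K = O * Matrix.diagonal m * Oᵀ) :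
    ∑ i, ∑ j, K i j * (T j * T i).trace = ∑ a, ∑ b, ∑ c, m a * sT O T a b c ^ 2 := by
  have := bil (T := T) hK LinearMap.id
  simp only [LinearMap.id_apply] at this
  rw [this]
  refine Finset.sum_congr rfl fun a _ => ?_
  rw [uT_eq h1, tr_conj h2, Matrix.trace, Finset.mul_sum]
  refine Finset.sum_congr rfl fun b _ => ?_
  rw [Matrix.diag_apply, Matrix.mul_apply, Finset.mul_sum]
  refine Finset.sum_congr rfl fun c _ => ?_
  rw [sT_swap2 h a c b]; ring

theorem tr2 (h1 : O * Oᵀ = 1) (h2 : Oᵀ * O = 1) (h : ∀ i j k, T i j k = T i k j)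
    {G : Matrix (Fin n) (Fin n) ℝ} {γ : Fin n → ℝ} (hG : G = O * Matrix.diagonal γ * Oᵀ)
    (hH : H = O * Matrix.diagonal l * Oᵀ) :
    ∑ i, ∑ j, H i j * (G * (T j * H + H * T j) * G * T i).trace
      = ∑ a, ∑ b, ∑ c, l a * γ b * γ c * (l b + l c) * sT O T a b c ^ 2 := by
  let L : Matrix (Fin n) (Fin n) ℝ →ₗ[ℝ] Matrix (Fin n) (Fin n) ℝ :=
    { toFun := fun X => G * (X * H + H * X) * G
      map_add' := fun X Y => by simp only [Matrix.add_mul, Matrix.mul_add]; abel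
      map_smul' := fun c X => by
        simp only [Matrix.smul_mul, Matrix.mul_smul, ← smul_add, RingHom.id_apply] }
  have := bil (T := T) hH L
  have e : ∀ X, L X = G * (X * H + H * X) * G := fun X => rfl
  simp only [e] at this
  rw [this]
  refine Finset.sum_congr rfl fun a _ => ?_
  set S := sT O T a with hS
  have e3 : G * (uT O T a * H + H * uT O T a) * G
      = O * (Matrix.diagonal γ * (S * Matrix.diagonal l + Matrix.diagonal l * S) * Matrix.diagonal γ) * Oᵀ := by
    rw [uT_eq h1, hG, hH, ← hS]
    have c : ∀ X Y : Matrix (Fin n) (Fin n) ℝ, (O * X * Oᵀ) * (O * Y * Oᵀ) = O * (X * Y) * Oᵀ := by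
      intro X Y
      have : (O * X * Oᵀ) * (O * Y * Oᵀ) = O * (X * (Oᵀ * O) * Y) * Oᵀ := by
        simp only [Matrix.mul_assoc]
      rw [this, h2, Matrix.mul_one]
    rw [c, c, ← Matrix.add_mul, ← Matrix.mul_add, c, c]
  rw [e3, uT_eq h1, tr_conj h2, ← hS, Matrix.trace, Finset.mul_sum]
  refine Finset.sum_congr rfl fun b _ => ?_
  rw [Matrix.diag_apply, Matrix.mul_apply, Finset.mul_sum]
  refine Finset.sum_congr rfl fun c _ => ?_
  rw [Matrix.mul_diagonal, Matrix.diagonal_mul, Matrix.add_apply, Matrix.mul_diagonal,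
    Matrix.diagonal_mul, hS, sT_swap2 h a c b]; ring

theorem tr3 (h1 : O * Oᵀ = 1) (h2 : Oᵀ * O = 1) (hH : H = O * Matrix.diagonal l * Oᵀ)
    (M : Matrix (Fin n) (Fin n) ℝ) {m : Fin n → ℝ} (hM : M = O * Matrix.diagonal m * Oᵀ) (a : Fin n) :
    (Oᵀ *ᵥ (fun k => (M * T k).trace)) a = ∑ b, m b * sT O T a b b := by
  have : (Oᵀ *ᵥ (fun k => (M * T k).trace)) a = (M * uT O T a).trace := by
    simp only [Matrix.mulVec, dotProduct, uT, Finset.mul_sum, Matrix.mul_smul, Matrix.trace_sum,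
      Matrix.trace_smul, smul_eq_mul, Matrix.transpose_apply]
  rw [this, uT_eq h1, hM, tr_conj h2, Matrix.trace]
  exact Finset.sum_congr rfl fun b _ => by rw [Matrix.diag_apply, Matrix.diagonal_mul]

theorem alg_main (hs : H.IsSymm) {d : ℝ} (hd0 : 0 ≤ d) (hd : d ≤ 0.03)
    (hB : ∀ v : Fin n → ℝ, ∑ i, (∑ j, H i j * v j) ^ 2 ≤ 3 * (1 + d) ^ 2 * ∑ i, v i ^ 2)
    (hT1 : ∀ i j k, T i j k = T j i k) (hT2 : ∀ i j k, T i j k = T i k j) :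
    ∑ k, (T k).trace ^ 2 + ∑ k, (∑ b, H k b * (T b).trace - (H * T k).trace) ^ 2
      ≤ 5100 * n * (∑ i, ∑ j, (1 + H * H)⁻¹ i j * (T j * T i).trace
         + ∑ i, ∑ j, H i j * ((1 + H * H)⁻¹ * (T j * H + H * T j) * (1 + H * H)⁻¹ * T i).trace)
       + 340000 * n * d * ∑ i, ∑ j, ∑ k, T i j k ^ 2 := by
  obtain ⟨O, l, h1, h2, hH⟩ := spec hs
  have hl : ∀ k, l k ^ 2 ≤ 3 * (1 + d) ^ 2 := spec_bd h2 hH hB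
  have hl2 : ∀ k, l k ^ 2 ≤ 3.24 := fun k => (hl k).trans (by nlinarith)
  have hG := spec_G h2 h1 hH
  rw [tr1 h1 h2 hT2 hG, tr2 h1 h2 hT2 hG hH]
  set S := sT O T with hS
  have c1 : ∀ a b c, S a b c = S b a c := sT_swap hT1
  have c2 : ∀ a b c, S a b c = S a c b := sT_swap2 hT2
  have one : (1 : Matrix (Fin n) (Fin n) ℝ) = O * Matrix.diagonal (fun _ => 1) * Oᵀ := by
    rw [Matrix.diagonal_one, Matrix.mul_one, h1]
  have hD : ∑ i, ∑ j, ∑ k, T i j k ^ 2 = ∑ a, ∑ b, ∑ c, S a b c ^ 2 := by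
    have := tr1 h1 h2 hT2 one
    simp only [one_mul] at this
    rw [← this]
    refine Finset.sum_congr rfl fun i _ => ?_
    symm
    rw [Finset.sum_eq_single i]
    · rw [Matrix.one_apply_eq, one_mul, Matrix.trace]
      refine Finset.sum_congr rfl fun j _ => ?_
      rw [Matrix.diag_apply, Matrix.mul_apply]
      exact Finset.sum_congr rfl fun k _ => by rw [hT2 i k j]; ring
    · intro j _ hj; rw [Matrix.one_apply_ne hj.symm, zero_mul]
    · simp
  rw [hD]
  set γ : Fin n → ℝ := fun i => (1 + l i ^ 2)⁻¹ with hγ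
  have gpos : ∀ i, 0 < γ i := fun i => by simp only [hγ]; positivity
  have gle : ∀ i, γ i ≤ 1 := fun i => inv_le_one_of_one_le₀ (by nlinarith [sq_nonneg (l i)])
  have gge : ∀ i, (1/4.24 : ℝ) ≤ γ i := fun i => by
    simp only [hγ, one_div]
    apply inv_anti₀ (by positivity); linarith [hl2 i]
  have gm : ∀ i, γ i * (1 + l i ^ 2) = 1 := fun i => inv_mul_cancel₀ (by positivity)
  -- main quadratic form
  set N := ∑ a, ∑ b, S a b b ^ 2 with hN
  have main : 3 * (∑ a, ∑ b, ∑ c, γ a * S a b c ^ 2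
      + ∑ a, ∑ b, ∑ c, l a * γ b * γ c * (l b + l c) * S a b c ^ 2)
      ≥ 1/100 * N - 200 * d * ∑ a, ∑ b, ∑ c, S a b c ^ 2 := by
    set F : Fin n → Fin n → Fin n → ℝ := fun a b c =>
      (γ a + l a * γ b * γ c * (l b + l c)) * S a b c ^ 2 with hF
    have e1 : ∑ a, ∑ b, ∑ c, γ a * S a b c ^ 2
      + ∑ a, ∑ b, ∑ c, l a * γ b * γ c * (l b + l c) * S a b c ^ 2 = ∑ a, ∑ b, ∑ c, F a b c := by
      simp only [hF, ← Finset.sum_add_distrib]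
      exact Finset.sum_congr rfl fun k _ => Finset.sum_congr rfl fun j _ =>
        Finset.sum_congr rfl fun i _ => by ring
    have e2 : 3 * ∑ a, ∑ b, ∑ c, F a b c = ∑ a, ∑ b, ∑ c, (F a b c + F b c a + F c a b) := by
      simp only [Finset.sum_add_distrib]
      rw [sum3_cyc F, sum3_cyc (fun a b c => F b c a), sum3_cyc F]; ring
    have e3 : ∀ a b c, F a b c + F b c a + F c a b
        = γ a * γ b * γ c * SS (l a) (l b) (l c) * S a b c ^ 2 := by
      intro a b c
      have s1 : S b c a = S a b c := by rw [c2, c1]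
      have s2 : S c a b = S a b c := by rw [c1, c2]
      simp only [hF, s1, s2]
      unfold SS QQ
      have g1 := gm a
      have g2 := gm b
      have g3 := gm c
      have k1 : γ a = γ a * (γ b * (1 + l b ^ 2)) * (γ c * (1 + l c ^ 2)) := by rw [g2, g3]; ring
      have k2 : γ b = γ b * (γ a * (1 + l a ^ 2)) * (γ c * (1 + l c ^ 2)) := by rw [g1, g3]; ring
      have k3 : γ c = γ c * (γ b * (1 + l b ^ 2)) * (γ a * (1 + l a ^ 2)) := by rw [g2, g1]; ring
      have m1 : γ b * γ c = γ b * γ c * (γ a * (1 + l a ^ 2)) := by rw [g1]; ring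
      have m2 : γ c * γ a = γ c * γ a * (γ b * (1 + l b ^ 2)) := by rw [g2]; ring
      have m3 : γ a * γ b = γ a * γ b * (γ c * (1 + l c ^ 2)) := by rw [g3]; ring
      linear_combination (k1 + k2 + k3 + l a * (l b + l c) * m1 + l b * (l c + l a) * m2
        + l c * (l a + l b) * m3) * S a b c ^ 2
    have e4 : 1/100 * N - 200 * d * ∑ a, ∑ b, ∑ c, S a b c ^ 2
        = ∑ a, ∑ b, ∑ c, ((if b = c then 1/100 else 0) - 200 * d) * S a b c ^ 2 := by
      simp only [sub_mul, Finset.sum_sub_distrib, ite_mul, zero_mul, Finset.sum_ite_eq,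
        Finset.mem_univ, if_true, hN, Finset.mul_sum]
    rw [e1, e2, e4, ge_iff_le]
    refine Finset.sum_le_sum fun a _ => Finset.sum_le_sum fun b _ => Finset.sum_le_sum fun c _ => ?_
    rw [e3]
    refine mul_le_mul_of_nonneg_right ?_ (sq_nonneg _)
    have p3 : 0 < γ a * γ b * γ c := mul_pos (mul_pos (gpos a) (gpos b)) (gpos c)
    have p4 : γ a * γ b * γ c ≤ 1 := mul_le_one₀ (mul_le_one₀ (gle a) (gpos b).le (gle b)) (gpos c).le (gle c)
    split_ifs with hbc
    · subst hbc
      have h5 : 1 ≤ SS (l a) (l b) (l b) := by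
        rw [SS_rot]; exact SS_diag _ _ (hl2 a)
      have h6 : (1/4.24 : ℝ) * (1/4.24) * (1/4.24) ≤ γ a * γ b * γ b := by
        have := gge a
        have := gge b
        gcongr
      have h7 : γ a * γ b * γ b * 1 ≤ γ a * γ b * γ b * SS (l a) (l b) (l b) :=
        mul_le_mul_of_nonneg_left h5 p3.le
      norm_num at h6
      linarith
    · have h5 := SS_lower d (l a) (l b) (l c) hd0 hd (hl a) (hl b) (hl c)
      have h7 := mul_le_mul_of_nonneg_left h5 p3.le
      nlinarith
  -- the trace terms
  have hp : ∑ k, (T k).trace ^ 2 ≤ n * N := by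
    rw [← orth_norm h1, hN, Finset.mul_sum]
    refine Finset.sum_le_sum fun a _ => ?_
    have e : (Oᵀ *ᵥ fun k => (T k).trace) a = ∑ b, S a b b := by
      have := tr3 (T := T) h1 h2 hH 1 one a
      simpa using this
    rw [e]
    have := sq_sum_le_card_mul_sum_sq (s := Finset.univ) (f := fun b => S a b b)
    simpa using this
  have hY : ∑ k, (∑ b, H k b * (T b).trace - (H * T k).trace) ^ 2 ≤ 16 * (n * N) := by
    rw [← orth_norm h1, hN, Finset.mul_sum, Finset.mul_sum]
    refine Finset.sum_le_sum fun a _ => ?_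
    have e : (Oᵀ *ᵥ fun k => (∑ b, H k b * (T b).trace - (H * T k).trace)) a
        = ∑ b, (l a - l b) * S a b b := by
      have e1 := tr3 (T := T) h1 h2 hH H hH a
      have e0 := tr3 (T := T) h1 h2 hH 1 one a
      simp only [Matrix.one_mul, one_mul] at e0
      have e2 : (fun k => (∑ b, H k b * (T b).trace - (H * T k).trace))
          = H *ᵥ (fun k => (T k).trace) - fun k => (H * T k).trace := rfl
      rw [e2, Matrix.mulVec_sub, Pi.sub_apply, e1]
      have e3 : Oᵀ *ᵥ (H *ᵥ (fun k => (T k).trace))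
          = Matrix.diagonal l *ᵥ (Oᵀ *ᵥ (fun k => (T k).trace)) := by
        rw [Matrix.mulVec_mulVec, Matrix.mulVec_mulVec]
        congr 1
        rw [hH, ← Matrix.mul_assoc, ← Matrix.mul_assoc, h2, Matrix.one_mul]
      rw [e3, Matrix.mulVec_diagonal, e0, Finset.mul_sum, ← Finset.sum_sub_distrib]
      exact Finset.sum_congr rfl fun b _ => by rw [hS]; ring
    rw [e]
    have := sq_sum_le_card_mul_sum_sq (s := Finset.univ) (f := fun b => (l a - l b) * S a b b)
    refine this.trans ?_
    rw [Finset.card_univ, Fintype.card_fin]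
    have e5 : ∑ b, ((l a - l b) * S a b b) ^ 2 ≤ 16 * ∑ b, S a b b ^ 2 := by
      rw [Finset.mul_sum]
      refine Finset.sum_le_sum fun b _ => ?_
      rw [mul_pow]
      refine mul_le_mul_of_nonneg_right ?_ (sq_nonneg _)
      nlinarith [hl2 a, hl2 b, sq_nonneg (l a + l b)]
    calc (n:ℝ) * _ ≤ n * (16 * ∑ b, S a b b ^ 2) := by gcongr
      _ = _ := by ring
  set Q := ∑ a, ∑ b, ∑ c, γ a * S a b c ^ 2
      + ∑ a, ∑ b, ∑ c, l a * γ b * γ c * (l b + l c) * S a b c ^ 2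
  have h8 : N ≤ 300 * Q + 20000 * d * ∑ a, ∑ b, ∑ c, S a b c ^ 2 := by linarith
  have h9 := mul_le_mul_of_nonneg_left h8 (Nat.cast_nonneg (α := ℝ) n)
  nlinarith
end talg

open MeasureTheory Set Filter Topology
open scoped ContDiff Matrix

noncomputable def wF {n : ℕ} (u : EE n → ℝ) (x : EE n) : ℝ := ∑ k, ∑ l, (1 / 2) * (Hm u x k l) ^ 2
noncomputable def DD {n : ℕ} (u : EE n → ℝ) (x : EE n) : ℝ := ∑ i, ∑ j, ∑ k, Tm u i x j k ^ 2
noncomputable def pF {n : ℕ} (u : EE n → ℝ) (k : Fin n) (x : EE n) : ℝ := (Tm u k x).trace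
noncomputable def YF {n : ℕ} (u : EE n → ℝ) (k : Fin n) (x : EE n) : ℝ :=
  ∑ b, Hm u x k b * pF u b x - (Hm u x * Tm u k x).trace

section wlap
variable {n : ℕ} {u : EE n → ℝ} {x y : EE n} {d r : ℝ}

theorem Lap_w (hs : Sol d u) : Lap u (wF u) x
    = ∑ i, ∑ j, Gm u x i j * (Tm u j x * Tm u i x).trace
      + ∑ i, ∑ j, Hm u x i j * (Gm u x * (Tm u j x * Hm u x + Hm u x * Tm u j x) * Gm u x * Tm u i x).trace := by
  have hu := hs.sm
  have h1 : ∀ k l, Sm (fun x => Hm u x k l) := SmM_H hu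
  have h2 : ∀ k l, Sm (fun x => (1 / 2) * Hm u x k l ^ 2) := fun k l => (Sm.const _).mul ((h1 k l).pow 2)
  unfold wF
  rw [Lap_sum (fun k => Sm.sum fun l => h2 k l)]
  simp only [Lap_sum (fun l => h2 _ l), Lap_const_mul _ ((h1 _ _).pow 2), Lap_sq (h1 _ _), Lap_H hs]
  have e1 : ∑ i, ∑ j, Gm u x i j * (Tm u j x * Tm u i x).trace
      = ∑ k, ∑ l, ∑ i, ∑ j, Gm u x i j * pd i (fun y => Hm u y k l) x * pd j (fun y => Hm u y k l) x := by
    have : ∀ i j, Gm u x i j * (Tm u j x * Tm u i x).trace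
        = ∑ k, ∑ l, Gm u x i j * Tm u i x k l * Tm u j x k l := by
      intro i j
      rw [trace_eq _ _ (Tm_symm hu i), Finset.mul_sum]
      refine Finset.sum_congr rfl fun k _ => ?_
      rw [Finset.mul_sum]
      exact Finset.sum_congr rfl fun l _ => by ring
    simp only [this]
    have hT : ∀ i k l, pd i (fun y => Hm u y k l) x = Tm u i x k l := fun _ _ _ => rfl
    simp only [hT]
    calc _ = ∑ i, ∑ k, ∑ j, ∑ l, Gm u x i j * Tm u i x k l * Tm u j x k l :=
          Finset.sum_congr rfl fun i _ => Finset.sum_comm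
      _ = ∑ k, ∑ i, ∑ j, ∑ l, Gm u x i j * Tm u i x k l * Tm u j x k l := Finset.sum_comm
      _ = ∑ k, ∑ i, ∑ l, ∑ j, Gm u x i j * Tm u i x k l * Tm u j x k l :=
          Finset.sum_congr rfl fun k _ => Finset.sum_congr rfl fun i _ => Finset.sum_comm
      _ = _ := Finset.sum_congr rfl fun k _ => Finset.sum_comm
  rw [e1, ← Finset.sum_add_distrib]
  refine Finset.sum_congr rfl fun k _ => ?_
  rw [← Finset.sum_add_distrib]
  refine Finset.sum_congr rfl fun l _ => ?_
  rw [trace_eq _ _ (Tm_symm hu k)]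
  ring

theorem alg_u (hs : Sol d u) : ∑ k, pF u k x ^ 2 + ∑ k, YF u k x ^ 2
    ≤ 5100 * n * Lap u (wF u) x + 340000 * n * d * DD u x := by
  have hu := hs.sm
  rw [Lap_w hs]
  exact alg_main (Hm_symm (x := x) hu) hs.hd0 hs.hd (hs.bd x) (T := fun k => Tm u k x)
    (fun i j k => Tm_swap hu i j k) (fun i j k => Tm_swap2 hu i j k)

theorem Sm_p (hu : Sm u) (k : Fin n) : Sm (pF u k) := by
  unfold pF Matrix.trace
  exact Sm.sum fun i => ((hu.pd i).pd i).pd k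
theorem Sm_Y (hu : Sm u) (k : Fin n) : Sm (YF u k) := by
  unfold YF
  refine Sm.sub (Sm.sum fun b => ((hu.pd _).pd _).mul (Sm_p hu b)) ?_
  simp only [Matrix.trace, Matrix.diag, Matrix.mul_apply]
  exact Sm.sum fun i => Sm.sum fun j => ((hu.pd _).pd _).mul (((hu.pd _).pd _).pd _)
theorem Sm_D (hu : Sm u) : Sm (DD u) := by
  unfold DD
  exact Sm.sum fun i => Sm.sum fun j => Sm.sum fun k => Sm.pow (((hu.pd _).pd _).pd _) 2
theorem Sm_w (hu : Sm u) : Sm (wF u) := by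
  unfold wF
  exact Sm.sum fun i => Sm.sum fun j => (Sm.const _).mul (Sm.pow ((hu.pd _).pd _) 2)

theorem div_Y (hu : Sm u) : ∑ k, pd k (YF u k) x = ∑ k, pF u k x ^ 2 - DD u x := by
  have hH : ∀ k b, Sm (fun x => Hm u x k b) := SmM_H hu
  have hT : ∀ k i j, Sm (fun x => Tm u k x i j) := fun k i j => ((hu.pd _).pd _).pd _
  have e : ∀ k, pd k (YF u k) x = ∑ b, (Tm u k x k b * pF u b x + Hm u x k b * pd k (pF u b) x)
      - ∑ i, ∑ j, (Tm u k x i j * Tm u k x i j + Hm u x i j * pd k (fun x => Tm u k x i j) x) := by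
    intro k
    have : YF u k = fun x => (∑ b, Hm u x k b * pF u b x) - ∑ i, ∑ j, Hm u x i j * Tm u k x i j := by
      ext z; unfold YF; rw [trace_eq _ _ (Tm_symm hu k)]
    rw [this, pd_sub (Sm.sum fun b => (hH _ _).mul (Sm_p hu b)).da
      (Sm.sum fun i => Sm.sum fun j => (hH i j).mul (hT k i j)).da,
      pd_sum (fun b => ((hH _ _).mul (Sm_p hu b)).da),
      pd_sum (fun i => (Sm.sum fun j => (hH i j).mul (hT k i j)).da)]
    congr 1
    · exact Finset.sum_congr rfl fun b _ => pd_mul (hH _ _).da (Sm_p hu b).da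
    · refine Finset.sum_congr rfl fun i _ => ?_
      rw [pd_sum (fun j => ((hH i j).mul (hT k i j)).da)]
      exact Finset.sum_congr rfl fun j _ => pd_mul (hH _ _).da (hT _ _ _).da
  simp only [e, Finset.sum_sub_distrib, Finset.sum_add_distrib]
  have e1 : ∑ k, ∑ b, Tm u k x k b * pF u b x = ∑ k, pF u k x ^ 2 := by
    refine Finset.sum_comm.trans (Finset.sum_congr rfl fun b _ => ?_)
    rw [← Finset.sum_mul, pow_two]
    congr 1
    refine Finset.sum_congr rfl fun k _ => ?_
    rw [Tm_swap2 hu k k b, Tm_swap hu k b k]; rfl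
  have e2 : ∑ k, ∑ b, Hm u x k b * pd k (pF u b) x
      = ∑ k, ∑ i, ∑ j, Hm u x i j * pd k (fun x => Tm u k x i j) x := by
    have hp : ∀ k b, pd k (pF u b) x = ∑ a, pd a (fun x => Tm u a x k b) x := by
      intro k b
      have h0 : pF u b = fun x => ∑ a, Tm u b x a a := rfl
      rw [h0, pd_sum (fun a => (hT b a a).da)]
      refine Finset.sum_congr rfl fun a _ => ?_
      have h1 : (fun x => Tm u b x a a) = pd a (fun x => Hm u x b a) := by
        ext z; rw [Tm_swap hu]; rfl
      rw [h1, pd_comm (hH b a)]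
      congr 1
      ext z
      change Tm u k z b a = Tm u a z k b
      rw [Tm_swap2 hu, Tm_swap hu]
    simp only [hp, Finset.mul_sum]
    calc _ = ∑ i, ∑ k, ∑ j, Hm u x i j * pd k (fun x => Tm u k x i j) x :=
          Finset.sum_congr rfl fun i _ => Finset.sum_comm
      _ = _ := Finset.sum_comm
  have e3 : ∑ k, ∑ i, ∑ j, Tm u k x i j * Tm u k x i j = DD u x := by
    unfold DD; simp only [pow_two]
  rw [e1, e2, e3]; ring

theorem w_bd (hs : Sol d u) : 0 ≤ wF u x ∧ wF u x ≤ 2 * n := by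
  unfold wF
  refine ⟨by positivity, ?_⟩
  have h : ∀ l, ∑ k, (Hm u x k l) ^ 2 ≤ 4 := by
    intro l
    have := bd4 (x := x) hs (fun j => if j = l then 1 else 0)
    simpa using this
  calc _ = ∑ l, (1 / 2) * ∑ k, (Hm u x k l) ^ 2 := by
        simp only [Finset.mul_sum]; exact Finset.sum_comm
    _ ≤ ∑ l : Fin n, (1 / 2) * 4 := Finset.sum_le_sum fun l _ => by have := h l; linarith
    _ = _ := by simp; ring

theorem pd_sF_bd (hs : Sol d u) : ∑ j, pd j (sF u y) x ^ 2 ≤ 40 * sF u y x := by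
  have h1 := bd4 (x := x) hs (fun a => pd a u x - pd a u y)
  calc _ ≤ ∑ j, (8 * (x j - y j) ^ 2 + 8 * (∑ a, Hm u x j a * (pd a u x - pd a u y)) ^ 2) :=
        Finset.sum_le_sum fun j _ => by
          rw [pd_sF hs.sm]
          nlinarith [sq_nonneg ((x j - y j) - (∑ a, Hm u x j a * (pd a u x - pd a u y)))]
    _ ≤ _ := by
        rw [Finset.sum_add_distrib, ← Finset.mul_sum, ← Finset.mul_sum]
        unfold sF
        have : 0 ≤ ∑ j, (x j - y j) ^ 2 := by positivity
        have : 0 ≤ ∑ j, (pd j u x - pd j u y) ^ 2 := by positivity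
        linarith
end wlap

open MeasureTheory Set Filter Topology
open scoped ContDiff Matrix

noncomputable def v1 (n : ℕ) : ℝ := (volume (Metric.ball (0 : EE n) 1)).toReal

section energy
variable {n : ℕ} {u : EE n → ℝ} {x y : EE n} {d r : ℝ}

theorem v1_pos (n : ℕ) : 0 < v1 n :=
  ENNReal.toReal_pos (Metric.measure_ball_pos _ _ one_pos).ne' measure_ball_lt_top.ne

theorem vol_cb (y : EE n) (hr : 0 ≤ r) : volume.real (Metric.closedBall y r) = v1 n * r ^ n := by
  rw [Measure.real, Measure.addHaar_closedBall volume y hr]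
  simp [v1, ENNReal.toReal_mul, ENNReal.toReal_ofReal (pow_nonneg hr n), mul_comm]

theorem int_le_ball {f : EE n → ℝ} {M : ℝ} (y : EE n) (hr : 0 ≤ r) (hM : 0 ≤ M)
    (h1 : ∀ x, f x ≤ M) (h2 : ∀ x, r < ‖x - y‖ → f x ≤ 0) : ∫ x, f x ≤ M * (v1 n * r ^ n) := by
  by_cases hf : Integrable f
  · calc ∫ x, f x ≤ ∫ x, (Metric.closedBall y r).indicator (fun _ => M) x := by
          refine integral_mono hf ?_ ?_
          · exact (integrable_indicator_iff measurableSet_closedBall).2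
              (integrableOn_const (measure_closedBall_lt_top.ne))
          · intro x
            by_cases hx : x ∈ Metric.closedBall y r
            · rw [indicator_of_mem hx]; exact h1 x
            · rw [indicator_of_notMem hx]
              apply h2
              rw [Metric.mem_closedBall, dist_eq_norm] at hx
              exact not_le.1 hx
      _ = _ := by
          rw [integral_indicator measurableSet_closedBall, setIntegral_const, vol_cb y hr]
          simp [mul_comm]
  · rw [integral_undef hf]
    have := v1_pos n
    positivity

theorem mF_zero (hr : 0 < r) (h : r < ‖x - y‖) : mF u y r x = 0 := by
  by_contra hc
  exact absurd (norm_lt_of_sF hr (mF_ne hr hc)) (not_lt.2 h.le)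

theorem int_m (hr : 0 < r) : ∫ x, mF u y r x ≤ v1 n * r ^ n := by
  have := int_le_ball (f := mF u y r) (M := 1) y hr.le zero_le_one (fun x => mF_le_one)
    (fun x h => (mF_zero hr h).le)
  linarith

theorem be_le (hs : Sol d u) (hr : 0 < r) : be u y (wF u) r ≤ 2 * n * 5 ^ n * v1 n := by
  unfold be
  have := int_le_ball (f := fun x => mF u y r x ^ 2 * (wF u x * om u x)) (M := 2 * n * 5 ^ n)
    y hr.le (by positivity) (fun x => ?_) (fun x h => by simp [mF_zero hr h])
  · rw [inv_mul_le_iff₀ (by positivity)]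
    linarith
  · have h1 := w_bd (x := x) hs
    have h2 := om_pos (x := x) hs.sm
    have h3 := om_le (x := x) hs
    have h4 : mF u y r x ^ 2 ≤ 1 := pow_le_one₀ mF_nonneg mF_le_one
    calc mF u y r x ^ 2 * (wF u x * om u x) ≤ 1 * (wF u x * om u x) := by
          have := mul_nonneg h1.1 h2.le
          gcongr
      _ ≤ 1 * (2 * n * 5 ^ n) := by
          have := h1.1; have := h1.2; gcongr
      _ = _ := one_mul _

theorem be_nonneg (hs : Sol d u) (hr : 0 < r) : 0 ≤ be u y (wF u) r := by
  unfold be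
  refine mul_nonneg (by positivity) (integral_nonneg fun x => ?_)
  exact mul_nonneg (sq_nonneg _) (mul_nonneg (w_bd hs).1 (om_pos hs.sm).le)

theorem D_est (hs : Sol d u) (hr : 0 < r) {A : ℝ} (hA : 1 ≤ A) :
    ∫ x, mF u y r x ^ 3 * DD u x
      ≤ A * (∫ x, mF u y r x ^ 3 * (∑ k, pF u k x ^ 2 + ∑ k, YF u k x ^ 2))
        + 90 / A / r ^ 2 * (v1 n * r ^ n) := by
  have hu := hs.sm
  have hm := mF_cont (y := y) (r := r) hu
  have hD := (Sm_D hu).cont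
  have hp := fun k => (Sm_p hu k).cont
  have hY := fun k => (Sm_Y hu k).cont
  have hsf := fun k => ((Sm_sF hu y).pd k).cont
  have h1 := ibp3 (y := y) hu hr (X := YF u) (Sm_Y hu)
  have e1 : ∫ x, mF u y r x ^ 3 * ∑ i, pd i (YF u i) x
      = (∫ x, mF u y r x ^ 3 * ∑ k, pF u k x ^ 2) - ∫ x, mF u y r x ^ 3 * DD u x := by
    rw [← integral_sub (int_of (u := u) (y := y) hr (by fun_prop) (fun x h => by simp [h]))
      (int_of (u := u) (y := y) hr (by fun_prop) (fun x h => by simp [h]))]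
    refine integral_congr_ae (Eventually.of_forall fun x => ?_)
    simp only [div_Y hu]; ring
  rw [e1] at h1
  have h2 : ∫ x, mF u y r x ^ 3 * DD u x = ∫ x, (mF u y r x ^ 3 * ∑ k, pF u k x ^ 2
      - 3 / r ^ 2 * (mF u y r x ^ 2 * ∑ i, YF u i x * pd i (sF u y) x)) := by
    rw [integral_sub (int_of (u := u) (y := y) hr (by fun_prop) (fun x h => by simp [h]))
      (int_of (u := u) (y := y) hr (by fun_prop) (fun x h => by simp [h])), integral_const_mul]
    linarith
  rw [h2]
  calc _ ≤ ∫ x, (A * (mF u y r x ^ 3 * (∑ k, pF u k x ^ 2 + ∑ k, YF u k x ^ 2))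
        + 90 / A / r ^ 2 * mF u y r x) := by
        refine integral_mono (int_of (u := u) (y := y) hr (by fun_prop) (fun x h => by simp [h]))
          (int_of (u := u) (y := y) hr (by fun_prop) (fun x h => by simp [h])) fun x => ?_
        have m0 : 0 ≤ mF u y r x := mF_nonneg
        have hpp : 0 ≤ ∑ k, pF u k x ^ 2 := by positivity
        by_cases hz : mF u y r x = 0
        · simp [hz]
        have hsr := mF_ne hr hz
        have hb := pd_sF_bd (x := x) (y := y) hs
        have key : ∀ i, -(3 / r ^ 2 * (mF u y r x ^ 2 * (YF u i x * pd i (sF u y) x)))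
            ≤ A * (mF u y r x ^ 3 * YF u i x ^ 2) + 9 / (4 * A * r ^ 4) * (mF u y r x * pd i (sF u y) x ^ 2) := by
          intro i
          have hA0 : 0 < A := by linarith
          have e : A * (mF u y r x ^ 3 * YF u i x ^ 2) + 9 / (4 * A * r ^ 4) * (mF u y r x * pd i (sF u y) x ^ 2)
            + (3 / r ^ 2 * (mF u y r x ^ 2 * (YF u i x * pd i (sF u y) x)))
            = A * mF u y r x * (mF u y r x * YF u i x + 3 / (2 * A * r ^ 2) * pd i (sF u y) x) ^ 2 := by
            field_simp; ring
          have : 0 ≤ A * mF u y r x * (mF u y r x * YF u i x + 3 / (2 * A * r ^ 2) * pd i (sF u y) x) ^ 2 := by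
            positivity
          linarith
        have key2 := Finset.sum_le_sum fun i (_ : i ∈ Finset.univ) => key i
        rw [Finset.sum_neg_distrib, ← Finset.mul_sum, ← Finset.mul_sum, Finset.sum_add_distrib,
          ← Finset.mul_sum, ← Finset.mul_sum, ← Finset.mul_sum, ← Finset.mul_sum] at key2
        have k3 : 9 / (4 * A * r ^ 4) * (mF u y r x * ∑ i, pd i (sF u y) x ^ 2)
            ≤ 90 / A / r ^ 2 * mF u y r x := by
          have hA0 : 0 < A := by linarith
          calc _ ≤ 9 / (4 * A * r ^ 4) * (mF u y r x * (40 * r ^ 2)) := by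
                gcongr; linarith
            _ = _ := by field_simp; ring
        have k4 : mF u y r x ^ 3 * ∑ k, pF u k x ^ 2 ≤ A * (mF u y r x ^ 3 * ∑ k, pF u k x ^ 2) :=
          le_mul_of_one_le_left (by positivity) hA
        simp only []
        rw [mul_add (mF u y r x ^ 3), mul_add A]
        linarith
    _ ≤ _ := by
        rw [integral_add (int_of (u := u) (y := y) hr (by fun_prop) (fun x h => by simp [h]))
          (int_of (u := u) (y := y) hr (by fun_prop) (fun x h => by simp [h])),
          integral_const_mul, integral_const_mul]
        have hA0 : 0 < A := by linarith
        have := int_m (u := u) (y := y) hr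
        gcongr

theorem G_est (hs : Sol d u) (hr : 0 < r) :
    ∫ x, mF u y r x ^ 3 * (∑ k, pF u k x ^ 2 + ∑ k, YF u k x ^ 2)
      ≤ 5100 * n * (∫ x, mF u y r x ^ 3 * (om u x * Lap u (wF u) x))
        + 340000 * n * d * 5 ^ n * ∫ x, mF u y r x ^ 3 * DD u x := by
  have hu := hs.sm
  have hm := mF_cont (y := y) (r := r) hu
  have hD := (Sm_D hu).cont
  have hp := fun k => (Sm_p hu k).cont
  have hY := fun k => (Sm_Y hu k).cont
  have ho := (Sm_om hu).cont
  have hL := (Sm_Lap hu (Sm_w hu)).cont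
  rw [← integral_const_mul, ← integral_const_mul,
    ← integral_add (int_of (u := u) (y := y) hr (by fun_prop) (fun x h => by simp [h]))
      (int_of (u := u) (y := y) hr (by fun_prop) (fun x h => by simp [h]))]
  refine integral_mono (int_of (u := u) (y := y) hr (by fun_prop) (fun x h => by simp [h]))
    (int_of (u := u) (y := y) hr (by fun_prop) (fun x h => by simp [h])) fun x => ?_
  have h1 := alg_u (x := x) hs
  have h0 : 0 ≤ ∑ k, pF u k x ^ 2 + ∑ k, YF u k x ^ 2 := by positivity
  have m0 : 0 ≤ mF u y r x ^ 3 := pow_nonneg mF_nonneg 3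
  have o1 := om_ge (x := x) hu
  have o2 := om_le (x := x) hs
  have hD0 : 0 ≤ DD u x := by unfold DD; positivity
  have hd0 := hs.hd0
  have h2 : ∑ k, pF u k x ^ 2 + ∑ k, YF u k x ^ 2
      ≤ 5100 * n * (om u x * Lap u (wF u) x) + 340000 * n * d * 5 ^ n * DD u x := by
    calc _ ≤ om u x * (5100 * n * Lap u (wF u) x + 340000 * n * d * DD u x) := by nlinarith
      _ = 5100 * n * (om u x * Lap u (wF u) x) + 340000 * n * d * om u x * DD u x := by ring
      _ ≤ _ := by gcongr
  have h3 := mul_le_mul_of_nonneg_left h2 m0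
  simp only []
  linarith

theorem small_energy (hn : 4 ≤ n) {κ : ℝ} (hκ : 0 < κ) : ∃ d0 : ℝ, 0 < d0 ∧ d0 ≤ 0.03 ∧
    ∀ u : EE n → ℝ, Sol d0 u → ∀ r0 : ℝ, 0 < r0 → ∃ r, r0 ≤ r ∧
      r ^ 2 * (∫ x, mF u 0 r x ^ 3 * DD u x) < κ * r ^ n := by
  have hn0 : (0:ℝ) < n := by positivity
  have hv := v1_pos n
  set A := max 1 (180 * v1 n / κ) with hAdef
  have hA1 : 1 ≤ A := le_max_left _ _
  have hA0 : 0 < A := by linarith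
  have hA2 : 90 / A * v1 n ≤ κ / 2 := by
    have : 180 * v1 n / κ ≤ A := le_max_right _ _
    rw [div_le_iff₀ hκ] at this
    rw [div_mul_eq_mul_div, div_le_iff₀ hA0]
    linarith
  set d0 := min 0.03 (1 / (4 * A * 340000 * n * 5 ^ n)) with hd0
  have hd0p : 0 < d0 := lt_min (by norm_num) (by positivity)
  have hd1 : 2 * A * (340000 * n * d0 * 5 ^ n) ≤ 1 / 2 := by
    have : d0 ≤ 1 / (4 * A * 340000 * n * 5 ^ n) := min_le_right _ _
    rw [le_div_iff₀ (by positivity)] at this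
    linarith
  refine ⟨d0, hd0p, min_le_left _ _, fun u hs r0 hr0 => ?_⟩
  by_contra hc
  push Not at hc
  set c := κ / (20400 * A * n) / 6 with hcdef
  have hc0 : 0 < c := by positivity
  have hder : ∀ r, r0 ≤ r → HasDerivAt (be u 0 (wF u)) _ r :=
    fun r hr => be_deriv (y := 0) hs.sm (Sm_w hs.sm).cont (hr0.trans_le hr)
  have hge : ∀ r, r0 ≤ r → c / r ≤ (r ^ n)⁻¹ * ((∫ x, 4 * sF u 0 x / r ^ 3 * mF u 0 r x * (wF u x * om u x))
      - n / r * ∫ x, mF u 0 r x ^ 2 * (wF u x * om u x)) := by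
    intro r hr
    have hrp : 0 < r := hr0.trans_le hr
    refine le_trans ?_ (be_deriv_ge hs (Sm_w hs.sm) hrp (fun x _ => (w_bd hs).1))
    have h1 := D_est (y := 0) hs hrp hA1
    have h2 := G_est (y := 0) hs hrp
    have h3 := hc r hr
    generalize (∫ x, mF u 0 r x ^ 3 * DD u x) = ID at *
    generalize (∫ x, mF u 0 r x ^ 3 * (om u x * Lap u (wF u) x)) = L at *
    generalize (∫ x, mF u 0 r x ^ 3 * (∑ k, pF u k x ^ 2 + ∑ k, YF u k x ^ 2)) = IG at *
    have hrn : 0 < r ^ n := by positivity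
    have h4 : 90 / A / r ^ 2 * (v1 n * r ^ n) ≤ ID / 2 := by
      have : 90 / A / r ^ 2 * (v1 n * r ^ n) = (90 / A * v1 n) * r ^ n / r ^ 2 := by ring
      rw [this, div_le_iff₀ (by positivity)]
      nlinarith
    have hID : 0 ≤ ID := by
      have : 0 < κ * r ^ n := by positivity
      by_contra hneg
      push Not at hneg
      nlinarith [mul_pos hrp hrp]
    have h5 : ID ≤ 2 * A * IG := by linarith
    have h6 : ID ≤ 20400 * A * n * L := by
      have a1 := mul_le_mul_of_nonneg_left h2 (by positivity : 0 ≤ 2 * A)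
      have a2 := mul_le_mul_of_nonneg_right hd1 hID
      nlinarith
    have h7 : κ * r ^ n ≤ r ^ 2 * (20400 * A * n * L) :=
      h3.trans (mul_le_mul_of_nonneg_left h6 (by positivity))
    rw [hcdef]
    have e1 : κ / (20400 * A * ↑n) / 6 / r = (κ * r ^ n) / (20400 * A * n * 6 * r * r ^ n) := by
      field_simp
    have e2 : r / 6 * ((r ^ n)⁻¹ * L) = (r ^ 2 * (20400 * A * n * L)) / (20400 * A * n * 6 * r * r ^ n) := by
      field_simp
    rw [e1, e2]
    gcongr
  have hmono : MonotoneOn (fun r => be u 0 (wF u) r - c * Real.log r) (Ici r0) := by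
    have hd2 : ∀ r, r0 ≤ r → HasDerivAt (fun r => be u 0 (wF u) r - c * Real.log r) _ r :=
      fun r hr => (hder r hr).sub ((Real.hasDerivAt_log (hr0.trans_le hr).ne').const_mul c)
    refine monotoneOn_of_deriv_nonneg (convex_Ici r0)
      (fun r hr => (hd2 r hr).continuousAt.continuousWithinAt)
      (fun r hr => (hd2 r (interior_subset hr)).differentiableAt.differentiableWithinAt) ?_
    intro r hr
    have hr' : r0 ≤ r := interior_subset hr
    rw [(hd2 r hr').deriv]
    have := hge r hr'
    rw [div_eq_mul_inv] at this
    linarith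
  set B := 2 * (n:ℝ) * 5 ^ n * v1 n with hB
  have hB0 : 0 ≤ B := by positivity
  set R := r0 * Real.exp ((B + 1) / c) with hR
  have hRp : 0 < R := by positivity
  have hRr : r0 ≤ R := le_mul_of_one_le_right hr0.le (Real.one_le_exp (by positivity))
  have h := hmono (Set.mem_Ici.2 le_rfl) (Set.mem_Ici.2 hRr) hRr
  simp only [] at h
  rw [hR, Real.log_mul hr0.ne' (Real.exp_ne_zero _), Real.log_exp, ← hR] at h
  have h1 := be_le (y := 0) hs hRp
  have h2 := be_nonneg (y := 0) hs hr0
  have h3 : c * ((B + 1) / c) = B + 1 := by field_simp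
  nlinarith
end energy

open MeasureTheory Set Filter Topology
open scoped ContDiff Matrix

section poinc
variable {n : ℕ}

noncomputable def eD {n : ℕ} (F : EE n → ℝ) (x : EE n) : ℝ := ∑ j, pd j F x ^ 2

theorem Sm_eD {F : EE n → ℝ} (hF : Sm F) : Sm (eD F) := by
  unfold eD; exact Sm.sum fun j => (hF.pd j).pow 2
theorem eD_nonneg {F : EE n → ℝ} {x : EE n} : 0 ≤ eD F x := by unfold eD; positivity

theorem diff_sq {F : EE n → ℝ} (hF : Sm F) (x h : EE n) :
    (F (x + h) - F x) ^ 2 ≤ ‖h‖ ^ 2 * ∫ t in (0:ℝ)..1, eD F (x + t • h) := by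
  set φ : ℝ → ℝ := fun t => ∑ j, pd j F (x + t • h) * h j with hφ
  have cφ : Continuous φ := by
    have := fun j => (hF.pd j).cont
    rw [hφ]; fun_prop
  have ce : Continuous (fun t : ℝ => eD F (x + t • h)) := by
    have := (Sm_eD hF).cont
    fun_prop
  have h1 : ∫ t in (0:ℝ)..1, φ t = F (x + h) - F x := by
    have := intervalIntegral.integral_eq_sub_of_hasDerivAt (a := 0) (b := 1)
      (fun t _ => line_deriv2 hF x h t) (cφ.intervalIntegrable 0 1)
    simpa using this
  have h2 : (∫ t in (0:ℝ)..1, φ t) ^ 2 ≤ ∫ t in (0:ℝ)..1, φ t ^ 2 := by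
    set m := ∫ t in (0:ℝ)..1, φ t
    have h3 : 0 ≤ ∫ t in (0:ℝ)..1, (φ t - m) ^ 2 :=
      intervalIntegral.integral_nonneg zero_le_one fun t _ => sq_nonneg _
    have h4 : ∫ t in (0:ℝ)..1, (φ t - m) ^ 2 = (∫ t in (0:ℝ)..1, φ t ^ 2) - m ^ 2 := by
      have : ∀ t, (φ t - m) ^ 2 = φ t ^ 2 - 2 * m * φ t + m ^ 2 := fun t => by ring
      simp only [this]
      rw [intervalIntegral.integral_add ((by fun_prop : Continuous _).intervalIntegrable 0 1)
        ((by fun_prop : Continuous _).intervalIntegrable 0 1),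
        intervalIntegral.integral_sub ((by fun_prop : Continuous _).intervalIntegrable 0 1)
        ((by fun_prop : Continuous _).intervalIntegrable 0 1), intervalIntegral.integral_const_mul]
      simp
      change _ - 2 * m * m + m ^ 2 = _
      ring
    linarith
  rw [← h1]
  refine h2.trans ?_
  rw [← intervalIntegral.integral_const_mul]
  refine intervalIntegral.integral_mono_on zero_le_one ((by fun_prop : Continuous _).intervalIntegrable 0 1)
    ((by fun_prop : Continuous _).intervalIntegrable 0 1) fun t _ => ?_
  rw [hφ, nsq, mul_comm]
  exact Finset.sum_mul_sq_le_sq_mul_sq _ _ _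

theorem diff_sq_l {F : EE n → ℝ} (hF : Sm F) (x h : EE n) {ρ : ℝ} (hh : ‖h‖ ≤ ρ) :
    ENNReal.ofReal ((F (x + h) - F x) ^ 2)
      ≤ ENNReal.ofReal (ρ ^ 2) * ∫⁻ t in Icc (0:ℝ) 1, ENNReal.ofReal (eD F (x + t • h)) := by
  have ce : Continuous (fun t : ℝ => eD F (x + t • h)) := by
    have := (Sm_eD hF).cont
    fun_prop
  have e : ∫⁻ t in Icc (0:ℝ) 1, ENNReal.ofReal (eD F (x + t • h))
      = ENNReal.ofReal (∫ t in (0:ℝ)..1, eD F (x + t • h)) := by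
    rw [intervalIntegral.integral_of_le zero_le_one, ← integral_Icc_eq_integral_Ioc,
      ofReal_integral_eq_lintegral_ofReal ce.continuousOn.integrableOn_Icc
        (Eventually.of_forall fun t => eD_nonneg)]
  rw [e, ← ENNReal.ofReal_mul (sq_nonneg _)]
  refine ENNReal.ofReal_le_ofReal ((diff_sq hF x h).trans ?_)
  have : 0 ≤ ∫ t in (0:ℝ)..1, eD F (x + t • h) :=
      intervalIntegral.integral_nonneg zero_le_one fun t _ => eD_nonneg
  gcongr

theorem poinc {F : EE n → ℝ} (hF : Sm F) {ρ : ℝ} (hρ : 0 < ρ) :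
    ∃ c : ℝ, ∫ z in Metric.closedBall (0 : EE n) ρ, (F z - c) ^ 2
      ≤ 4 * ρ ^ 2 * 2 ^ n * ∫ z in Metric.closedBall (0 : EE n) (3 * ρ), eD F z := by
  set fe : EE n → ENNReal := fun x => ENNReal.ofReal (eD F x) with hfe
  have cF := hF.cont
  have ce := (Sm_eD hF).cont
  have mfe : Measurable fe := ce.measurable.ennreal_ofReal
  set B := Metric.closedBall (0 : EE n) ρ with hB
  set B2 := Metric.closedBall (0 : EE n) (2 * ρ) with hB2
  set B3 := Metric.closedBall (0 : EE n) (3 * ρ) with hB3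
  have mB : MeasurableSet B := measurableSet_closedBall
  have mB2 : MeasurableSet B2 := measurableSet_closedBall
  have mB3 : MeasurableSet B3 := measurableSet_closedBall
  set I : EE n → ENNReal := fun x => ∫⁻ z in B, ENNReal.ofReal ((F z - F x) ^ 2) with hI
  set K := ENNReal.ofReal ((2 * ρ) ^ 2)
  have s1 : ∀ x ∈ B, I x ≤ ∫⁻ h in B2, K * ∫⁻ t in Icc (0:ℝ) 1, fe (x + t • h) := by
    intro x hx
    calc I x = ∫⁻ z, B.indicator (fun z => ENNReal.ofReal ((F z - F x) ^ 2)) z := by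
          rw [lintegral_indicator mB]
      _ = ∫⁻ h, B.indicator (fun z => ENNReal.ofReal ((F z - F x) ^ 2)) (x + h) :=
          (lintegral_add_left_eq_self _ x).symm
      _ ≤ ∫⁻ h, B2.indicator (fun h => K * ∫⁻ t in Icc (0:ℝ) 1, fe (x + t • h)) h := by
          refine lintegral_mono fun h => ?_
          by_cases hh : x + h ∈ B
          · have h2 : h ∈ B2 := by
              rw [hB, mem_closedBall_zero_iff] at hx hh
              rw [hB2, mem_closedBall_zero_iff]
              calc ‖h‖ = ‖(x + h) - x‖ := by congr 1; abel
                _ ≤ ‖x + h‖ + ‖x‖ := norm_sub_le _ _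
                _ ≤ _ := by linarith
            rw [indicator_of_mem hh, indicator_of_mem h2]
            exact diff_sq_l hF x h (mem_closedBall_zero_iff.1 h2)
          · rw [indicator_of_notMem hh]; exact zero_le
      _ = _ := by rw [lintegral_indicator mB2]
  set E := ∫⁻ z in B3, fe z with hE
  have s2 : ∫⁻ x in B, I x ≤ K * (volume B2 * E) := by
    have mm : Measurable (fun p : (EE n × EE n) × ℝ => fe (p.1.1 + p.2 • p.1.2)) :=
      mfe.comp (by fun_prop)
    calc ∫⁻ x in B, I x ≤ ∫⁻ x in B, ∫⁻ h in B2, K * ∫⁻ t in Icc (0:ℝ) 1, fe (x + t • h) :=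
          setLIntegral_mono' mB s1
      _ = ∫⁻ h in B2, ∫⁻ x in B, K * ∫⁻ t in Icc (0:ℝ) 1, fe (x + t • h) := by
          rw [lintegral_lintegral_swap]
          exact (Measurable.const_mul (mm.lintegral_prod_right') K).aemeasurable
      _ = ∫⁻ h in B2, K * ∫⁻ x in B, ∫⁻ t in Icc (0:ℝ) 1, fe (x + t • h) := by
          refine lintegral_congr fun h => ?_
          rw [lintegral_const_mul' _ _ ENNReal.ofReal_ne_top]
      _ = ∫⁻ h in B2, K * ∫⁻ t in Icc (0:ℝ) 1, ∫⁻ x in B, fe (x + t • h) := by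
          refine lintegral_congr fun h => ?_
          congr 1
          rw [lintegral_lintegral_swap]
          exact (mfe.comp (by fun_prop : Measurable (fun p : EE n × ℝ => p.1 + p.2 • h))).aemeasurable
      _ ≤ ∫⁻ h in B2, K * E := by
          refine setLIntegral_mono' mB2 fun h hh => ?_
          gcongr
          calc _ ≤ ∫⁻ t in Icc (0:ℝ) 1, E := by
                refine setLIntegral_mono' measurableSet_Icc fun t ht => ?_
                calc ∫⁻ x in B, fe (x + t • h) = ∫⁻ x, B.indicator (fun x => fe (x + t • h)) x := by
                      rw [lintegral_indicator mB]
                  _ ≤ ∫⁻ x, B3.indicator fe (x + t • h) := by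
                      refine lintegral_mono fun x => ?_
                      by_cases hx : x ∈ B
                      · have h3 : x + t • h ∈ B3 := by
                          rw [hB, mem_closedBall_zero_iff] at hx
                          rw [hB2, mem_closedBall_zero_iff] at hh
                          rw [hB3, mem_closedBall_zero_iff]
                          refine (norm_add_le _ _).trans ?_
                          rw [norm_smul, Real.norm_eq_abs, abs_of_nonneg ht.1]
                          nlinarith [ht.2, norm_nonneg h]
                        rw [indicator_of_mem hx, indicator_of_mem h3]
                      · rw [indicator_of_notMem hx]; exact zero_le
                  _ = ∫⁻ x, B3.indicator fe x := lintegral_add_right_eq_self _ _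
                  _ = E := by rw [lintegral_indicator mB3]
            _ = E := by simp
      _ = _ := by rw [setLIntegral_const]; ring
  have vB : volume B ≠ 0 := (Metric.measure_closedBall_pos _ _ hρ).ne'
  have vB' : volume B ≠ ⊤ := measure_closedBall_lt_top.ne
  obtain ⟨x0, -, hx0⟩ := exists_le_setLAverage (f := I) vB vB' (by
    have : Measurable (fun p : EE n × EE n => ENNReal.ofReal ((F p.2 - F p.1) ^ 2)) :=
      (by fun_prop : Continuous (fun p : EE n × EE n => (F p.2 - F p.1) ^ 2)).measurable.ennreal_ofReal
    exact (this.lintegral_prod_right' (ν := volume.restrict B)).aemeasurable)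
  refine ⟨F x0, ?_⟩
  have s3 : I x0 ≤ K * (ENNReal.ofReal (2 ^ n) * E) := by
    refine hx0.trans ?_
    rw [setLAverage_eq]
    refine ENNReal.div_le_of_le_mul (s2.trans (le_of_eq ?_))
    rw [hB2, Measure.addHaar_closedBall_mul volume (0 : EE n) (by norm_num : (0:ℝ) ≤ 2) hρ.le,
      finrank_euclideanSpace_fin]
    ring
  have ie : IntegrableOn (eD F) B3 := ce.continuousOn.integrableOn_compact (isCompact_closedBall _ _)
  have iF : IntegrableOn (fun z => (F z - F x0) ^ 2) B :=
    (by fun_prop : Continuous _).continuousOn.integrableOn_compact (isCompact_closedBall _ _)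
  have e1 : I x0 = ENNReal.ofReal (∫ z in B, (F z - F x0) ^ 2) := by
    rw [ofReal_integral_eq_lintegral_ofReal iF (Eventually.of_forall fun z => sq_nonneg _)]
  have e2 : E = ENNReal.ofReal (∫ z in B3, eD F z) := by
    rw [ofReal_integral_eq_lintegral_ofReal ie (Eventually.of_forall fun z => eD_nonneg)]
  rw [e1, e2, ← ENNReal.ofReal_mul (by positivity), ← ENNReal.ofReal_mul (by positivity)] at s3
  have h0 : 0 ≤ ∫ z in B3, eD F z := integral_nonneg fun z => eD_nonneg
  rw [ENNReal.ofReal_le_ofReal_iff (by positivity)] at s3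
  refine s3.trans (le_of_eq ?_)
  ring
end poinc

open MeasureTheory Set Filter Topology
open scoped ContDiff Matrix

noncomputable def scU {n : ℕ} (R : ℝ) (u : EE n → ℝ) (x : EE n) : ℝ := (R ^ 2)⁻¹ * u (R • x)
noncomputable def fF {n : ℕ} (u : EE n → ℝ) (A : Matrix (Fin n) (Fin n) ℝ) (b : Fin n → ℝ) (k : Fin n)
    (x : EE n) : ℝ := pd k u x - ∑ j, A k j * x j - b k

section scaling
variable {n : ℕ} {u : EE n → ℝ} {x y : EE n} {d R : ℝ}

theorem pd_scale {f : EE n → ℝ} (hf : Sm f) (R : ℝ) (k : Fin n) :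
    pd k (fun x => f (R • x)) x = R * pd k f (R • x) := by
  unfold pd
  have h1 : HasFDerivAt (fun x : EE n => R • x) (R • ContinuousLinearMap.id ℝ (EE n)) x :=
    (hasFDerivAt_id x).const_smul R
  have h2 := (hf.da (x := R • x)).hasFDerivAt.comp x h1
  rw [show (fun x => f (R • x)) = f ∘ (fun x => R • x) from rfl, h2.fderiv]
  simp

theorem Sm_scale {f : EE n → ℝ} (hf : Sm f) (R : ℝ) : Sm (fun x => f (R • x)) := by
  unfold Sm at *
  exact hf.comp (by fun_prop)

theorem Sm_scU (hu : Sm u) : Sm (scU R u) := (Sm.const _).mul (Sm_scale hu R)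

theorem pd_scU (hu : Sm u) (hR : 0 < R) (k : Fin n) :
    pd k (scU R u) = fun x => R⁻¹ * pd k u (R • x) := by
  ext x
  unfold scU
  rw [pd_const_mul _ (Sm_scale hu R).da, pd_scale hu]
  field_simp

theorem Hm_scU (hu : Sm u) (hR : 0 < R) : Hm (scU R u) x = Hm u (R • x) := by
  ext i j
  simp only [Hm_apply]
  rw [pd_scU hu hR, pd_const_mul _ (Sm_scale (hu.pd j) R).da, pd_scale (hu.pd j)]
  field_simp

theorem Tm_scU (hu : Sm u) (hR : 0 < R) (k i j : Fin n) :
    Tm (scU R u) k x i j = R * Tm u k (R • x) i j := by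
  change pd k (fun x => Hm (scU R u) x i j) x = _
  simp only [Hm_scU hu hR]
  exact pd_scale (SmM_H hu i j) R k

theorem DD_scU (hu : Sm u) (hR : 0 < R) : DD (scU R u) x = R ^ 2 * DD u (R • x) := by
  unfold DD
  simp only [Tm_scU hu hR, mul_pow, Finset.mul_sum]

theorem Sol_scU (hs : Sol d u) (hR : 0 < R) : Sol d (scU R u) where
  sm := Sm_scU hs.sm
  hd0 := hs.hd0
  hd := hs.hd
  bd x v := by rw [Hm_scU hs.sm hR]; exact hs.bd _ v
  eq := by
    obtain ⟨c, hc, h⟩ := hs.eq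
    refine ⟨c, hc, fun x => ?_⟩
    have := h (R • x)
    unfold om gm at *
    rw [Hm_scU hs.sm hR]; exact this

theorem scU_scU (R S : ℝ) : scU S (scU R u) = scU (R * S) u := by
  ext x; unfold scU
  rw [smul_smul]; rw [mul_pow, mul_inv]; ring

theorem Sm_f (hu : Sm u) (A : Matrix (Fin n) (Fin n) ℝ) (b : Fin n → ℝ) (k : Fin n) :
    Sm (fF u A b k) :=
  ((hu.pd k).sub (Sm.sum fun j => (Sm.const _).mul (Sm.coord j))).sub (Sm.const _)

theorem pd_f (hu : Sm u) (A : Matrix (Fin n) (Fin n) ℝ) (b : Fin n → ℝ) (k i : Fin n) :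
    pd i (fF u A b k) x = Hm u x k i - A k i := by
  unfold fF
  have hl : Sm (fun x : EE n => ∑ j, A k j * x j) := Sm.sum fun j => (Sm.const _).mul (Sm.coord j)
  rw [pd_sub ((hu.pd k).sub hl).da (Sm.const _).da, pd_sub (hu.pd k).da hl.da, pd_const, sub_zero,
    pd_fun_mulVec, ← (Hm_symm hu).apply]
  rfl

theorem Lap_f (hs : Sol d u) (A : Matrix (Fin n) (Fin n) ℝ) (b : Fin n → ℝ) (k : Fin n) :
    Lap u (fF u A b k) x = 0 := by
  unfold fF
  have hl : Sm (fun x : EE n => ∑ j, A k j * x j) := Sm.sum fun j => (Sm.const _).mul (Sm.coord j)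
  rw [Lap_sub ((hs.sm.pd k).sub hl) (Sm.const _), Lap_sub (hs.sm.pd k) hl, Lap_const, Lap_lin, Lap_v hs]
  ring

theorem Lap_f2 (hs : Sol d u) (A : Matrix (Fin n) (Fin n) ℝ) (b : Fin n → ℝ) (k : Fin n) :
    0 ≤ Lap u (fun x => fF u A b k x ^ 2) x := by
  rw [Lap_sq (Sm_f hs.sm A b k), Lap_f hs]
  have := Gnn (x := x) hs.sm (fun i => pd i (fF u A b k) x)
  linarith

theorem init_flat (n : ℕ) : ∃ C : ℝ, 0 < C ∧ ∀ (d κ : ℝ) (u : EE n → ℝ), Sol d u →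
    ∫ z in Metric.closedBall (0 : EE n) (1 / 4), DD u z ≤ κ →
    ∃ A b, ∀ y : EE n, ‖y‖ ≤ 1 / 72 → ∀ k, fF u A b k y ^ 2 ≤ C * κ := by
  have hc := cN_pos n
  refine ⟨(cN n)⁻¹ * (72 ^ n * 5 ^ n * (2 ^ n * ((n + 1) * 2 ^ n))), by positivity, ?_⟩
  intro d κ u hs hκ
  have hu := hs.sm
  have iD : ∀ {F : EE n → ℝ} (ρ : ℝ), Sm F → IntegrableOn F (Metric.closedBall (0 : EE n) ρ) := fun ρ hF =>
    hF.cont.continuousOn.integrableOn_compact (isCompact_closedBall _ _)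
  have hκ0 : 0 ≤ κ := le_trans (integral_nonneg fun z => by unfold DD; positivity) hκ
  have h1 : ∀ k l, ∃ c : ℝ, ∫ z in Metric.closedBall (0 : EE n) (1 / 12), (Hm u z k l - c) ^ 2
      ≤ 2 ^ n * κ := by
    intro k l
    obtain ⟨c, hc⟩ := poinc (SmM_H hu k l) (by norm_num : (0:ℝ) < 1 / 12)
    refine ⟨c, hc.trans ?_⟩
    rw [show (3:ℝ) * (1 / 12) = 1 / 4 by norm_num]
    have : ∫ z in Metric.closedBall (0 : EE n) (1 / 4), eD (fun x => Hm u x k l) z ≤ κ := by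
      refine le_trans (setIntegral_mono (iD _ (Sm_eD (SmM_H hu k l))) (iD _ (Sm_D hu)) fun z => ?_) hκ
      unfold eD DD
      refine Finset.sum_le_sum fun i _ => ?_
      change Tm u i z k l ^ 2 ≤ _
      refine le_trans ?_ (Finset.single_le_sum (f := fun j => ∑ k, Tm u i z j k ^ 2)
        (fun _ _ => by positivity) (Finset.mem_univ k))
      exact Finset.single_le_sum (f := fun l => Tm u i z k l ^ 2)
        (fun _ _ => by positivity) (Finset.mem_univ l)
    calc _ ≤ 4 * (1 / 12) ^ 2 * 2 ^ n * κ := by gcongr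
      _ ≤ _ := by
        have : 0 ≤ 2 ^ n * κ := by positivity
        nlinarith
  choose A0 hA0 using h1
  obtain ⟨A, hA⟩ : ∃ A : Matrix (Fin n) (Fin n) ℝ, ∀ k l,
      ∫ z in Metric.closedBall (0 : EE n) (1 / 12), (Hm u z k l - A k l) ^ 2 ≤ 2 ^ n * κ :=
    ⟨Matrix.of A0, hA0⟩
  have h2 : ∀ k, ∃ c : ℝ, ∫ z in Metric.closedBall (0 : EE n) (1 / 36), (fF u A 0 k z - c) ^ 2
      ≤ 2 ^ n * ((n + 1) * 2 ^ n * κ) := by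
    intro k
    obtain ⟨c, hc⟩ := poinc (Sm_f hu A 0 k) (by norm_num : (0:ℝ) < 1 / 36)
    refine ⟨c, hc.trans ?_⟩
    rw [show (3:ℝ) * (1 / 36) = 1 / 12 by norm_num]
    have : ∫ z in Metric.closedBall (0 : EE n) (1 / 12), eD (fF u A 0 k) z ≤ (n + 1) * 2 ^ n * κ := by
      unfold eD
      simp only [pd_f hu]
      rw [integral_finsetSum _ fun i _ => iD _ (((SmM_H hu k i).sub (Sm.const _)).pow 2)]
      calc _ ≤ ∑ i : Fin n, 2 ^ n * κ := Finset.sum_le_sum fun i _ => hA k i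
        _ = n * (2 ^ n * κ) := by simp
        _ ≤ _ := by
          have : 0 ≤ 2 ^ n * κ := by positivity
          nlinarith
    calc _ ≤ 4 * (1 / 36) ^ 2 * 2 ^ n * ((n + 1) * 2 ^ n * κ) := by gcongr
      _ ≤ _ := by
        have : 0 ≤ 2 ^ n * ((n + 1) * 2 ^ n * κ) := by positivity
        nlinarith
  choose b hb using h2
  refine ⟨A, b, fun y hy k => ?_⟩
  have ef : ∀ z, fF u A 0 k z - b k = fF u A b k z := fun z => by unfold fF; simp
  have hbk := hb k
  simp only [ef] at hbk
  have hw : Sm (fun z => fF u A b k z ^ 2) := (Sm_f hu A b k).pow 2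
  have hM := M0 (y := y) hs hw (R := 1 / 72) (by norm_num) (fun x _ => sq_nonneg _) (fun x _ => Lap_f2 hs A b k)
  rw [mul_assoc, ← div_eq_inv_mul, le_div_iff₀ hc, mul_comm]
  refine hM.trans ?_
  unfold be
  have hI : ∫ x, mF u y (1 / 72) x ^ 2 * (fF u A b k x ^ 2 * om u x)
      ≤ 5 ^ n * ∫ z in Metric.closedBall (0 : EE n) (1 / 36), fF u A b k z ^ 2 := by
    rw [← integral_indicator measurableSet_closedBall, ← integral_const_mul]
    have hm := mF_cont (y := y) (r := 1 / 72) hu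
    have ho := (Sm_om hu).cont
    have hf := (Sm_f hu A b k).cont
    refine integral_mono (int_of (u := u) (y := y) (r := 1 / 72) (by norm_num) (by fun_prop) (fun x h => by rw [h]; simp))
      (((iD _ hw).integrable_indicator measurableSet_closedBall).const_mul _) fun x => ?_
    by_cases hx : mF u y (1 / 72) x = 0
    · simp only [hx]
      have : 0 ≤ (Metric.closedBall (0 : EE n) (1 / 36)).indicator (fun z => fF u A b k z ^ 2) x :=
        indicator_nonneg (fun z _ => sq_nonneg _) x
      have : (0:ℝ) ≤ 5 ^ n * (Metric.closedBall (0 : EE n) (1 / 36)).indicator (fun z => fF u A b k z ^ 2) x := by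
        positivity
      simpa using this
    · have h3 := norm_lt_of_sF (by norm_num) (mF_ne (by norm_num) hx)
      have hx2 : x ∈ Metric.closedBall (0 : EE n) (1 / 36) := by
        rw [mem_closedBall_zero_iff]
        calc ‖x‖ = ‖(x - y) + y‖ := by congr 1; abel
          _ ≤ ‖x - y‖ + ‖y‖ := norm_add_le _ _
          _ ≤ _ := by linarith
      simp only [indicator_of_mem hx2]
      have h4 : mF u y (1 / 72) x ^ 2 ≤ 1 := pow_le_one₀ mF_nonneg mF_le_one
      have h5 := om_le (x := x) hs
      have h6 := om_pos (x := x) hu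
      calc mF u y (1 / 72) x ^ 2 * (fF u A b k x ^ 2 * om u x) ≤ 1 * (fF u A b k x ^ 2 * 5 ^ n) := by
            gcongr
        _ = _ := by ring
  calc ((1 / 72 : ℝ) ^ n)⁻¹ * _ ≤ ((1 / 72 : ℝ) ^ n)⁻¹ * (5 ^ n * (2 ^ n * ((n + 1) * 2 ^ n * κ))) := by
        gcongr
        exact hI.trans (by gcongr)
    _ = _ := by
        rw [one_div, inv_pow, inv_inv]; ring
end scaling

open MeasureTheory Set Filter Topology
open scoped ContDiff Matrix

section start
variable {n : ℕ} {u : EE n → ℝ} {x y : EE n} {d R : ℝ}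

theorem fF_scU (hu : Sm u) (hR : 0 < R) (A : Matrix (Fin n) (Fin n) ℝ) (b : Fin n → ℝ) (k : Fin n) :
    fF (scU R u) A (fun k => R⁻¹ * b k) k x = R⁻¹ * fF u A b k (R • x) := by
  unfold fF
  rw [pd_scU hu hR]
  have : ∑ j, A k j * (R • x) j = R * ∑ j, A k j * x j := by
    rw [Finset.mul_sum]
    exact Finset.sum_congr rfl fun j _ => by simp; ring
  rw [this]
  field_simp

theorem mF_half (hs : Sol d u) (hR : 0 < R) (hx : ‖x - y‖ ≤ R / 4) : 1 / 2 ≤ mF u y R x := by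
  have h := sF_le (x := x) (y := y) hs
  have h2 : ‖x - y‖ ^ 2 ≤ (R / 4) ^ 2 := by gcongr
  unfold mF
  refine le_max_of_le_left ?_
  have : sF u y x / R ^ 2 ≤ 1 / 2 := by
    rw [div_le_iff₀ (by positivity)]; nlinarith [sq_nonneg R]
  linarith

theorem start_flat (hn : 4 ≤ n) {η : ℝ} (hη : 0 < η) : ∃ d0 : ℝ, 0 < d0 ∧ d0 ≤ 0.03 ∧
    ∀ u : EE n → ℝ, Sol d0 u → ∀ r0 : ℝ, 0 < r0 → ∃ R, r0 ≤ R ∧ ∃ A b,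
      ∀ x : EE n, ‖x‖ ≤ 1 → ∀ k, |fF (scU R u) A b k x| ≤ η := by
  obtain ⟨C, hC, hinit⟩ := init_flat n
  obtain ⟨d0, hd0, hd1, hE⟩ := small_energy hn (κ := (η / 72) ^ 2 / (8 * C)) (by positivity)
  refine ⟨d0, hd0, hd1, fun u hs r0 hr0 => ?_⟩
  obtain ⟨r, hr, hI⟩ := hE u hs (72 * r0) (by positivity)
  have hrp : 0 < r := by linarith
  have hu := hs.sm
  refine ⟨r / 72, by linarith, ?_⟩
  have hv := Sol_scU hs hrp
  have h1 : ∫ z in Metric.closedBall (0 : EE n) (1 / 4), DD (scU r u) z ≤ 8 * ((η / 72) ^ 2 / (8 * C)) := by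
    have hsc := Measure.integral_comp_smul_of_nonneg volume
      (fun x => mF u 0 r x ^ 3 * DD u x) r (hR := hrp.le)
    rw [finrank_euclideanSpace_fin, smul_eq_mul] at hsc
    have h2 : r ^ 2 * ∫ x, mF u 0 r (r • x) ^ 3 * DD u (r • x) ≤ (η / 72) ^ 2 / (8 * C) := by
      rw [hsc, ← mul_assoc, mul_comm (r ^ 2), mul_assoc, inv_mul_le_iff₀ (by positivity)]
      linarith
    have cD := (Sm_D hu).cont
    have cm := mF_cont (y := 0) (r := r) hu
    have iD : Integrable (fun x => mF u 0 r (r • x) ^ 3 * DD u (r • x)) := by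
      have : Integrable (fun x => mF u 0 r x ^ 3 * DD u x) :=
        int_of (u := u) (y := 0) hrp (by fun_prop) (fun x h => by simp [h])
      exact this.comp_smul hrp.ne'
    calc ∫ z in Metric.closedBall (0 : EE n) (1 / 4), DD (scU r u) z
        = ∫ z, (Metric.closedBall (0 : EE n) (1 / 4)).indicator (DD (scU r u)) z := by
          rw [integral_indicator measurableSet_closedBall]
      _ ≤ ∫ z, 8 * (r ^ 2 * (mF u 0 r (r • z) ^ 3 * DD u (r • z))) := by
          refine integral_mono ?_ ((iD.const_mul _).const_mul _) fun z => ?_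
          · exact ((Sm_D hv.sm).cont.continuousOn.integrableOn_compact
              (isCompact_closedBall _ _)).integrable_indicator measurableSet_closedBall
          · have hD0 : 0 ≤ DD u (r • z) := by unfold DD; positivity
            have m0 : 0 ≤ mF u 0 r (r • z) := mF_nonneg
            by_cases hz : z ∈ Metric.closedBall (0 : EE n) (1 / 4)
            · rw [indicator_of_mem hz, DD_scU hu hrp]
              rw [mem_closedBall_zero_iff] at hz
              have hm : 1 / 2 ≤ mF u 0 r (r • z) := by
                refine mF_half hs hrp ?_
                rw [sub_zero, norm_smul, Real.norm_eq_abs, abs_of_pos hrp]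
                nlinarith
              have hm3 : (1 / 2 : ℝ) ^ 3 ≤ mF u 0 r (r • z) ^ 3 := by gcongr
              have : 1 * DD u (r • z) ≤ (8 * mF u 0 r (r • z) ^ 3) * DD u (r • z) := by
                gcongr; linarith
              nlinarith [sq_nonneg r]
            · rw [indicator_of_notMem hz]; positivity
      _ ≤ _ := by
          rw [integral_const_mul, integral_const_mul]
          gcongr
  obtain ⟨A, b, hAb⟩ := hinit d0 _ (scU r u) hv h1
  refine ⟨A, fun k => (1 / 72 : ℝ)⁻¹ * b k, fun x hx k => ?_⟩
  have e : scU (r / 72) u = scU (1 / 72) (scU r u) := by rw [scU_scU]; congr 1; ring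
  rw [e, fF_scU hv.sm (by norm_num)]
  have h3 := hAb ((1 / 72 : ℝ) • x) (by rw [norm_smul]; norm_num; linarith) k
  have h4 : C * (8 * ((η / 72) ^ 2 / (8 * C))) = (η / 72) ^ 2 := by field_simp
  rw [h4] at h3
  have h5 := abs_le_of_sq_le_sq h3 (by positivity)
  rw [abs_mul, abs_of_pos (by norm_num : (0:ℝ) < (1 / 72)⁻¹)]
  calc (1 / 72 : ℝ)⁻¹ * _ ≤ (1 / 72 : ℝ)⁻¹ * (η / 72) := by gcongr
    _ = η := by ring
end start

open MeasureTheory Set Filter Topology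
open scoped ContDiff Matrix

section lip
variable {n : ℕ}

theorem det_lip (n : ℕ) : ∃ K : ℝ, 0 < K ∧ ∀ X Y : Matrix (Fin n) (Fin n) ℝ,
    (∀ i j, |X i j| ≤ 4) → (∀ i j, |Y i j| ≤ 4) →
    |(1 + Xᵀ * X).det - (1 + Yᵀ * Y).det| ≤ K * Real.sqrt (∑ i, ∑ j, (X i j - Y i j) ^ 2) := by
  set P : (Fin n → Fin n → ℝ) → ℝ := fun X => (1 + (Matrix.of X)ᵀ * Matrix.of X).det with hP
  have cP : ContDiff ℝ 1 P := by
    rw [hP]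
    simp only [Matrix.det_apply', Matrix.add_apply, Matrix.mul_apply, Matrix.transpose_apply, Matrix.of_apply]
    refine ContDiff.sum fun σ _ => contDiff_const.mul (contDiff_prod fun i _ => contDiff_const.add
      (ContDiff.sum fun j _ => ?_))
    fun_prop
  have hc : IsCompact (Metric.closedBall (0 : Fin n → Fin n → ℝ) 4) := isCompact_closedBall _ _
  have cd : Continuous (fun X => ‖fderiv ℝ P X‖) := (cP.continuous_fderiv one_ne_zero).norm
  obtain ⟨K, hK⟩ := hc.exists_bound_of_continuousOn cd.continuousOn
  refine ⟨|K| + 1, by positivity, fun X Y hX hY => ?_⟩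
  have mem : ∀ X : Matrix (Fin n) (Fin n) ℝ, (∀ i j, |X i j| ≤ 4) →
      (fun i j => X i j) ∈ Metric.closedBall (0 : Fin n → Fin n → ℝ) 4 := by
    intro X hX
    rw [mem_closedBall_zero_iff, pi_norm_le_iff_of_nonneg (by norm_num)]
    intro i
    rw [pi_norm_le_iff_of_nonneg (by norm_num)]
    exact fun j => hX i j
  have h1 := (convex_closedBall (0 : Fin n → Fin n → ℝ) 4).norm_image_sub_le_of_norm_fderiv_le (𝕜 := ℝ) (f := P)
    (C := |K|) (fun Z _ => cP.differentiable one_ne_zero Z)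
    (fun Z hZ => by have := hK Z hZ; rw [norm_norm] at this; exact this.trans (le_abs_self K))
    (mem Y hY) (mem X hX)
  have h2 : ‖(fun i j => X i j) - (fun i j => Y i j)‖ ≤ Real.sqrt (∑ i, ∑ j, (X i j - Y i j) ^ 2) := by
    rw [pi_norm_le_iff_of_nonneg (Real.sqrt_nonneg _)]
    intro i
    rw [pi_norm_le_iff_of_nonneg (Real.sqrt_nonneg _)]
    intro j
    refine Real.abs_le_sqrt ?_
    refine le_trans ?_ (Finset.single_le_sum (f := fun i => ∑ j, (X i j - Y i j) ^ 2)
        (fun _ _ => by positivity) (Finset.mem_univ i))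
    exact Finset.single_le_sum (f := fun j => (X i j - Y i j) ^ 2)
        (fun _ _ => by positivity) (Finset.mem_univ j)
  have h3 : |(1 + Xᵀ * X).det - (1 + Yᵀ * Y).det| = ‖P (fun i j => X i j) - P (fun i j => Y i j)‖ := rfl
  rw [h3]
  refine h1.trans ?_
  have := norm_nonneg ((fun i j => X i j) - (fun i j => Y i j))
  calc _ ≤ (|K| + 1) * ‖(fun i j => X i j) - (fun i j => Y i j)‖ := by gcongr; linarith
    _ ≤ _ := by gcongr
end lip

section cacc
variable {n : ℕ} {u : EE n → ℝ} {x y : EE n} {d r : ℝ}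

theorem H_entry (hs : Sol d u) (i j : Fin n) : |Hm u x i j| ≤ 2 := by
  have := bd4 (x := x) hs (fun a => if a = j then 1 else 0)
  simp only [mul_ite, mul_one, mul_zero, Finset.sum_ite_eq', Finset.mem_univ, if_true, ite_pow, one_pow,
    ne_eq, OfNat.ofNat_ne_zero, not_false_eq_true, zero_pow] at this
  have h2 := (Finset.single_le_sum (f := fun i => Hm u x i j ^ 2)
        (fun _ _ => by positivity) (Finset.mem_univ i)).trans this
  exact abs_le_of_sq_le_sq (by linarith) (by norm_num)

noncomputable def NN {n : ℕ} (u : EE n → ℝ) (A : Matrix (Fin n) (Fin n) ℝ) (x : EE n) : ℝ :=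
  ∑ i, ∑ j, (Hm u x i j - A i j) ^ 2

theorem Sm_NN (hu : Sm u) (A : Matrix (Fin n) (Fin n) ℝ) : Sm (NN u A) := by
  unfold NN
  exact Sm.sum fun i => Sm.sum fun j => ((SmM_H hu i j).sub (Sm.const _)).pow 2
theorem NN_nonneg {A : Matrix (Fin n) (Fin n) ℝ} : 0 ≤ NN u A x := by unfold NN; positivity

theorem cacc (hs : Sol d u) {A : Matrix (Fin n) (Fin n) ℝ} {b : Fin n → ℝ} {ϑ : ℝ} (hϑ : 0 ≤ ϑ)
    (hf : ∀ x : EE n, ‖x‖ ≤ 1 → ∀ k, |fF u A b k x| ≤ ϑ) :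
    ∫ z in Metric.closedBall (0 : EE n) (1 / 4), NN u A z ≤ 480 * n * 5 ^ n * v1 n * ϑ ^ 2 := by
  have hu := hs.sm
  set w : EE n → ℝ := fun x => ∑ k, fF u A b k x ^ 2 with hw
  have hf2 : ∀ k, Sm (fun x => fF u A b k x ^ 2) := fun k => (Sm_f hu A b k).pow 2
  have sw : Sm w := Sm.sum hf2
  have hL : ∀ x, 2 / 5 * NN u A x ≤ Lap u w x := by
    intro x
    rw [hw, Lap_sum hf2]
    unfold NN
    rw [Finset.mul_sum]
    refine Finset.sum_le_sum fun k _ => ?_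
    rw [Lap_sq (Sm_f hu A b k), Lap_f hs]
    have := G_lower (Hm_symm (x := x) hu) (B := 4) (fun v => bd4 hs v) (fun i => pd i (fF u A b k) x)
    simp only [pd_f hu] at this ⊢
    unfold Gm gm
    linarith
  have hg := green (y := 0) hs one_pos sw
  have cm := mF_cont (y := 0) (r := 1) hu
  have co := (Sm_om hu).cont
  have cN := (Sm_NN hu A).cont
  have cL := (Sm_Lap hu sw).cont
  have h1 : ∫ z in Metric.closedBall (0 : EE n) (1 / 4), NN u A z
      ≤ ∫ x, 20 * (mF u 0 1 x ^ 3 * (om u x * Lap u w x)) := by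
    rw [← integral_indicator measurableSet_closedBall]
    refine integral_mono ((cN.continuousOn.integrableOn_compact
      (isCompact_closedBall _ _)).integrable_indicator measurableSet_closedBall)
      (int_of (u := u) (y := 0) one_pos (by fun_prop) (fun x h => by simp [h])) fun x => ?_
    have m0 : 0 ≤ mF u 0 1 x := mF_nonneg
    have o1 := om_ge (x := x) hu
    have N0 := NN_nonneg (u := u) (A := A) (x := x)
    have L0 : 0 ≤ Lap u w x := le_trans (by positivity) (hL x)
    by_cases hz : x ∈ Metric.closedBall (0 : EE n) (1 / 4)
    · rw [indicator_of_mem hz]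
      rw [mem_closedBall_zero_iff] at hz
      have hm : 1 / 2 ≤ mF u 0 1 x := mF_half hs one_pos (by simpa using hz)
      have hm3 : (1 / 2 : ℝ) ^ 3 ≤ mF u 0 1 x ^ 3 := by gcongr
      calc NN u A x ≤ 20 * ((1 / 2 : ℝ) ^ 3 * (1 * Lap u w x)) := by have := hL x; linarith
        _ ≤ _ := by gcongr
    · rw [indicator_of_notMem hz]; positivity
  refine h1.trans ?_
  rw [integral_const_mul, hg]
  have h2 := int_le_ball (n := n) (r := 1) (f := fun x => w x * om u x * (6 / 1 ^ 4 * (mF u 0 1 x * gss u 0 x)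
          - 6 * n / 1 ^ 2 * mF u 0 1 x ^ 2)) (M := n * ϑ ^ 2 * 5 ^ n * 24) 0 zero_le_one (by positivity) (fun x => ?_)
      (fun x h => by simp [mF_zero one_pos h])
  · simp only [one_pow, mul_one] at h2 ⊢
    linarith
  · by_cases hz : mF u 0 1 x = 0
    · simp only [hz]; norm_num; positivity
    have hsr := mF_ne one_pos hz
    have hx := norm_lt_of_sF one_pos hsr
    rw [sub_zero] at hx
    have hw1 : w x ≤ n * ϑ ^ 2 := by
      rw [hw]
      calc _ ≤ ∑ k : Fin n, ϑ ^ 2 := Finset.sum_le_sum fun k _ => by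
            have := hf x hx.le k
            rw [← sq_abs]; gcongr
        _ = _ := by simp
    have hw0 : 0 ≤ w x := by rw [hw]; positivity
    have o1 := om_le (x := x) hs
    have o0 := om_pos (x := x) hu
    have g1 : gss u 0 x ≤ 4 := by have := Gss (x := x) hu 0; unfold gss; nlinarith
    have m0 : 0 ≤ mF u 0 1 x := mF_nonneg
    have m1 : mF u 0 1 x ≤ 1 := mF_le_one
    have g0 : 0 ≤ gss u 0 x := Gnn hu _
    have : (6 / 1 ^ 4 * (mF u 0 1 x * gss u 0 x) - 6 * n / 1 ^ 2 * mF u 0 1 x ^ 2) ≤ 24 := by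
      have : mF u 0 1 x * gss u 0 x ≤ 1 * 4 := by gcongr
      have : 0 ≤ 6 * (n:ℝ) / 1 ^ 2 * mF u 0 1 x ^ 2 := by positivity
      norm_num at *; linarith
    calc _ ≤ w x * om u x * 24 := by gcongr
      _ ≤ _ := by gcongr
end cacc

open MeasureTheory Set Filter Topology
open scoped ContDiff Matrix

noncomputable def MM {n : ℕ} (A : Matrix (Fin n) (Fin n) ℝ) (y x : EE n) : ℝ :=
  max (1 - qF A (x - y) / (1 / 8) ^ 2) 0

section approx
variable {n : ℕ} {u : EE n → ℝ} {x y : EE n} {d : ℝ} {A : Matrix (Fin n) (Fin n) ℝ} {b : Fin n → ℝ} {ϑ : ℝ}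

theorem grad_lip1 (hs : Sol d u) (x y : EE n) (k : Fin n) : |pd k u x - pd k u y| ≤ 2 * ‖x - y‖ := by
  have h := (Finset.single_le_sum (f := fun k => (pd k u x - pd k u y) ^ 2)
        (fun _ _ => by positivity) (Finset.mem_univ k)).trans (grad_lip hs x y)
  refine abs_le_of_sq_le_sq (h.trans (le_of_eq (by ring))) (by positivity)

theorem A_lin (hs : Sol d u) (hf : ∀ x : EE n, ‖x‖ ≤ 1 → ∀ k, |fF u A b k x| ≤ ϑ)
    (hx : ‖x‖ ≤ 1) (hy : ‖y‖ ≤ 1) (k : Fin n) :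
    |(pd k u x - pd k u y) - ∑ j, A k j * (x - y) j| ≤ 2 * ϑ := by
  have h1 := hf x hx k
  have h2 := hf y hy k
  have e : ∑ j, A k j * (x - y) j = ∑ j, A k j * x j - ∑ j, A k j * y j := by
    rw [← Finset.sum_sub_distrib]
    exact Finset.sum_congr rfl fun j _ => by simp; ring
  unfold fF at h1 h2
  rw [e]
  rw [abs_le] at *
  constructor <;> linarith [h1.1, h1.2, h2.1, h2.2]

theorem A_entry (hs : Sol d u) (hϑ : ϑ ≤ 1) (hf : ∀ x : EE n, ‖x‖ ≤ 1 → ∀ k, |fF u A b k x| ≤ ϑ)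
    (i j : Fin n) : |A i j| ≤ 4 := by
  have h1 := A_lin (x := EuclideanSpace.single j 1) (y := 0) hs hf (by simp) (by simp) i
  have h2 := grad_lip1 hs (EuclideanSpace.single j 1) 0 i
  simp [Pi.single_apply] at h1 h2
  rw [abs_le] at *
  constructor <;> linarith [h1.1, h1.2, h2.1, h2.2]

theorem sq_diff (hs : Sol d u) (hϑ0 : 0 ≤ ϑ) (hϑ : ϑ ≤ 1) (hf : ∀ x : EE n, ‖x‖ ≤ 1 → ∀ k, |fF u A b k x| ≤ ϑ)
    (hx : ‖x‖ ≤ 1 / 4) (hy : ‖y‖ ≤ 1 / 4) : |sF u y x - qF A (x - y)| ≤ 8 * n * ϑ := by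
  have e : sF u y x - qF A (x - y)
      = ∑ k, ((pd k u x - pd k u y) ^ 2 - (∑ j, A k j * (x - y) j) ^ 2) := by
    unfold sF qF
    rw [Finset.sum_sub_distrib]; simp
  rw [e]
  refine (Finset.abs_sum_le_sum_abs _ _).trans ?_
  have hxy : ‖x - y‖ ≤ 1 / 2 := (norm_sub_le _ _).trans (by linarith)
  calc _ ≤ ∑ k : Fin n, 8 * ϑ := Finset.sum_le_sum fun k _ => by
        have h1 := A_lin hs hf (hx.trans (by norm_num)) (hy.trans (by norm_num)) k
        have h2 := grad_lip1 hs x y k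
        rw [sq_sub_sq, abs_mul]
        have h3 : |(pd k u x - pd k u y) + ∑ j, A k j * (x - y) j| ≤ 4 := by
          rw [abs_le] at *
          constructor <;> linarith [h1.1, h1.2, h2.1, h2.2]
        calc _ ≤ 4 * (2 * ϑ) := by gcongr
          _ = _ := by ring
    _ = _ := by simp; ring

theorem MM_cont (A : Matrix (Fin n) (Fin n) ℝ) (y : EE n) : Continuous (MM A y) := by
  unfold MM
  have := qF_cont A
  fun_prop
theorem MM_nonneg : 0 ≤ MM A y x := le_max_right _ _
theorem MM_le_one : MM A y x ≤ 1 := by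
  unfold MM
  have h := qF_ge A (x - y)
  have : 0 ≤ qF A (x - y) := le_trans (by positivity) h
  exact max_le (by have : 0 ≤ qF A (x - y) / (1 / 8) ^ 2 := by positivity
                   linarith) zero_le_one
theorem MM_zero (h : 1 / 8 < ‖x - y‖) : MM A y x = 0 := by
  unfold MM
  have h1 := qF_ge A (x - y)
  refine max_eq_right ?_
  have : 1 ≤ qF A (x - y) / (1 / 8) ^ 2 := by
    rw [one_le_div (by positivity)]
    nlinarith
  linarith
theorem MM_int {g : EE n → ℝ} (hg : Continuous g) (h0 : ∀ x, MM A y x = 0 → g x = 0) : Integrable g := by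
  refine hg.integrable_of_hasCompactSupport ?_
  refine HasCompactSupport.of_support_subset_isCompact (isCompact_closedBall y (1 / 8)) ?_
  intro x hx
  rw [Metric.mem_closedBall, dist_eq_norm]
  by_contra hc
  exact hx (h0 x (MM_zero (not_le.1 hc)))

theorem om_lip {K : ℝ} (hK : ∀ X Y : Matrix (Fin n) (Fin n) ℝ,
    (∀ i j, |X i j| ≤ 4) → (∀ i j, |Y i j| ≤ 4) →
    |(1 + Xᵀ * X).det - (1 + Yᵀ * Y).det| ≤ K * Real.sqrt (∑ i, ∑ j, (X i j - Y i j) ^ 2))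
    (hs : Sol d u) (hA : ∀ i j, |A i j| ≤ 4) : |om u x - o0 A| ≤ K * Real.sqrt (NN u A x) := by
  have h1 := hK (Hm u x) A (fun i j => (H_entry hs i j).trans (by norm_num)) hA
  refine le_trans ?_ h1
  have o1 := om_ge (x := x) hs.sm
  have p0 := o0_pos A
  rw [← o0_H hs.sm] at o1 ⊢
  have e1 : o0 (Hm u x) ^ 2 = (1 + (Hm u x)ᵀ * Hm u x).det := by
    unfold o0
    refine Real.sq_sqrt ?_
    by_contra hc
    have := Real.sqrt_eq_zero_of_nonpos (not_le.1 hc).le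
    unfold o0 at o1; linarith
  have e2 : o0 A ^ 2 = (1 + Aᵀ * A).det := by
    unfold o0
    refine Real.sq_sqrt ?_
    by_contra hc
    have := Real.sqrt_eq_zero_of_nonpos (not_le.1 hc).le
    unfold o0 at p0; linarith
  rw [← e1, ← e2, sq_sub_sq, abs_mul]
  refine le_mul_of_one_le_left (abs_nonneg _) ?_
  rw [abs_of_pos (by linarith)]; linarith

theorem cmpL (n : ℕ) : ∃ C : ℝ, 0 < C ∧ ∀ (d : ℝ) (u : EE n → ℝ) (A : Matrix (Fin n) (Fin n) ℝ) (b : Fin n → ℝ)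
    (ϑ : ℝ), Sol d u → 0 < ϑ → ϑ ≤ 1 → (∀ x : EE n, ‖x‖ ≤ 1 → ∀ k, |fF u A b k x| ≤ ϑ) →
    ∀ y : EE n, ‖y‖ ≤ 1 / 8 → ∀ (g : EE n → ℝ) (L : ℝ), Continuous g → 0 ≤ L → (∀ x, ‖x‖ ≤ 1 / 4 → |g x| ≤ L) →
    |(∫ x, mF u y (1 / 8) x ^ 2 * (g x * om u x)) - o0 A * ∫ x, MM A y x ^ 2 * g x| ≤ C * ϑ * L := by
  obtain ⟨K, hK0, hK⟩ := det_lip n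
  have hv := v1_pos n
  refine ⟨(1024 * n * 5 ^ n + K) * (v1 n * (1 / 4) ^ n) + K * (480 * n * 5 ^ n * v1 n), by positivity, ?_⟩
  intro d u A b ϑ hs hϑ hϑ1 hf y hy g L hg hL hgL
  have hu := hs.sm
  have hA := A_entry hs hϑ1 hf
  have cm := mF_cont (y := y) (r := 1 / 8) hu
  have cM := MM_cont A y
  have co := (Sm_om hu).cont
  have cN := (Sm_NN hu A).cont
  have h8 : (0:ℝ) < 1 / 8 := by norm_num
  have i1 : Integrable (fun x => mF u y (1 / 8) x ^ 2 * (g x * om u x)) :=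
    int_of (u := u) (y := y) h8 (by fun_prop) (fun x h => by rw [h]; simp)
  have i2 : Integrable (fun x => o0 A * (MM A y x ^ 2 * g x)) :=
    MM_int (A := A) (y := y) (by fun_prop) (fun x h => by rw [h]; simp)
  rw [← integral_const_mul, ← integral_sub i1 i2]
  have pw : ∀ x, |mF u y (1 / 8) x ^ 2 * (g x * om u x) - o0 A * (MM A y x ^ 2 * g x)|
      ≤ (Metric.closedBall (0 : EE n) (1 / 4)).indicator
        (fun x => L * ((1024 * n * 5 ^ n + K) * ϑ + K / ϑ * NN u A x)) x := by
    intro x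
    have N0 := NN_nonneg (u := u) (A := A) (x := x)
    by_cases hxy : 1 / 8 < ‖x - y‖
    · rw [mF_zero h8 hxy, MM_zero hxy]
      simp only [ne_eq, OfNat.ofNat_ne_zero, not_false_eq_true, zero_pow, zero_mul, mul_zero, sub_zero, abs_zero]
      exact indicator_nonneg (fun z _ => by
        have := NN_nonneg (u := u) (A := A) (x := z); positivity) x
    · have hx : ‖x‖ ≤ 1 / 4 := by
        calc ‖x‖ = ‖(x - y) + y‖ := by congr 1; abel
          _ ≤ ‖x - y‖ + ‖y‖ := norm_add_le _ _
          _ ≤ _ := by linarith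
      rw [indicator_of_mem (mem_closedBall_zero_iff.2 hx)]
      set m := mF u y (1 / 8) x with hm
      set M := MM A y x with hM
      have m0 : 0 ≤ m := mF_nonneg
      have m1 : m ≤ 1 := mF_le_one
      have M0 : 0 ≤ M := MM_nonneg
      have M1 : M ≤ 1 := MM_le_one
      have hd1 : |m - M| ≤ 512 * n * ϑ := by
        rw [hm, hM]; unfold mF MM
        refine (abs_max_sub_max_le_abs _ _ _).trans ?_
        have e : (1 - sF u y x / (1 / 8) ^ 2) - (1 - qF A (x - y) / (1 / 8) ^ 2)
            = -64 * (sF u y x - qF A (x - y)) := by ring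
        rw [e, abs_mul]
        have := sq_diff hs hϑ.le hϑ1 hf hx (hy.trans (by norm_num))
        norm_num
        linarith
      have hd2 : |m ^ 2 - M ^ 2| ≤ 1024 * n * ϑ := by
        rw [sq_sub_sq, abs_mul, abs_of_nonneg (by linarith : 0 ≤ m + M)]
        have := abs_nonneg (m - M)
        nlinarith
      have ho := om_lip (x := x) hK hs hA
      have hsq : Real.sqrt (NN u A x) ≤ ϑ + NN u A x / ϑ := by
        have h5 := Real.sq_sqrt N0
        have h6 := Real.sqrt_nonneg (NN u A x)
        rw [← sub_nonneg]
        have : ϑ + NN u A x / ϑ - Real.sqrt (NN u A x)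
          = ((ϑ - Real.sqrt (NN u A x)) ^ 2 + ϑ * Real.sqrt (NN u A x)) / ϑ := by
          rw [eq_div_iff hϑ.ne']
          have : NN u A x / ϑ * ϑ = NN u A x := by field_simp
          nlinarith
        rw [this]; positivity
      have o1 := om_le (x := x) hs
      have op := om_pos (x := x) hu
      have e : m ^ 2 * (g x * om u x) - o0 A * (M ^ 2 * g x)
          = g x * ((m ^ 2 - M ^ 2) * om u x + M ^ 2 * (om u x - o0 A)) := by ring
      rw [e, abs_mul]
      have h7 : |(m ^ 2 - M ^ 2) * om u x + M ^ 2 * (om u x - o0 A)|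
          ≤ (1024 * n * 5 ^ n + K) * ϑ + K / ϑ * NN u A x := by
        refine (abs_add_le _ _).trans ?_
        rw [abs_mul, abs_mul, abs_of_pos op, abs_of_nonneg (sq_nonneg M)]
        have a1 : |m ^ 2 - M ^ 2| * om u x ≤ (1024 * n * ϑ) * 5 ^ n := by gcongr
        have a2 : M ^ 2 * |om u x - o0 A| ≤ 1 * (K * (ϑ + NN u A x / ϑ)) := by
          have : M ^ 2 ≤ 1 := pow_le_one₀ M0 M1
          have := ho.trans (mul_le_mul_of_nonneg_left hsq hK0.le)
          gcongr
        calc _ ≤ (1024 * n * ϑ) * 5 ^ n + 1 * (K * (ϑ + NN u A x / ϑ)) := add_le_add a1 a2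
          _ = _ := by ring
      exact mul_le_mul (hgL x hx) h7 (abs_nonneg _) hL
  have iN : IntegrableOn (NN u A) (Metric.closedBall (0 : EE n) (1 / 4)) :=
    cN.continuousOn.integrableOn_compact (isCompact_closedBall _ _)
  have ic : ∀ c : ℝ, IntegrableOn (fun _ : EE n => c) (Metric.closedBall (0 : EE n) (1 / 4)) :=
    fun c => (continuous_const.continuousOn).integrableOn_compact (isCompact_closedBall _ _)
  calc _ ≤ ∫ x, |mF u y (1 / 8) x ^ 2 * (g x * om u x) - o0 A * (MM A y x ^ 2 * g x)| :=
        abs_integral_le_integral_abs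
    _ ≤ ∫ x, (Metric.closedBall (0 : EE n) (1 / 4)).indicator
        (fun x => L * ((1024 * n * 5 ^ n + K) * ϑ + K / ϑ * NN u A x)) x := by
        refine integral_mono (i1.sub i2).abs ?_ pw
        exact ((by fun_prop : Continuous _).continuousOn.integrableOn_compact
          (isCompact_closedBall _ _)).integrable_indicator measurableSet_closedBall
    _ = L * ((1024 * n * 5 ^ n + K) * ϑ * (v1 n * (1 / 4) ^ n)
          + K / ϑ * ∫ x in Metric.closedBall (0 : EE n) (1 / 4), NN u A x) := by
        rw [integral_indicator measurableSet_closedBall, integral_const_mul,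
          integral_add (ic _) (iN.const_mul _), integral_const_mul (K / ϑ), setIntegral_const,
          vol_cb _ (by norm_num)]
        simp only [smul_eq_mul]
        ring
    _ ≤ L * ((1024 * n * 5 ^ n + K) * ϑ * (v1 n * (1 / 4) ^ n)
          + K / ϑ * (480 * n * 5 ^ n * v1 n * ϑ ^ 2)) := by
        have := cacc hs hϑ.le hf
        gcongr
    _ = _ := by field_simp

theorem approx (n : ℕ) : ∃ C : ℝ, 0 < C ∧ ∀ (d : ℝ) (u : EE n → ℝ) (A : Matrix (Fin n) (Fin n) ℝ) (b : Fin n → ℝ)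
    (ϑ : ℝ), Sol d u → 0 < ϑ → ϑ ≤ 1 → (∀ x : EE n, ‖x‖ ≤ 1 → ∀ k, |fF u A b k x| ≤ ϑ) →
    ∀ y : EE n, ‖y‖ ≤ 1 / 8 → ∀ k,
    |cN n * fF u A b k y - 8 ^ n * (o0 A * ∫ x, MM A y x ^ 2 * fF u A b k x)| ≤ C * ϑ ^ 2 := by
  obtain ⟨C, hC, hcmp⟩ := cmpL n
  refine ⟨8 ^ n * (2 * C), by positivity, ?_⟩
  intro d u A b ϑ hs hϑ hϑ1 hf y hy k
  have hu := hs.sm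
  have sf := Sm_f hu A b k
  have h8 : (0:ℝ) < 1 / 8 := by norm_num
  have h1 := hcmp d u A b ϑ hs hϑ hϑ1 hf y hy (fun _ => 1) 1 continuous_const zero_le_one (by simp)
  have h2 := hcmp d u A b ϑ hs hϑ hϑ1 hf y hy (fF u A b k) ϑ sf.cont hϑ.le
    (fun x hx => hf x (hx.trans (by norm_num)) k)
  have hq := qint A h8 y
  have e1 : ∫ x, MM A y x ^ 2 * 1 = ∫ x, (max (1 - qF A (x - y) / (1 / 8) ^ 2) 0) ^ 2 := by
    simp only [mul_one]; rfl
  rw [e1, hq] at h1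
  have cm := mF_cont (y := y) (r := 1 / 8) hu
  have co := (Sm_om hu).cont
  have cf := sf.cont
  have hpos : ∀ x, sF u y x < (1 / 8) ^ 2 → |fF u A b k x| ≤ ϑ := by
    intro x hx
    have h3 := norm_lt_of_sF h8 hx
    refine hf x ?_ k
    calc ‖x‖ = ‖(x - y) + y‖ := by congr 1; abel
      _ ≤ ‖x - y‖ + ‖y‖ := norm_add_le _ _
      _ ≤ _ := by linarith
  have i1 : Integrable (fun x => mF u y (1 / 8) x ^ 2 * (1 * om u x)) :=
    int_of (u := u) (y := y) h8 (by fun_prop) (fun x h => by rw [h]; simp)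
  have i2 : Integrable (fun x => mF u y (1 / 8) x ^ 2 * (fF u A b k x * om u x)) :=
    int_of (u := u) (y := y) h8 (by fun_prop) (fun x h => by rw [h]; simp)
  have p1 := M0 (y := y) hs ((Sm.const ϑ).add sf) h8
    (fun x hx => by have := abs_le.1 (hpos x hx); linarith [this.1])
    (fun x _ => by rw [Lap_add (Sm.const ϑ) sf, Lap_const, Lap_f hs]; simp)
  have p2 := M0 (y := y) hs ((Sm.const ϑ).sub sf) h8
    (fun x hx => by have := abs_le.1 (hpos x hx); linarith [this.2])
    (fun x _ => by rw [Lap_sub (Sm.const ϑ) sf, Lap_const, Lap_f hs]; simp)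
  have b1 : be u y (fun x => ϑ + fF u A b k x) (1 / 8)
      = 8 ^ n * (ϑ * (∫ x, mF u y (1 / 8) x ^ 2 * (1 * om u x))
        + ∫ x, mF u y (1 / 8) x ^ 2 * (fF u A b k x * om u x)) := by
    unfold be
    rw [← integral_const_mul ϑ, ← integral_add (i1.const_mul _) i2, one_div, inv_pow, inv_inv]
    congr 1
    exact integral_congr_ae (Eventually.of_forall fun x => by simp only []; ring)
  have b2 : be u y (fun x => ϑ - fF u A b k x) (1 / 8)
      = 8 ^ n * (ϑ * (∫ x, mF u y (1 / 8) x ^ 2 * (1 * om u x))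
        - ∫ x, mF u y (1 / 8) x ^ 2 * (fF u A b k x * om u x)) := by
    unfold be
    rw [← integral_const_mul ϑ, ← integral_sub (i1.const_mul _) i2, one_div, inv_pow, inv_inv]
    congr 1
    exact integral_congr_ae (Eventually.of_forall fun x => by simp only []; ring)
  rw [b1] at p1
  rw [b2] at p2
  generalize (∫ x, mF u y (1 / 8) x ^ 2 * (1 * om u x)) = I1 at *
  generalize (∫ x, mF u y (1 / 8) x ^ 2 * (fF u A b k x * om u x)) = I2 at *
  generalize (o0 A * ∫ x, MM A y x ^ 2 * fF u A b k x) = I3 at *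
  have h18 : ((1:ℝ) / 8) ^ n = (8 ^ n)⁻¹ := by rw [one_div, inv_pow]
  rw [h18] at h1
  have hT : (0:ℝ) < 8 ^ n := by positivity
  generalize (8:ℝ) ^ n = T at *
  have h1b := (abs_le.1 h1).2
  have h2b := abs_le.1 h2
  have h3 : T * (cN n * T⁻¹) = cN n := by field_simp
  have h4 : T * I1 ≤ cN n + T * (C * ϑ) := by
    have := mul_le_mul_of_nonneg_left h1b hT.le
    nlinarith
  have h5 := mul_le_mul_of_nonneg_left h4 hϑ.le
  have h6 := mul_le_mul_of_nonneg_left h2b.1 hT.le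
  have h7 := mul_le_mul_of_nonneg_left h2b.2 hT.le
  rw [abs_le]
  constructor <;> nlinarith
end approx

open MeasureTheory Set Filter Topology
open scoped ContDiff Matrix

noncomputable def bB {n : ℕ} (A : Matrix (Fin n) (Fin n) ℝ) (j : Fin n) (x : EE n) : ℝ :=
  x j + ∑ k, (∑ i, A k i * x i) * A k j

section taylor
variable {n : ℕ} {A : Matrix (Fin n) (Fin n) ℝ} {x y : EE n}

theorem bB_cont (A : Matrix (Fin n) (Fin n) ℝ) (j : Fin n) : Continuous (bB A j) := by
  unfold bB
  fun_prop

theorem coord_le (x : EE n) (j : Fin n) : |x j| ≤ ‖x‖ := by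
  have := EuclideanSpace.norm_eq x
  have h := PiLp.norm_apply_le x j
  simpa using h

theorem A_row (hA : ∀ i j, |A i j| ≤ 4) (k : Fin n) (x : EE n) : |∑ i, A k i * x i| ≤ 4 * n * ‖x‖ := by
  calc _ ≤ ∑ i, |A k i * x i| := Finset.abs_sum_le_sum_abs _ _
    _ ≤ ∑ i : Fin n, 4 * ‖x‖ := Finset.sum_le_sum fun i _ => by
        rw [abs_mul]
        exact mul_le_mul (hA k i) (coord_le x i) (abs_nonneg _) (by norm_num)
    _ = _ := by simp; ring

theorem bB_le (hA : ∀ i j, |A i j| ≤ 4) (hx : ‖x‖ ≤ 1 / 4) (j : Fin n) : |bB A j x| ≤ 1 + 4 * n ^ 2 := by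
  unfold bB
  refine (abs_add_le _ _).trans ?_
  have h1 := (coord_le x j).trans hx
  have h2 : |∑ k, (∑ i, A k i * x i) * A k j| ≤ 4 * (n:ℝ) ^ 2 := by
    calc _ ≤ ∑ k, |(∑ i, A k i * x i) * A k j| := Finset.abs_sum_le_sum_abs _ _
      _ ≤ ∑ k : Fin n, (4 * (n:ℝ) * (1 / 4)) * 4 := Finset.sum_le_sum fun k _ => by
          rw [abs_mul]
          refine mul_le_mul ((A_row hA k x).trans ?_) (hA k j) (abs_nonneg _) (by positivity)
          gcongr
      _ = _ := by simp; ring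
  linarith

theorem qF_up (hA : ∀ i j, |A i j| ≤ 4) (y : EE n) : qF A y ≤ (1 + 16 * n ^ 3) * ‖y‖ ^ 2 := by
  unfold qF
  rw [← nsq]
  have : ∑ k, (∑ j, A k j * y j) ^ 2 ≤ ∑ k : Fin n, (4 * n * ‖y‖) ^ 2 := Finset.sum_le_sum fun k _ => by
    rw [← sq_abs]
    have := A_row hA k y
    gcongr
  have e : ∑ k : Fin n, (4 * (n:ℝ) * ‖y‖) ^ 2 = 16 * n ^ 3 * ‖y‖ ^ 2 := by simp; ring
  linarith

theorem qF_sub (A : Matrix (Fin n) (Fin n) ℝ) (x y : EE n) :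
    qF A (x - y) = qF A x - 2 * ∑ j, bB A j x * y j + qF A y := by
  have e : ∑ j, bB A j x * y j = ∑ j, x j * y j + ∑ k, (∑ i, A k i * x i) * ∑ j, A k j * y j := by
    unfold bB
    simp only [add_mul, Finset.sum_add_distrib]
    congr 1
    have e0 : ∀ j, (∑ k, (∑ i, A k i * x i) * A k j) * y j = ∑ k, (∑ i, A k i * x i) * (A k j * y j) := fun j => by
      rw [Finset.sum_mul]
      exact Finset.sum_congr rfl fun k _ => mul_assoc _ _ _
    simp only [e0]
    rw [Finset.sum_comm]
    exact Finset.sum_congr rfl fun k _ => (Finset.mul_sum _ _ _).symm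
  rw [e]
  unfold qF
  have e1 : ∀ k, ∑ j, A k j * (x - y) j = ∑ j, A k j * x j - ∑ j, A k j * y j := fun k => by
    rw [← Finset.sum_sub_distrib]
    exact Finset.sum_congr rfl fun j _ => by simp; ring
  simp only [e1]
  generalize hp : (fun k => ∑ j, A k j * x j) = p
  generalize hr : (fun k => ∑ j, A k j * y j) = r
  have hp' : ∀ k, ∑ j, A k j * x j = p k := fun k => congrFun hp k
  have hr' : ∀ k, ∑ j, A k j * y j = r k := fun k => congrFun hr k
  simp only [hp', hr', PiLp.sub_apply, mul_add, Finset.mul_sum]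
  have key : ∀ a b : Fin n → ℝ, ∑ i, (a i - b i) ^ 2 = ∑ i, a i ^ 2 - ∑ i, 2 * (a i * b i) + ∑ i, b i ^ 2 := by
    intro a b
    rw [← Finset.sum_sub_distrib, ← Finset.sum_add_distrib]
    exact Finset.sum_congr rfl fun i _ => by ring
  rw [key, key]
  ring

theorem max_taylor (a s : ℝ) : |max (a + s) 0 ^ 2 - max a 0 ^ 2 - 2 * max a 0 * s| ≤ s ^ 2 := by
  rw [abs_le]
  rcases le_total a 0 with h | h <;> rcases le_total (a + s) 0 with h' | h' <;>
    simp only [max_eq_left h, max_eq_right h, max_eq_left h', max_eq_right h'] <;> constructor <;> nlinarith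

theorem MM_taylor (n : ℕ) : ∃ K : ℝ, 0 < K ∧ ∀ (A : Matrix (Fin n) (Fin n) ℝ), (∀ i j, |A i j| ≤ 4) →
    ∀ x y : EE n, ‖x‖ ≤ 1 / 4 → ‖y‖ ≤ 1 / 8 →
    |MM A y x ^ 2 - MM A 0 x ^ 2 - 256 * MM A 0 x * ∑ j, bB A j x * y j| ≤ K * ‖y‖ ^ 2 := by
  refine ⟨(128 * (n * (1 + 4 * n ^ 2)) + 64 * (1 + 16 * n ^ 3)) ^ 2 + 128 * (1 + 16 * n ^ 3), by positivity, ?_⟩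
  intro A hA x y hx hy
  have hq := qF_up hA y
  have hq0 : 0 ≤ qF A y := le_trans (by positivity) (qF_ge A y)
  have hb : |∑ j, bB A j x * y j| ≤ n * (1 + 4 * n ^ 2) * ‖y‖ := by
    calc _ ≤ ∑ j, |bB A j x * y j| := Finset.abs_sum_le_sum_abs _ _
      _ ≤ ∑ j : Fin n, (1 + 4 * (n:ℝ) ^ 2) * ‖y‖ := Finset.sum_le_sum fun j _ => by
          rw [abs_mul]
          exact mul_le_mul (bB_le hA hx j) (coord_le y j) (abs_nonneg _) (by positivity)
      _ = _ := by simp; ring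
  set β := ∑ j, bB A j x * y j with hβ
  have h0 : MM A 0 x = max (1 - 64 * qF A x) 0 := by
    unfold MM; rw [sub_zero]; congr 1; ring
  have hy' : MM A y x = max ((1 - 64 * qF A x) + (128 * β - 64 * qF A y)) 0 := by
    unfold MM; rw [qF_sub, ← hβ]; congr 1; ring
  have ht := max_taylor (1 - 64 * qF A x) (128 * β - 64 * qF A y)
  rw [← h0, ← hy'] at ht
  have m0 : 0 ≤ MM A 0 x := MM_nonneg
  have m1 : MM A 0 x ≤ 1 := MM_le_one
  have hs : |128 * β - 64 * qF A y| ≤ (128 * (n * (1 + 4 * n ^ 2)) + 64 * (1 + 16 * n ^ 3)) * ‖y‖ := by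
    refine (abs_sub _ _).trans ?_
    rw [abs_mul, abs_mul, abs_of_nonneg hq0]
    have h3 : ‖y‖ ^ 2 ≤ ‖y‖ := by nlinarith [norm_nonneg y]
    have h4 : qF A y ≤ (1 + 16 * n ^ 3) * ‖y‖ := hq.trans (by gcongr)
    norm_num
    nlinarith
  have hs2 : (128 * β - 64 * qF A y) ^ 2 ≤ (128 * (n * (1 + 4 * n ^ 2)) + 64 * (1 + 16 * n ^ 3)) ^ 2 * ‖y‖ ^ 2 := by
    rw [← sq_abs, ← mul_pow]
    gcongr
  have hm : MM A 0 x * qF A y ≤ (1 + 16 * n ^ 3) * ‖y‖ ^ 2 :=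
    (mul_le_of_le_one_left hq0 m1).trans hq
  have hm0 : 0 ≤ MM A 0 x * qF A y := by positivity
  rw [abs_le] at ht ⊢
  rw [add_mul]
  constructor <;> nlinarith [ht.1, ht.2]

theorem int_taylor (n : ℕ) : ∃ K : ℝ, 0 < K ∧ ∀ (A : Matrix (Fin n) (Fin n) ℝ), (∀ i j, |A i j| ≤ 4) →
    ∀ (f : EE n → ℝ) (ϑ : ℝ), Continuous f → 0 ≤ ϑ → (∀ x, ‖x‖ ≤ 1 / 4 → |f x| ≤ ϑ) →
    ∀ y : EE n, ‖y‖ ≤ 1 / 8 →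
    |(∫ x, MM A y x ^ 2 * f x) - (∫ x, MM A 0 x ^ 2 * f x)
      - ∑ j, (256 * ∫ x, MM A 0 x * bB A j x * f x) * y j| ≤ K * ϑ * ‖y‖ ^ 2 := by
  obtain ⟨K, hK, h⟩ := MM_taylor n
  have hv := v1_pos n
  refine ⟨K * (v1 n * (1 / 4) ^ n), by positivity, ?_⟩
  intro A hA f ϑ cf hϑ hf y hy
  have cy := MM_cont A y
  have c0 := MM_cont A 0
  have cb := bB_cont A
  have i1 : Integrable (fun x => MM A y x ^ 2 * f x) :=
    MM_int (A := A) (y := y) (by fun_prop) (fun x h => by rw [h]; simp)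
  have i2 : Integrable (fun x => MM A 0 x ^ 2 * f x) :=
    MM_int (A := A) (y := 0) (by fun_prop) (fun x h => by rw [h]; simp)
  have i3 : ∀ j, Integrable (fun x => 256 * y j * (MM A 0 x * bB A j x * f x)) := fun j =>
    MM_int (A := A) (y := 0) (by have := cb j; fun_prop) (fun x h => by rw [h]; simp)
  have e : ∑ j, (256 * ∫ x, MM A 0 x * bB A j x * f x) * y j
      = ∫ x, ∑ j, 256 * y j * (MM A 0 x * bB A j x * f x) := by
    rw [integral_finsetSum _ (fun j _ => i3 j)]
    refine Finset.sum_congr rfl fun j _ => ?_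
    rw [integral_const_mul]; ring
  have i4 : Integrable (fun x => MM A y x ^ 2 * f x - MM A 0 x ^ 2 * f x) := i1.sub i2
  rw [e, ← integral_sub i1 i2, ← integral_sub i4 (integrable_finsetSum _ fun j _ => i3 j)]
  refine abs_integral_le_integral_abs.trans ?_
  have hz : ∀ x : EE n, 1 / 4 < ‖x‖ → MM A y x = 0 ∧ MM A 0 x = 0 := fun x hx => by
    refine ⟨MM_zero ?_, MM_zero (by rw [sub_zero]; linarith)⟩
    have := norm_sub_norm_le x y
    linarith
  have := int_le_ball (0 : EE n) (r := 1 / 4) (M := K * ϑ * ‖y‖ ^ 2)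
    (f := fun x => |MM A y x ^ 2 * f x - MM A 0 x ^ 2 * f x
      - ∑ j, 256 * y j * (MM A 0 x * bB A j x * f x)|)
    (by norm_num) (by positivity) ?_ ?_
  · refine this.trans (le_of_eq (by ring))
  · intro x
    by_cases hx' : ‖x‖ ≤ 1 / 4
    swap
    · have h0 := hz x (not_le.1 hx')
      simp only [h0.1, h0.2]
      simp
      positivity
    have e2 : MM A y x ^ 2 * f x - MM A 0 x ^ 2 * f x
      - ∑ j, 256 * y j * (MM A 0 x * bB A j x * f x)
      = (MM A y x ^ 2 - MM A 0 x ^ 2 - 256 * MM A 0 x * ∑ j, bB A j x * y j) * f x := by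
      rw [sub_mul, sub_mul, Finset.mul_sum, Finset.sum_mul]
      congr 1
      exact Finset.sum_congr rfl fun j _ => by ring
    simp only [e2, abs_mul]
    calc _ ≤ K * ‖y‖ ^ 2 * ϑ := mul_le_mul (h A hA x y hx' hy) (hf x hx') (abs_nonneg _) (by positivity)
      _ = _ := by ring
  · intro x hx
    have := hz x (by simpa using hx)
    simp [this.1, this.2]

theorem o0_up (n : ℕ) : ∃ K : ℝ, 0 < K ∧ ∀ (A : Matrix (Fin n) (Fin n) ℝ), (∀ i j, |A i j| ≤ 4) → o0 A ≤ K := by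
  obtain ⟨K, hK, h⟩ := det_lip n
  refine ⟨1 + (1 + K * Real.sqrt (∑ i : Fin n, ∑ j : Fin n, 16)), by positivity, fun A hA => ?_⟩
  have h1 := h A 0 hA (by simp)
  simp only [Matrix.zero_apply, sub_zero, Matrix.transpose_zero, Matrix.mul_zero, add_zero, Matrix.det_one] at h1
  have h2 : Real.sqrt (∑ i, ∑ j, A i j ^ 2) ≤ Real.sqrt (∑ i : Fin n, ∑ j : Fin n, 16) := by
    refine Real.sqrt_le_sqrt (Finset.sum_le_sum fun i _ => Finset.sum_le_sum fun j _ => ?_)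
    rw [← sq_abs]; nlinarith [hA i j, abs_nonneg (A i j)]
  have h3 := (abs_le.1 h1).2
  have h4 := mul_le_mul_of_nonneg_left h2 hK.le
  have h5 : o0 A ≤ 1 + |(1 + Aᵀ * A).det| := by
    unfold o0
    have := abs_nonneg (1 + Aᵀ * A).det
    rw [Real.sqrt_le_left (by linarith)]
    nlinarith [le_abs_self (1 + Aᵀ * A).det]
  have h6 : |(1 + Aᵀ * A).det| ≤ 1 + K * Real.sqrt (∑ i, ∑ j, A i j ^ 2) := by
    rw [abs_le] at h1 ⊢
    constructor <;> linarith [h1.1, h1.2]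
  linarith

theorem decay (n : ℕ) : ∃ τ η : ℝ, 0 < τ ∧ τ < 1 ∧ 0 < η ∧ η ≤ 1 ∧ ∀ (d : ℝ) (u : EE n → ℝ)
    (A : Matrix (Fin n) (Fin n) ℝ) (b : Fin n → ℝ)
    (ϑ : ℝ), Sol d u → 0 < ϑ → ϑ ≤ η → (∀ x : EE n, ‖x‖ ≤ 1 → ∀ k, |fF u A b k x| ≤ ϑ) →
    ∃ (A' : Matrix (Fin n) (Fin n) ℝ) (b' : Fin n → ℝ), ∀ y : EE n, ‖y‖ ≤ τ → ∀ k,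
      |fF u A' b' k y| ≤ τ * (ϑ / 2) := by
  obtain ⟨C1, hC1, h1⟩ := approx n
  obtain ⟨C2, hC2, h2⟩ := int_taylor n
  obtain ⟨C3, hC3, h3⟩ := o0_up n
  have hc := cN_pos n
  obtain ⟨C, hC, hCa, hCb⟩ : ∃ C : ℝ, 0 < C ∧ C1 ≤ cN n * C ∧ 8 ^ n * (C3 * C2) ≤ cN n * C := by
    refine ⟨(C1 + 8 ^ n * (C3 * C2)) / cN n, by positivity, ?_, ?_⟩ <;>
      rw [mul_div_cancel₀ _ hc.ne']
    · have : 0 < 8 ^ n * (C3 * C2) := by positivity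
      linarith
    · linarith
  set τ := min (1 / 8) (1 / (4 * C)) with hτ
  have τ0 : 0 < τ := by positivity
  have τ1 : τ ≤ 1 / 8 := min_le_left _ _
  have τ2 : C * τ ≤ 1 / 4 := by
    have : τ ≤ 1 / (4 * C) := min_le_right _ _
    rw [le_div_iff₀ (by positivity)] at this
    linarith
  set η := min 1 (τ / (4 * C)) with hη
  have η0 : 0 < η := by positivity
  have η2 : C * η ≤ τ / 4 := by
    have : η ≤ τ / (4 * C) := min_le_right _ _
    rw [le_div_iff₀ (by positivity)] at this
    linarith
  refine ⟨τ, η, τ0, by linarith, η0, min_le_left _ _, ?_⟩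
  intro d u A b ϑ hs hϑ hϑη hf
  have hϑ1 : ϑ ≤ 1 := hϑη.trans (min_le_left _ _)
  have hA := A_entry hs hϑ1 hf
  set s : ℝ := 8 ^ n * o0 A / cN n with hsd
  have ho := o0_pos A
  refine ⟨A + Matrix.of fun k j => s * (256 * ∫ x, MM A 0 x * bB A j x * fF u A b k x),
    fun k => b k + s * ∫ x, MM A 0 x ^ 2 * fF u A b k x, fun y hy k => ?_⟩
  have p1 := h1 d u A b ϑ hs hϑ hϑ1 hf y (hy.trans τ1) k
  have p2 := h2 A hA (fF u A b k) ϑ (Sm_f hs.sm A b k).cont hϑ.le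
    (fun x hx => hf x (hx.trans (by norm_num)) k) y (hy.trans τ1)
  have e : fF u (A + Matrix.of fun k j => s * (256 * ∫ x, MM A 0 x * bB A j x * fF u A b k x))
      (fun k => b k + s * ∫ x, MM A 0 x ^ 2 * fF u A b k x) k y
      = fF u A b k y - s * ((∑ j, (256 * ∫ x, MM A 0 x * bB A j x * fF u A b k x) * y j)
        + ∫ x, MM A 0 x ^ 2 * fF u A b k x) := by
    have e1 : ∑ j, (A + Matrix.of fun k j => s * (256 * ∫ x, MM A 0 x * bB A j x * fF u A b k x)) k j * y j
        = ∑ j, A k j * y j + s * ∑ j, (256 * ∫ x, MM A 0 x * bB A j x * fF u A b k x) * y j := by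
      rw [Finset.mul_sum, ← Finset.sum_add_distrib]
      refine Finset.sum_congr rfl fun j _ => ?_
      rw [Matrix.add_apply, Matrix.of_apply]
      generalize (∫ x, MM A 0 x * bB A j x * fF u A b k x) = Z
      ring
    rw [fF, e1, fF]
    generalize (∫ x, MM A 0 x ^ 2 * fF u A b k x) = Z
    ring
  rw [e]
  generalize (∑ j, (256 * ∫ x, MM A 0 x * bB A j x * fF u A b k x) * y j) = S at *
  generalize (∫ x, MM A 0 x ^ 2 * fF u A b k x) = Z at *
  generalize (∫ x, MM A y x ^ 2 * fF u A b k x) = W at *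
  generalize fF u A b k y = F at *
  have hs' : cN n * s = 8 ^ n * o0 A := by rw [hsd]; field_simp
  have e3 : cN n * (F - s * (S + Z)) = (cN n * F - 8 ^ n * (o0 A * W)) + 8 ^ n * o0 A * (W - Z - S) := by
    rw [mul_sub, ← mul_assoc, hs']; ring
  have h6 : cN n * |F - s * (S + Z)| ≤ cN n * (C * ϑ ^ 2 + C * (ϑ * ‖y‖ ^ 2)) := by
    rw [← abs_of_pos hc, ← abs_mul, abs_of_pos hc, e3]
    refine (abs_add_le _ _).trans ?_
    rw [abs_mul, abs_of_pos (by positivity : 0 < 8 ^ n * o0 A)]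
    have q1 : 8 ^ n * o0 A * |W - Z - S| ≤ 8 ^ n * C3 * (C2 * ϑ * ‖y‖ ^ 2) := by
      have := h3 A hA
      gcongr
    have q2 : 8 ^ n * C3 * (C2 * ϑ * ‖y‖ ^ 2) ≤ cN n * C * (ϑ * ‖y‖ ^ 2) := by
      have := mul_le_mul_of_nonneg_right hCb (by positivity : 0 ≤ ϑ * ‖y‖ ^ 2)
      linarith
    have q3 : C1 * ϑ ^ 2 ≤ cN n * C * ϑ ^ 2 := by gcongr
    linarith
  have h7 := le_of_mul_le_mul_left h6 hc
  refine h7.trans ?_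
  have r1 : C * ϑ ^ 2 ≤ τ / 4 * ϑ := by
    have : C * ϑ ≤ τ / 4 := le_trans (by gcongr) η2
    nlinarith
  have r2 : C * (ϑ * ‖y‖ ^ 2) ≤ τ / 4 * ϑ := by
    have : C * ‖y‖ ^ 2 ≤ C * τ ^ 2 := by gcongr
    have : C * ‖y‖ ^ 2 ≤ τ / 4 := by nlinarith
    nlinarith
  linarith
end taylor

open MeasureTheory Set Filter Topology
open scoped ContDiff Matrix

section concl
variable {n : ℕ} {u : EE n → ℝ} {x y : EE n} {d : ℝ}

theorem flat_iter {τ η : ℝ} (hτ : 0 < τ) (hη : 0 < η)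
    (hdec : ∀ (d : ℝ) (u : EE n → ℝ)
    (A : Matrix (Fin n) (Fin n) ℝ) (b : Fin n → ℝ)
    (ϑ : ℝ), Sol d u → 0 < ϑ → ϑ ≤ η → (∀ x : EE n, ‖x‖ ≤ 1 → ∀ k, |fF u A b k x| ≤ ϑ) →
    ∃ (A' : Matrix (Fin n) (Fin n) ℝ) (b' : Fin n → ℝ), ∀ y : EE n, ‖y‖ ≤ τ → ∀ k,
      |fF u A' b' k y| ≤ τ * (ϑ / 2))
    (hs : Sol d u) {R : ℝ} (hR : 0 < R)
    (h0 : ∃ A b, ∀ x : EE n, ‖x‖ ≤ 1 → ∀ k, |fF (scU R u) A b k x| ≤ η) (m : ℕ) :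
    ∃ A b, ∀ x : EE n, ‖x‖ ≤ 1 → ∀ k, |fF (scU (R * τ ^ m) u) A b k x| ≤ η / 2 ^ m := by
  induction m with
  | zero => simpa using h0
  | succ m ih =>
    obtain ⟨A, b, h⟩ := ih
    have hS : 0 < R * τ ^ m := by positivity
    have hv := Sol_scU hs hS
    obtain ⟨A', b', h'⟩ := hdec d _ A b (η / 2 ^ m) hv (by positivity)
      (div_le_self hη.le (one_le_pow₀ (by norm_num))) h
    refine ⟨A', fun k => τ⁻¹ * b' k, fun x hx k => ?_⟩
    have e : R * τ ^ (m + 1) = (R * τ ^ m) * τ := by ring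
    rw [e, ← scU_scU, fF_scU hv.sm hτ, abs_mul, abs_of_pos (by positivity)]
    have hx' : ‖τ • x‖ ≤ τ := by
      rw [norm_smul, Real.norm_of_nonneg hτ.le]
      exact mul_le_of_le_one_right hτ.le hx
    have := h' _ hx' k
    calc _ ≤ τ⁻¹ * (τ * (η / 2 ^ m / 2)) := by gcongr
      _ = _ := by field_simp; ring

theorem second_diff (hu : Sm u) {S ϑ : ℝ} (hS : 0 < S) {A : Matrix (Fin n) (Fin n) ℝ} {b : Fin n → ℝ}
    (hf : ∀ x : EE n, ‖x‖ ≤ 1 → ∀ k, |fF (scU S u) A b k x| ≤ ϑ) (k : Fin n) (x h : EE n)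
    (h0 : ‖x‖ ≤ S) (h1 : ‖x + h‖ ≤ S) (h2 : ‖x - h‖ ≤ S) :
    |pd k u (x + h) + pd k u (x - h) - 2 * pd k u x| ≤ 4 * S * ϑ := by
  have key : ∀ z : EE n, ‖z‖ ≤ S → |S⁻¹ * pd k u z - S⁻¹ * ∑ j, A k j * z j - b k| ≤ ϑ := by
    intro z hz
    have hz' : ‖S⁻¹ • z‖ ≤ 1 := by
      rw [norm_smul, norm_inv, Real.norm_of_nonneg hS.le, inv_mul_le_iff₀ hS]; linarith
    have := hf _ hz' k
    unfold fF at this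
    rw [pd_scU hu hS] at this
    simp only [smul_smul] at this
    rw [mul_inv_cancel₀ hS.ne', one_smul] at this
    convert this using 3
    congr 1
    rw [Finset.mul_sum]
    exact Finset.sum_congr rfl fun j _ => by simp; ring
  have a0 := abs_le.1 (key _ h0)
  have a1 := abs_le.1 (key _ h1)
  have a2 := abs_le.1 (key _ h2)
  have e : ∑ j, A k j * (x + h) j + ∑ j, A k j * (x - h) j = 2 * ∑ j, A k j * x j := by
    rw [Finset.mul_sum, ← Finset.sum_add_distrib]
    exact Finset.sum_congr rfl fun j _ => by simp; ring
  have e2 : S⁻¹ * ∑ j, A k j * (x + h) j + S⁻¹ * ∑ j, A k j * (x - h) j = 2 * (S⁻¹ * ∑ j, A k j * x j) := by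
    rw [← mul_add, e]; ring
  have e3 : pd k u (x + h) + pd k u (x - h) - 2 * pd k u x
      = S * (S⁻¹ * pd k u (x + h) + S⁻¹ * pd k u (x - h) - 2 * (S⁻¹ * pd k u x)) := by
    field_simp
  rw [e3, abs_mul, abs_of_pos hS, mul_comm 4 S, mul_assoc]
  refine mul_le_mul_of_nonneg_left ?_ hS.le
  rw [abs_le]
  constructor <;> linarith [a0.1, a0.2, a1.1, a1.2, a2.1, a2.2]

theorem rigid (hn : 4 ≤ n) : ∃ d0 : ℝ, 0 < d0 ∧ d0 ≤ 0.03 ∧ ∀ u : EE n → ℝ, Sol d0 u →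
    ∀ k (x h : EE n), pd k u (x + h) + pd k u (x - h) - 2 * pd k u x = 0 := by
  obtain ⟨τ, η, τ0, τ1, η0, -, hdec⟩ := decay n
  obtain ⟨d0, hd0, hd1, hst⟩ := start_flat hn η0
  refine ⟨d0, hd0, hd1, fun u hs k x h => ?_⟩
  set ρ := ‖x‖ + ‖h‖ + 1 with hρ
  have ρ0 : 0 < ρ := by positivity
  have hx1 : ‖x + h‖ ≤ ‖x‖ + ‖h‖ := norm_add_le _ _
  have hx2 : ‖x - h‖ ≤ ‖x‖ + ‖h‖ := norm_sub_le _ _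
  have hh := norm_nonneg h
  have main : ∀ N : ℕ, |pd k u (x + h) + pd k u (x - h) - 2 * pd k u x| ≤ (4 * (ρ / τ) * η) * (1 / 2) ^ N := by
    intro N
    obtain ⟨R, hR, hfl⟩ := hst u hs (ρ / τ ^ N) (by positivity)
    have R0 : 0 < R := lt_of_lt_of_le (by positivity) hR
    have hRN : ρ / R ≤ τ ^ N := by
      rw [div_le_iff₀ (by positivity)] at hR ⊢
      linarith
    obtain ⟨m, hm1, hm2⟩ := exists_nat_pow_near_of_lt_one (x := ρ / R) (by positivity)
      (hRN.trans (pow_le_one₀ τ0.le τ1.le)) τ0 τ1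
    have hmN : N ≤ m := by
      by_contra hc
      have : τ ^ N ≤ τ ^ (m + 1) := pow_le_pow_of_le_one τ0.le τ1.le (by omega)
      linarith
    obtain ⟨A, b, hAb⟩ := flat_iter τ0 η0 hdec hs R0 hfl m
    have S0 : 0 < R * τ ^ m := by positivity
    have S1 : ρ ≤ R * τ ^ m := by
      rw [div_le_iff₀ R0] at hm2; linarith
    have S2 : R * τ ^ m ≤ ρ / τ := by
      rw [lt_div_iff₀ R0] at hm1
      rw [le_div_iff₀ τ0]
      rw [pow_succ] at hm1; linarith
    refine (second_diff hs.sm S0 hAb k x h (by linarith) (by linarith) (by linarith)).trans ?_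
    have h2 : η / 2 ^ m ≤ η * (1 / 2) ^ N := by
      rw [div_eq_mul_inv, ← inv_pow, one_div]
      exact mul_le_mul_of_nonneg_left (pow_le_pow_of_le_one (by norm_num) (by norm_num) hmN) η0.le
    calc _ ≤ 4 * (ρ / τ) * (η * (1 / 2) ^ N) := by gcongr
      _ = _ := by ring
  have ht : Tendsto (fun N : ℕ => (4 * (ρ / τ) * η) * (1 / 2 : ℝ) ^ N) atTop (𝓝 ((4 * (ρ / τ) * η) * 0)) :=
    (tendsto_pow_atTop_nhds_zero_of_lt_one (by norm_num) (by norm_num)).const_mul _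
  rw [mul_zero] at ht
  exact abs_nonpos_iff.1 (ge_of_tendsto' ht main)

theorem pd_lin (hu : Sm u) (h : ∀ k (x h : EE n), pd k u (x + h) + pd k u (x - h) - 2 * pd k u x = 0)
    (k : Fin n) (x : EE n) : pd k u x = pd k u 0 + ∑ j, Hm u 0 k j * x j := by
  have hs : ∀ t : ℝ, pd k u (0 + t • x) + pd k u (0 + t • (-x)) = 2 * pd k u 0 := fun t => by
    have := h k 0 (t • x)
    simp only [zero_add, zero_sub, smul_neg] at this ⊢
    linarith
  have hadd : ∀ a b : EE n, (pd k u (a + b) - pd k u 0) = (pd k u a - pd k u 0) + (pd k u b - pd k u 0) := by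
    intro a b
    have p1 := h k ((1 / 2 : ℝ) • (a + b)) ((1 / 2 : ℝ) • (a + b))
    have p2 := h k ((1 / 2 : ℝ) • (a + b)) ((1 / 2 : ℝ) • (a - b))
    have e1 : (1 / 2 : ℝ) • (a + b) + (1 / 2 : ℝ) • (a + b) = a + b := by module
    have e2 : (1 / 2 : ℝ) • (a + b) + (1 / 2 : ℝ) • (a - b) = a := by module
    have e3 : (1 / 2 : ℝ) • (a + b) - (1 / 2 : ℝ) • (a - b) = b := by module
    rw [e1, sub_self] at p1
    rw [e2, e3] at p2
    linarith
  let φ : EE n →+ ℝ := AddMonoidHom.mk' (fun a => pd k u a - pd k u 0) hadd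
  have hc : Continuous φ := ((hu.pd k).cont).sub continuous_const
  let L := φ.toRealLinearMap hc
  have hL : ∀ a, pd k u a = L a + pd k u 0 := fun a => by
    change pd k u a = (pd k u a - pd k u 0) + pd k u 0
    ring
  have hfd : ∀ a, fderiv ℝ (pd k u) a = L := fun a => by
    have : pd k u = fun a => L a + pd k u 0 := funext hL
    rw [this, fderiv_add_const]
    exact L.fderiv
  rw [hL x, add_comm]
  congr 1
  rw [← hfd 0, fderiv_coord]
  refine Finset.sum_congr rfl fun j _ => ?_
  rw [Hm_apply, pd_comm hu]

theorem quad (hu : Sm u) (h : ∀ k (x h : EE n), pd k u (x + h) + pd k u (x - h) - 2 * pd k u x = 0) (x : EE n) :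
    u x = (1 / 2) * ∑ i, ∑ j, Hm u 0 i j * x i * x j + ∑ i, pd i u 0 * x i + u 0 := by
  set Q := ∑ i, ∑ j, Hm u 0 i j * x i * x j with hQ
  set P := ∑ i, pd i u 0 * x i with hP
  have hd : ∀ t : ℝ, HasDerivAt (fun t : ℝ => u (0 + t • x) - (t ^ 2 / 2 * Q + t * P)) 0 t := by
    intro t
    have h1 := line_deriv2 hu 0 x t
    have h2 : HasDerivAt (fun t : ℝ => t ^ 2 / 2 * Q + t * P) (t * Q + P) t := by
      have := (((hasDerivAt_pow 2 t).div_const 2).mul_const Q).add ((hasDerivAt_id t).mul_const P)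
      refine this.congr_deriv ?_
      simp
    refine (h1.sub h2).congr_deriv ?_
    rw [sub_eq_zero, hQ, hP, Finset.mul_sum, ← Finset.sum_add_distrib]
    refine Finset.sum_congr rfl fun k _ => ?_
    rw [pd_lin hu h, add_mul, add_comm, Finset.mul_sum, Finset.sum_mul]
    congr 1
    refine Finset.sum_congr rfl fun j _ => ?_
    simp; ring
  have hconst := is_const_of_deriv_eq_zero (fun t => (hd t).differentiableAt) (fun t => (hd t).deriv) 1 0
  simp at hconst
  linarith
end concl

open MeasureTheory Set Filter Topology
open scoped ContDiff Matrix



section final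
variable {n : ℕ} {u : EE n → ℝ} {x : EE n}

theorem Hess_eq (hu : Sm u) : Hess u x = Hm u x := by
  ext i j
  have h1 : ContDiff ℝ ∞ (fderiv ℝ u) := ContDiff.fderiv_right hu (by simp)
  have hd : DifferentiableAt ℝ (fderiv ℝ u) x := h1.differentiable (by simp) x
  rw [Hess, Matrix.of_apply, iteratedFDeriv_two_apply, Hm_apply]
  unfold pd
  rw [fderiv_clm_apply hd (differentiableAt_const _)]
  simp

theorem spec_of {H : Matrix (Fin n) (Fin n) ℝ} (hh : H.IsHermitian) :
    ∃ (O : Matrix (Fin n) (Fin n) ℝ), O * Oᵀ = 1 ∧ Oᵀ * O = 1 ∧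
      H = O * Matrix.diagonal hh.eigenvalues * Oᵀ := by
  refine ⟨(hh.eigenvectorUnitary : Matrix (Fin n) (Fin n) ℝ), ?_, ?_, ?_⟩
  · have := Unitary.coe_mul_star_self hh.eigenvectorUnitary
    rwa [Unitary.coe_star, Matrix.star_eq_conjTranspose, Matrix.conjTranspose_eq_transpose_of_trivial] at this
  · have := Unitary.coe_star_mul_self hh.eigenvectorUnitary
    rwa [Matrix.star_eq_conjTranspose, Matrix.conjTranspose_eq_transpose_of_trivial] at this
  · have := hh.spectral_theorem
    rw [Unitary.conjStarAlgAut_apply, Matrix.star_eq_conjTranspose,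
      Matrix.conjTranspose_eq_transpose_of_trivial] at this
    simpa [Function.comp_def] using this

theorem orth_nrm2 {O : Matrix (Fin n) (Fin n) ℝ} (h : Oᵀ * O = 1) (v : Fin n → ℝ) :
    ∑ i, (O *ᵥ v) i ^ 2 = ∑ i, v i ^ 2 := by
  have e : ∀ w : Fin n → ℝ, ∑ i, w i ^ 2 = w ⬝ᵥ w := fun w => by
    simp [dotProduct, sq]
  rw [e, e, Matrix.dotProduct_mulVec, ← Matrix.mulVec_transpose, Matrix.mulVec_mulVec, h, Matrix.one_mulVec]

theorem arctan_pt (l : ℝ) : (1 + Complex.I * (l : ℂ)) = (Real.sqrt (1 + l ^ 2) : ℂ) * Complex.exp (Complex.I * Real.arctan l) := by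
  have hs : Real.sqrt (1 + l ^ 2) ≠ 0 := (Real.sqrt_pos.2 (by positivity)).ne'
  rw [mul_comm Complex.I (Real.arctan l : ℂ), Complex.exp_mul_I, ← Complex.ofReal_cos, ← Complex.ofReal_sin,
    Real.cos_arctan, Real.sin_arctan]
  push_cast
  have hs' : ((Real.sqrt (1 + l ^ 2) : ℝ) : ℂ) ≠ 0 := by exact_mod_cast hs
  field_simp

theorem mk_sol {c d0 : ℝ} (h0 : 0 < d0) (h1 : d0 ≤ 0.03) (hu : Sm u)
    (hsym : ∀ x : EE n, (Hess u x).IsHermitian)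
    (heq : ∀ x, ∑ i, Real.arctan ((hsym x).eigenvalues i) = c)
    (hbd : ∀ x, ∀ i : Fin n, |(hsym x).eigenvalues i| ≤ Real.sqrt 3 + d0) : Sol d0 u where
  sm := hu
  hd0 := h0.le
  hd := h1
  bd := by
    intro x v
    obtain ⟨O, h1, h2, hH⟩ := spec_of (hsym x)
    replace hH := (Hess_eq hu).symm.trans hH
    have e : ∀ i, ∑ j, Hm u x i j * v j = (Hm u x *ᵥ v) i := fun i => rfl
    simp only [e]
    rw [hH, ← Matrix.mulVec_mulVec, ← Matrix.mulVec_mulVec, orth_nrm2 h2,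
      ← orth_nrm2 (O := Oᵀ) (by rw [Matrix.transpose_transpose]; exact h1) v, Finset.mul_sum]
    refine Finset.sum_le_sum fun i _ => ?_
    rw [Matrix.mulVec_diagonal, mul_pow]
    refine mul_le_mul_of_nonneg_right ?_ (sq_nonneg _)
    rw [← sq_abs]
    have h3 : (1:ℝ) ≤ Real.sqrt 3 := Real.one_le_sqrt.2 (by norm_num)
    have h4 : Real.sqrt 3 ^ 2 = 3 := Real.sq_sqrt (by norm_num)
    calc _ ≤ (Real.sqrt 3 * (1 + d0)) ^ 2 := by
          have : |(hsym x).eigenvalues i| ≤ Real.sqrt 3 * (1 + d0) := (hbd x i).trans (by nlinarith)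
          gcongr
      _ = _ := by rw [mul_pow, h4]
  eq := by
    refine ⟨Complex.exp (Complex.I * c), Complex.exp_ne_zero _, fun x => ?_⟩
    obtain ⟨O, h1, h2, hH⟩ := spec_of (hsym x)
    replace hH := (Hess_eq hu).symm.trans hH
    have hom : om u x = ∏ i, Real.sqrt (1 + (hsym x).eigenvalues i ^ 2) := by
      unfold om gm
      rw [spec_det h2 h1 hH, Real.sqrt_prod _ (fun i _ => by positivity)]
    have hc : Complex.exp (Complex.I * c)
        = ∏ i, Complex.exp (Complex.I * Real.arctan ((hsym x).eigenvalues i)) := by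
      rw [← Complex.exp_sum, ← Finset.mul_sum, ← heq x]
      push_cast; rfl
    rw [hom, hc, Complex.ofReal_prod]
    rw [← Finset.prod_mul_distrib]
    simp only [← arctan_pt]
    set P := Complex.ofRealHom.mapMatrix O with hP
    have hPP : P * Complex.ofRealHom.mapMatrix Oᵀ = 1 := by
      rw [hP, ← map_mul, h1, map_one]
    have hD : Complex.ofRealHom.mapMatrix (Matrix.diagonal (hsym x).eigenvalues)
        = Matrix.diagonal (fun i => ((hsym x).eigenvalues i : ℂ)) := by
      ext i j
      by_cases hij : i = j
      · subst hij; simp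
      · simp [hij]
    have e : (1 : Matrix (Fin n) (Fin n) ℂ) + Complex.I • Complex.ofRealHom.mapMatrix (Hm u x)
        = P * Matrix.diagonal (fun i => 1 + Complex.I * ((hsym x).eigenvalues i : ℂ))
          * Complex.ofRealHom.mapMatrix Oᵀ := by
      have e1 : Matrix.diagonal (fun i => 1 + Complex.I * ((hsym x).eigenvalues i : ℂ))
          = 1 + Complex.I • Matrix.diagonal (fun i => ((hsym x).eigenvalues i : ℂ)) := by
        rw [← Matrix.diagonal_one, ← Matrix.diagonal_smul, Matrix.diagonal_add]
        rfl
      rw [e1, Matrix.mul_add, Matrix.add_mul, Matrix.mul_one, hPP]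
      congr 1
      rw [Matrix.mul_smul, Matrix.smul_mul, ← hD, hP, ← map_mul, ← map_mul, ← hH]
    rw [e, Matrix.det_mul, Matrix.det_mul, Matrix.det_diagonal]
    have hdet : P.det * (Complex.ofRealHom.mapMatrix Oᵀ).det = 1 := by
      rw [← Matrix.det_mul, hPP, Matrix.det_one]
    linear_combination (∏ i, (1 + Complex.I * ((hsym x).eigenvalues i : ℂ))) * hdet
end final

/-- For `n ≥ 4` there is `ε'(n) > 0` such that any entire solution with
`|λᵢ| ≤ √3 + ε'(n)` is a quadratic polynomial. -/
theorem stmt_19 {n : ℕ} (hn : 4 ≤ n) :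
    ∃ ε' : ℝ, 0 < ε' ∧
      ∀ (c : ℝ) (u : EuclideanSpace ℝ (Fin n) → ℝ),
        ContDiff ℝ (⊤ : ℕ∞) u →
        ∀ hsym : ∀ x : EuclideanSpace ℝ (Fin n), (Hess u x).IsHermitian,
        (∀ x, ∑ i, Real.arctan ((hsym x).eigenvalues i) = c) →
        (∀ x, ∀ i : Fin n, |(hsym x).eigenvalues i| ≤ Real.sqrt 3 + ε') →
        ∃ (A : Matrix (Fin n) (Fin n) ℝ) (b : Fin n → ℝ) (c₀ : ℝ), A.IsSymm ∧
          ∀ x : EuclideanSpace ℝ (Fin n),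
            u x = (1 / 2) * ∑ i, ∑ j, A i j * x i * x j + ∑ i, b i * x i + c₀ := by
  obtain ⟨d0, h0, h1, hr⟩ := rigid hn
  refine ⟨d0, h0, fun c u hu hsym heq hbd => ?_⟩
  have hu' : Sm u := hu
  have hs := mk_sol h0 h1 hu' hsym heq hbd
  exact ⟨Hm u 0, fun i => pd i u 0, u 0, Hm_symm hu', quad hu' (hr u hs)⟩
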